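/- Fix ε > 0 and set D(x) = exp[C(log x)^{1/2}] for a suitable positive constant C. There is a constant A > 0 such that for all sufficiently large x there exist at least D(x)^{1−ε} integers d ≤ D(x), each a fundamental discriminant with associated real primitive Dirichlet character χ_d, for which (#{(p,q) : p, q prime, pq ≤ x, χ_d(p) = χ_d(q) = 1}) / ((1/4)·#{(p,q) : p, q prime, pq ≤ x, gcd(pq, d) = 1}) ≤ 1 − (log log log x − A)/log log x. -/

import Mathlib

open Filter

/-- The Dirichlet L-function of `χ` (extended by `0` for modulus `0`). -/
noncomputable def LFun (d : ℕ) (χ : DirichletCharacter ℂ d) (s : ℂ) : ℂ :=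
  if h : d ≠ 0 then
    letI : NeZero d := ⟨h⟩
    DirichletCharacter.LFunction χ s
  else 0

/-- `𝓛_χ = Σ_p χ(p)/p` has value `L`: the partial sums over primes `p < y`
converge to `L` as `y → ∞`. -/
def HasCurlyL {d : ℕ} (χ : DirichletCharacter ℂ d) (L : ℝ) : Prop :=
  Filter.Tendsto
    (fun y : ℕ => ∑ p ∈ (Finset.range y).filter Nat.Prime, (χ p).re / (p : ℝ))
    Filter.atTop (nhds L)

/-- Number of ordered pairs `(p, q)` of primes with `p * q ≤ x` satisfying `P p q`. -/
noncomputable def pairCount (x : ℝ) (P : ℕ → ℕ → Prop) : ℕ :=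
  Nat.card {pq : ℕ × ℕ // pq.1.Prime ∧ pq.2.Prime ∧ ((pq.1 * pq.2 : ℕ) : ℝ) ≤ x ∧ P pq.1 pq.2}

/-- The race ratio `#{pq ≤ x : χ(p) = χ(q) = η} / ((1/4) #{pq ≤ x : gcd(pq, d) = 1})`,
where products of two primes are counted as ordered pairs. -/
noncomputable def raceRatio {d : ℕ} (χ : DirichletCharacter ℂ d) (η : ℂ) (x : ℝ) : ℝ :=
  (pairCount x (fun p q => χ p = η ∧ χ q = η) : ℝ) /
    ((1 / 4 : ℝ) * (pairCount x (fun p q => Nat.gcd (p * q) d = 1) : ℝ))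

/-- A positive integer is a fundamental discriminant if it is `≡ 1 (mod 4)` and squarefree,
or is `4m` with `m ≡ 2, 3 (mod 4)` squarefree. -/
def IsFundamentalDiscriminant (d : ℕ) : Prop :=
  0 < d ∧ ((d % 4 = 1 ∧ Squarefree d) ∨
    (d % 4 = 0 ∧ Squarefree (d / 4) ∧ (d / 4 % 4 = 2 ∨ d / 4 % 4 = 3)))

/-- The Generalized Riemann Hypothesis for Dirichlet L-functions: all zeros in the
critical strip lie on the critical line. -/
def GRH : Prop :=
  ∀ (d : ℕ), d ≠ 0 → ∀ (χ : DirichletCharacter ℂ d) (s : ℂ),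
    LFun d χ s = 0 → 0 < s.re → s.re < 1 → s.re = 1 / 2

/-- `L(s, χ)` has no real zero `β` with `1 - c / log d ≤ β ≤ 1` (a Siegel zero). -/
def HasNoSiegelZero (c : ℝ) (d : ℕ) (χ : DirichletCharacter ℂ d) : Prop :=
  ¬ ∃ β : ℝ, 1 - c / Real.log d ≤ β ∧ β ≤ 1 ∧ LFun d χ (β : ℂ) = 0

/-- The logarithmic integral `Li(t) = ∫_2^t du / log u`. -/
noncomputable def Li (t : ℝ) : ℝ := ∫ u in (2:ℝ)..t, 1 / Real.log u


section
open Filter Complex MeasureTheory Set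

noncomputable def frI (t : ℝ) : ℂ := (Set.Ioi (1:ℝ)).indicator (fun t : ℝ => ((Int.fract t : ℝ) : ℂ)) t

lemma frI_norm_le (t : ℝ) : ‖frI t‖ ≤ 1 := by
  unfold frI
  by_cases h : t ∈ Set.Ioi (1:ℝ)
  · rw [Set.indicator_of_mem h, Complex.norm_real, Real.norm_eq_abs, abs_of_nonneg (Int.fract_nonneg t)]
    exact (Int.fract_lt_one t).le
  · rw [Set.indicator_of_notMem h]; simp

lemma frI_meas : Measurable frI := by
  unfold frI
  exact (Complex.measurable_ofReal.comp measurable_fract).indicator measurableSet_Ioi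

lemma frI_diff {s : ℂ} (hs : s.re < 0) : DifferentiableAt ℂ (mellin frI) s := by
  apply mellin_differentiableAt_of_isBigO_rpow (a := 0) (b := s.re - 1)
  · apply LocallyIntegrable.locallyIntegrableOn
    refine (locallyIntegrable_const (1:ℝ)).mono frI_meas.aestronglyMeasurable ?_
    filter_upwards with t
    simpa using frI_norm_le t
  · apply Asymptotics.IsBigO.of_bound 1
    filter_upwards with t
    simpa using frI_norm_le t
  · exact hs
  · apply Asymptotics.IsBigO.of_bound 1
    filter_upwards [mem_nhdsWithin_of_mem_nhds (Iio_mem_nhds (show (0:ℝ) < 1 by norm_num))] with t ht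
    have : frI t = 0 := by
      unfold frI; rw [Set.indicator_of_notMem]; simp only [Set.mem_Ioi, not_lt]; exact le_of_lt ht
    rw [this]; simp
  · linarith

lemma mellin_frI (s : ℂ) : mellin frI (-s) = ∫ t in Set.Ioi (1:ℝ), ((t:ℂ) ^ (-(s+1))) * ((Int.fract t : ℝ) : ℂ) := by
  unfold mellin frI
  have : ∀ t : ℝ, (t:ℂ) ^ (-s - 1) • (Set.Ioi (1:ℝ)).indicator (fun t : ℝ => ((Int.fract t : ℝ) : ℂ)) t
     = (Set.Ioi (1:ℝ)).indicator (fun t : ℝ => ((t:ℂ) ^ (-(s+1))) * ((Int.fract t : ℝ) : ℂ)) t := by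
    intro t
    by_cases h : t ∈ Set.Ioi (1:ℝ)
    · rw [Set.indicator_of_mem h, Set.indicator_of_mem h, smul_eq_mul]; congr 2; ring
    · rw [Set.indicator_of_notMem h, Set.indicator_of_notMem h]; simp
  simp_rw [this]
  rw [setIntegral_indicator measurableSet_Ioi]
  congr 2
  ext t; simp only [mem_inter_iff, mem_Ioi]; constructor
  · exact fun h => h.2
  · intro h; exact ⟨by linarith, h⟩

lemma mellin_frI_bound {s : ℂ} (hs : 0 < s.re) : ‖mellin frI (-s)‖ ≤ 1 / s.re := by
  rw [mellin_frI]
  have h1 : ∀ t ∈ Set.Ioi (1:ℝ), ‖((t:ℂ) ^ (-(s+1))) * ((Int.fract t : ℝ) : ℂ)‖ ≤ t ^ (-(s.re + 1)) := by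
    intro t ht
    have ht0 : (0:ℝ) < t := lt_trans one_pos ht
    rw [norm_mul, Complex.norm_cpow_eq_rpow_re_of_pos ht0, Complex.norm_real, Real.norm_eq_abs, abs_of_nonneg (Int.fract_nonneg t)]
    simp only [neg_re, add_re, one_re]
    exact mul_le_of_le_one_right (by positivity) (Int.fract_lt_one t).le
  refine (norm_integral_le_of_norm_le (integrableOn_Ioi_rpow_of_lt (by linarith) one_pos) (ae_restrict_of_forall_mem measurableSet_Ioi h1)).trans ?_
  rw [integral_Ioi_rpow_of_lt (by linarith) one_pos]
  simp only [Real.one_rpow]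
  apply le_of_eq
  have : -(s.re+1)+1 = - s.re := by ring
  rw [this, neg_div_neg_eq]

lemma zeta1_eq_of_one_lt {s : ℂ} (hs : 1 < s.re) :
    riemannZeta₁ s = s - s * (s - 1) * mellin frI (-s) := by
  have hs1 : s ≠ 1 := by rintro rfl; simp at hs
  have h0 : riemannZeta s = s * ∫ t in Set.Ioi (1 : ℝ), (∑ k ∈ Finset.Icc 1 ⌊t⌋₊, (1:ℂ)) * t ^ (-(s + 1)) := by
    rw [← LSeries_one_eq_riemannZeta hs]
    have := LSeries_eq_mul_integral' (fun _ => (1:ℂ)) (r := 1) zero_le_one hs (by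
      simp only [norm_one, Finset.sum_const, Nat.card_Icc, add_tsub_cancel_right, nsmul_eq_mul, mul_one, Real.rpow_one]
      exact Asymptotics.isBigO_refl _ _)
    exact this
  have hint1 : IntegrableOn (fun t : ℝ => (t:ℂ) ^ (-s)) (Set.Ioi 1) := integrableOn_Ioi_cpow_of_lt (by simpa using hs) one_pos
  have hint2 : IntegrableOn (fun t : ℝ => ((t:ℂ) ^ (-(s+1))) * ((Int.fract t : ℝ) : ℂ)) (Set.Ioi 1) := by
    refine Integrable.mono' (integrableOn_Ioi_rpow_of_lt (a := -(s.re+1)) (by linarith) one_pos) ?_ (ae_restrict_of_forall_mem measurableSet_Ioi ?_)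
    · apply AEStronglyMeasurable.mul
      · exact (integrableOn_Ioi_cpow_of_lt (by simp; linarith) one_pos).aestronglyMeasurable
      · exact (Complex.measurable_ofReal.comp measurable_fract).aestronglyMeasurable
    · intro t ht
      have ht0 : (0:ℝ) < t := lt_trans one_pos ht
      rw [norm_mul, Complex.norm_cpow_eq_rpow_re_of_pos ht0, Complex.norm_real, Real.norm_eq_abs, abs_of_nonneg (Int.fract_nonneg t)]
      simp only [neg_re, add_re, one_re]
      exact mul_le_of_le_one_right (by positivity) (Int.fract_lt_one t).le
  have h1 : ∫ t in Set.Ioi (1 : ℝ), (∑ k ∈ Finset.Icc 1 ⌊t⌋₊, (1:ℂ)) * t ^ (-(s + 1))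
     = (∫ t in Set.Ioi (1 : ℝ), (t:ℂ) ^ (-s)) - mellin frI (-s) := by
    rw [mellin_frI, ← integral_sub hint1 hint2]
    apply setIntegral_congr_fun measurableSet_Ioi
    intro t ht
    have ht0 : (0:ℝ) < t := lt_trans one_pos ht
    have htc : (t:ℂ) ≠ 0 := by exact_mod_cast ht0.ne'
    simp only [Finset.sum_const, Nat.card_Icc, add_tsub_cancel_right, nsmul_eq_mul, mul_one]
    have e1 : ((⌊t⌋₊ : ℕ) : ℂ) = (t:ℂ) - ((Int.fract t : ℝ) : ℂ) := by
      have : (⌊t⌋₊ : ℝ) = t - Int.fract t := by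
        rw [Int.self_sub_fract, natCast_floor_eq_intCast_floor ht0.le]
      rw [← Complex.ofReal_sub, ← this]; simp
    have e2 : (t:ℂ) ^ (-s) = t * (t:ℂ)^(-(s+1)) := by
      have : -s = 1 + -(s+1) := by ring
      rw [this, Complex.cpow_add _ _ htc, Complex.cpow_one]
    rw [e1, e2]; ring
  rw [h1, integral_Ioi_cpow_of_lt (by simpa using hs) one_pos] at h0
  have hz : riemannZeta₁ s = (s-1) * riemannZeta s := by
    rw [riemannZeta_eq_inv_sub_mul hs1, ← mul_assoc, mul_inv_cancel₀ (sub_ne_zero.mpr hs1), one_mul]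
  rw [hz, h0]
  have h2 : s - 1 ≠ 0 := sub_ne_zero.mpr hs1
  have h3 : -s + 1 ≠ 0 := by intro h; apply h2; linear_combination -h
  simp only [ofReal_one, one_cpow]
  have : -1 / (-s+1) = 1/(s-1) := by field_simp; ring
  rw [this]; field_simp

lemma zeta1_eq {s : ℂ} (hs : 0 < s.re) :
    riemannZeta₁ s = s - s * (s - 1) * mellin frI (-s) := by
  have hU : IsOpen {s : ℂ | 0 < s.re} := isOpen_lt continuous_const Complex.continuous_re
  have ha : AnalyticOnNhd ℂ riemannZeta₁ {s : ℂ | 0 < s.re} :=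
    differentiable_riemannZeta₁.differentiableOn.analyticOnNhd hU
  have hb : AnalyticOnNhd ℂ (fun s => s - s * (s - 1) * mellin frI (-s)) {s : ℂ | 0 < s.re} := by
    apply DifferentiableOn.analyticOnNhd _ hU
    intro z hz
    apply DifferentiableAt.differentiableWithinAt
    have : DifferentiableAt ℂ (fun s => mellin frI (-s)) z :=
      DifferentiableAt.comp (g := mellin frI) (f := fun s : ℂ => -s) z (frI_diff (s := -z) (by simpa using hz)) differentiableAt_id.neg
    fun_prop
  have hc : IsPreconnected {s : ℂ | 0 < s.re} := (convex_halfSpace_re_gt 0).isPreconnected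
  refine ha.eqOn_of_preconnected_of_eventuallyEq hb hc (z₀ := 2) (by simp) ?_ hs
  have : {s : ℂ | 1 < s.re} ∈ nhds (2:ℂ) := (isOpen_lt continuous_const Complex.continuous_re).mem_nhds (by simp)
  filter_upwards [this] with z hz
  exact zeta1_eq_of_one_lt hz

lemma zeta1_bound {s : ℂ} (hs : 1/2 ≤ s.re) : ‖riemannZeta₁ s‖ ≤ 4 * (1 + ‖s‖)^2 := by
  rw [zeta1_eq (by linarith)]
  have h1 : ‖mellin frI (-s)‖ ≤ 2 := (mellin_frI_bound (by linarith)).trans (by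
    rw [div_le_iff₀ (by linarith)]; linarith)
  have h2 : ‖s - 1‖ ≤ ‖s‖ + 1 := (norm_sub_le _ _).trans (by simp)
  calc ‖s - s * (s - 1) * mellin frI (-s)‖ ≤ ‖s‖ + ‖s * (s - 1) * mellin frI (-s)‖ := norm_sub_le _ _
    _ = ‖s‖ + ‖s‖ * ‖s - 1‖ * ‖mellin frI (-s)‖ := by rw [norm_mul, norm_mul]
    _ ≤ ‖s‖ + ‖s‖ * (‖s‖ + 1) * 2 := by gcongr
    _ ≤ _ := by nlinarith [norm_nonneg s]

end

section
open Filter Complex MeasureTheory Set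

lemma zeta1_deriv_bound {s : ℂ} (hs : 3/4 ≤ s.re) : ‖deriv riemannZeta₁ s‖ ≤ 16 * (2 + ‖s‖)^2 := by
  have := Complex.norm_deriv_le_of_forall_mem_sphere_norm_le (c := s) (R := 1/4) (C := 4 * (2 + ‖s‖)^2) (f := riemannZeta₁)
    (by norm_num) differentiable_riemannZeta₁.diffContOnCl (by
      intro z hz
      have hz' : ‖z - s‖ = 1/4 := by simpa [dist_eq_norm] using hz
      have h1 : |(z - s).re| ≤ 1/4 := hz' ▸ Complex.abs_re_le_norm _
      have h2 : ‖z‖ ≤ ‖s‖ + 1/4 := by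
        calc ‖z‖ = ‖s + (z - s)‖ := by ring_nf
          _ ≤ _ := by rw [← hz']; exact norm_add_le _ _
      rw [Complex.sub_re] at h1
      refine (zeta1_bound (by linarith [(abs_le.mp h1).1])).trans ?_
      have := norm_nonneg z
      nlinarith [norm_nonneg z, norm_nonneg s, pow_le_pow_left₀ (by positivity : (0:ℝ) ≤ 1+‖z‖) (by linarith : 1+‖z‖ ≤ 2+‖s‖) 2])
  refine this.trans (le_of_eq (by ring))

lemma zeta1_deriv2_bound {s : ℂ} (hs : 1 ≤ s.re) : ‖deriv (deriv riemannZeta₁) s‖ ≤ 64 * (3 + ‖s‖)^2 := by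
  have := Complex.norm_deriv_le_of_forall_mem_sphere_norm_le (c := s) (R := 1/4) (C := 16 * (3 + ‖s‖)^2) (f := deriv riemannZeta₁)
    (by norm_num) (differentiable_riemannZeta₁.deriv).diffContOnCl (by
      intro z hz
      have hz' : ‖z - s‖ = 1/4 := by simpa [dist_eq_norm] using hz
      have h1 : |(z - s).re| ≤ 1/4 := hz' ▸ Complex.abs_re_le_norm _
      have h2 : ‖z‖ ≤ ‖s‖ + 1/4 := by
        calc ‖z‖ = ‖s + (z - s)‖ := by ring_nf
          _ ≤ _ := by rw [← hz']; exact norm_add_le _ _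
      rw [Complex.sub_re] at h1
      refine (zeta1_deriv_bound (by linarith [(abs_le.mp h1).1])).trans ?_
      have := norm_nonneg z
      nlinarith [norm_nonneg z, norm_nonneg s, pow_le_pow_left₀ (by positivity : (0:ℝ) ≤ 2+‖z‖) (by linarith : 2+‖z‖ ≤ 3+‖s‖) 2])
  refine this.trans (le_of_eq (by ring))

lemma zeta_prod_ge {x : ℝ} (hx : 0 < x) (t : ℝ) :
    1 ≤ ‖riemannZeta (1 + x)‖ ^ 3 * ‖riemannZeta (1 + x + I * t)‖ ^ 4 * ‖riemannZeta (1 + x + 2 * I * t)‖ := by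
  have := DirichletCharacter.norm_LFunction_product_ge_one (N := 1) (1 : DirichletCharacter ℂ 1) hx t
  simpa [DirichletCharacter.LFunctionTrivChar, DirichletCharacter.LFunction_modOne_eq, norm_mul, norm_pow] using this

lemma zeta_norm_eq {s : ℂ} (hs : s ≠ 1) : ‖riemannZeta s‖ = ‖riemannZeta₁ s‖ / ‖s - 1‖ := by
  rw [riemannZeta_eq_inv_sub_mul hs, norm_mul, norm_inv]; ring

lemma zeta1_lower_pow {x : ℝ} (hx : 0 < x) (hx1 : x ≤ 1) {t : ℝ} (ht : 1 ≤ |t|) :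
    x ^ 3 ≤ 31^4 * (1 + |t|)^2 * ‖riemannZeta₁ (1 + x + I * t)‖ ^ 4 := by
  have ht0 : t ≠ 0 := by rintro rfl; norm_num at ht
  have h := zeta_prod_ge hx t
  have e1 : ‖riemannZeta (1 + x)‖ ≤ 36 / x := by
    rw [zeta_norm_eq (by simp [hx.ne'])]
    have hn : ‖(1:ℂ) + x - 1‖ = x := by simp [abs_of_pos hx]
    rw [hn]
    have h1 : ‖(1:ℂ) + x‖ ≤ 2 := (norm_add_le _ _).trans (by simp [abs_of_pos hx]; linarith)
    have := zeta1_bound (s := 1 + x) (by simp; linarith)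
    have h2 : 4 * (1 + ‖(1:ℂ) + x‖)^2 ≤ 36 := by nlinarith [norm_nonneg ((1:ℂ) + x)]
    gcongr; linarith
  have e2 : ‖riemannZeta (1 + x + I * t)‖ ≤ ‖riemannZeta₁ (1 + x + I * t)‖ := by
    rw [zeta_norm_eq (by intro h; have := congrArg Complex.im h; simp at this; exact ht0 this)]
    have : 1 ≤ ‖(1:ℂ) + x + I * t - 1‖ := by
      refine ht.trans ?_
      have := Complex.abs_im_le_norm ((1:ℂ) + x + I * t - 1)
      simpa using this
    exact div_le_self (norm_nonneg _) this
  have e3 : ‖riemannZeta (1 + x + 2 * I * t)‖ ≤ 18 * (1 + |t|)^2 := by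
    rw [zeta_norm_eq (by intro h; have := congrArg Complex.im h; simp at this; exact ht0 this)]
    have h2 : 2 ≤ ‖(1:ℂ) + x + 2 * I * t - 1‖ := by
      have h3 : 2 ≤ 2 * |t| := by linarith
      refine h3.trans ?_
      have := Complex.abs_im_le_norm ((1:ℂ) + x + 2 * I * t - 1)
      simpa [abs_mul] using this
    have h1 : ‖(1:ℂ) + x + 2 * I * t‖ ≤ 2 + 2 * |t| := by
      refine (norm_add_le _ _).trans ?_
      have : ‖(1:ℂ) + x‖ ≤ 2 := (norm_add_le _ _).trans (by simp [abs_of_pos hx]; linarith)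
      have h4 : ‖2 * I * (t:ℂ)‖ = 2 * |t| := by simp
      linarith
    have := zeta1_bound (s := 1 + x + 2 * I * t) (by simp; linarith)
    rw [div_le_iff₀ (by linarith)]
    have h5 : 4 * (1 + ‖(1:ℂ) + x + 2 * I * t‖)^2 ≤ 4 * (3 * (1 + |t|))^2 := by
      gcongr; linarith
    nlinarith [sq_nonneg (1 + |t|)]
  have h6 : 1 ≤ (36 / x) ^ 3 * ‖riemannZeta₁ (1 + x + I * t)‖ ^ 4 * (18 * (1 + |t|)^2) := by
    refine h.trans ?_
    gcongr
  have h7 : (36 / x) ^ 3 * ‖riemannZeta₁ (1 + x + I * t)‖ ^ 4 * (18 * (1 + |t|)^2)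
    = (36^3 * 18 * (1 + |t|)^2 * ‖riemannZeta₁ (1 + x + I * t)‖ ^ 4) / x^3 := by field_simp
  rw [h7, le_div_iff₀ (by positivity), one_mul] at h6
  refine h6.trans ?_
  have : 0 ≤ (1 + |t|)^2 * ‖riemannZeta₁ (1 + x + I * t)‖ ^ 4 := by positivity
  nlinarith

lemma zeta1_lower_far {η x t : ℝ} (ht : 1 ≤ |t|) (hη : η = (1/15872)^4 / (1+|t|)^10) (hx : η ≤ x) (hx1 : x ≤ 1) :
    (1/15872)^3 / (31 * (1+|t|)^8) ≤ ‖riemannZeta₁ (1 + x + I * t)‖ := by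
  have hw : 0 < 1 + |t| := by positivity
  have hη0 : 0 < η := by rw [hη]; positivity
  have h := zeta1_lower_pow (hη0.trans_le hx) hx1 ht
  have h1 : η ^ 3 ≤ x ^ 3 := by gcongr
  by_contra hcon
  push Not at hcon
  have h2 : ‖riemannZeta₁ (1 + x + I * t)‖ ^ 4 < ((1/15872)^3 / (31 * (1+|t|)^8))^4 := by
    gcongr
  have h3 : 31^4 * (1 + |t|)^2 * ((1/15872)^3 / (31 * (1+|t|)^8))^4 ≤ η ^ 3 := by
    rw [hη]; apply le_of_eq; field_simp
  have h4 : 31^4 * (1 + |t|)^2 * ‖riemannZeta₁ (1 + x + I * t)‖ ^ 4 < 31^4 * (1 + |t|)^2 * ((1/15872)^3 / (31 * (1+|t|)^8))^4 := by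
    gcongr
  linarith

lemma zeta1_lower_near {x t : ℝ} (ht : 1 ≤ |t|) (hx0 : 0 < x) (hx1 : x ≤ 1) :
    (1/15872)^3 / (62 * (1+|t|)^8) ≤ ‖riemannZeta₁ (1 + x + I * t)‖ := by
  have hw : 0 < 1 + |t| := by positivity
  have hcmp : (1/15872:ℝ)^3 / (62 * (1+|t|)^8) ≤ (1/15872)^3 / (31 * (1+|t|)^8) := by gcongr; norm_num
  set η : ℝ := (1/15872)^4 / (1+|t|)^10 with hη
  have hη0 : 0 < η := by rw [hη]; positivity
  have hη1 : η ≤ 1 := by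
    rw [hη, div_le_one (by positivity)]
    have : (1:ℝ) ≤ (1 + |t|)^10 := one_le_pow₀ (by linarith)
    refine le_trans (by norm_num) this
  rcases le_total η x with h | h
  · exact hcmp.trans (zeta1_lower_far ht hη h hx1)
  · have h1 := zeta1_lower_far ht hη le_rfl hη1
    have h2 : ‖riemannZeta₁ (1 + η + I * t) - riemannZeta₁ (1 + x + I * t)‖ ≤ (256 * (1+|t|)^2) * ‖((1:ℂ) + η + I * t) - (1 + x + I * t)‖ := by
      refine Convex.norm_image_sub_le_of_norm_deriv_le (s := {z : ℂ | 1 ≤ z.re} ∩ ({z : ℂ | z.re ≤ 2} ∩ {z : ℂ | z.im = t})) (𝕜 := ℂ) (fun z _ => differentiable_riemannZeta₁ z) ?_ ?_ ?_ ?_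
      · rintro z ⟨hz1, hz2, hz3⟩
        refine (zeta1_deriv_bound (by simp at hz1; linarith)).trans ?_
        have : ‖z‖ ≤ 2 + |t| := by
          refine (Complex.norm_le_abs_re_add_abs_im z).trans ?_
          simp only [mem_setOf_eq] at hz1 hz2 hz3
          rw [hz3, abs_of_nonneg (by linarith)]; linarith
        calc 16 * (2 + ‖z‖)^2 ≤ 16 * (4 * (1 + |t|))^2 := by gcongr; linarith [abs_nonneg t]
          _ = _ := by ring
      · exact (convex_halfSpace_re_ge 1).inter ((convex_halfSpace_re_le 2).inter (by
          intro a ha b hb p q hp hq hpq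
          simp only [mem_setOf_eq] at *
          simp [ha, hb, ← add_mul, hpq]))
      · simp; constructor <;> linarith
      · simp; constructor <;> linarith
    have h3 : ‖((1:ℂ) + η + I * t) - (1 + x + I * t)‖ ≤ η := by
      have : ((1:ℂ) + η + I * t) - (1 + x + I * t) = ((η - x : ℝ) : ℂ) := by push_cast; ring
      rw [this, Complex.norm_real, Real.norm_eq_abs, abs_of_nonneg (by linarith)]; linarith
    have h4 : (256 * (1+|t|)^2) * η = (1/15872)^3 / (62 * (1+|t|)^8) := by
      rw [hη]; field_simp; norm_num
    have h5 : (1/15872:ℝ)^3 / (31 * (1+|t|)^8) = 2 * ((1/15872)^3 / (62 * (1+|t|)^8)) := by field_simp; norm_num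
    have h6 : ‖riemannZeta₁ (1 + η + I * t)‖ ≤ ‖riemannZeta₁ (1 + η + I * t) - riemannZeta₁ (1 + x + I * t)‖ + ‖riemannZeta₁ (1 + x + I * t)‖ := by
      simpa using norm_add_le (riemannZeta₁ (1 + η + I * t) - riemannZeta₁ (1 + x + I * t)) (riemannZeta₁ (1 + x + I * t))
    have h7 : (256 * (1+|t|)^2) * ‖((1:ℂ) + η + I * t) - (1 + x + I * t)‖ ≤ (256 * (1+|t|)^2) * η := by gcongr
    linarith

lemma zeta1_ne_zero {s : ℂ} (hs : 1 ≤ s.re) : riemannZeta₁ s ≠ 0 := by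
  by_cases h : s = 1
  · subst h; simp
  · have := riemannZeta_ne_zero_of_one_le_re hs
    rw [riemannZeta_eq_inv_sub_mul h] at this
    exact right_ne_zero_of_mul this

lemma zeta1_lower : ∃ c > (0:ℝ), ∀ x t : ℝ, 0 < x → x ≤ 1 → c / (1+|t|)^8 ≤ ‖riemannZeta₁ (1 + x + I * t)‖ := by
  obtain ⟨c1, hc1, h1⟩ : ∃ c1 > (0:ℝ), ∀ s ∈ (Set.Icc (1:ℝ) 2 ×ℂ Set.Icc (-1:ℝ) 1), c1 ≤ ‖riemannZeta₁ s‖ := by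
    have hK : IsCompact (Set.Icc (1:ℝ) 2 ×ℂ Set.Icc (-1:ℝ) 1) := isCompact_Icc.reProdIm isCompact_Icc
    have hne : (Set.Icc (1:ℝ) 2 ×ℂ Set.Icc (-1:ℝ) 1).Nonempty := ⟨1, by simp [Complex.mem_reProdIm]⟩
    obtain ⟨z, hz, hmin⟩ := hK.exists_isMinOn hne (differentiable_riemannZeta₁.continuous.norm.continuousOn)
    refine ⟨‖riemannZeta₁ z‖, ?_, fun s hs => hmin hs⟩
    rw [gt_iff_lt, norm_pos_iff]
    exact zeta1_ne_zero (Complex.mem_reProdIm.mp hz).1.1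
  refine ⟨min c1 ((1/15872)^3/62), by positivity, fun x t hx hx1 => ?_⟩
  rcases le_total 1 |t| with h | h
  · refine le_trans ?_ (zeta1_lower_near h hx hx1)
    rw [← div_div]
    gcongr
    exact min_le_right _ _
  · refine le_trans ?_ (h1 (1 + x + I * t) ?_)
    · have : (1:ℝ) ≤ (1+|t|)^8 := one_le_pow₀ (by linarith [abs_nonneg t])
      rw [div_le_iff₀ (by positivity)]
      refine (min_le_left _ _).trans (le_mul_of_one_le_right hc1.le this)
    · rw [Complex.mem_reProdIm]
      simp only [add_re, one_re, ofReal_re, mul_re, I_re, zero_mul, I_im, ofReal_im, mul_zero, sub_self, add_zero, add_im, one_im, mul_im, one_mul, zero_add, Set.mem_Icc]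
      exact ⟨⟨by linarith, by linarith⟩, abs_le.mp h⟩

noncomputable def Gf (s : ℂ) : ℂ := deriv riemannZeta₁ s / riemannZeta₁ s

lemma Gf_bounds : ∃ K > (0:ℝ), ∀ x t : ℝ, 0 < x → x ≤ 1 →
    ‖Gf (1 + x + I * t)‖ ≤ K * (1+|t|)^20 ∧ ‖deriv Gf (1 + x + I * t)‖ ≤ K * (1+|t|)^20 := by
  obtain ⟨c, hc, h⟩ := zeta1_lower
  refine ⟨(256/c + 1600/c + (256/c)^2), by positivity, fun x t hx hx1 => ?_⟩
  have hl := h x t hx hx1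
  set s : ℂ := 1 + x + I * t with hs
  have hre : s.re = 1 + x := by simp [hs]
  have hw1 : 1 ≤ 1 + |t| := by linarith [abs_nonneg t]
  set w := 1 + |t| with hw
  have hn : ‖s‖ ≤ 1 + w := by
    refine (Complex.norm_le_abs_re_add_abs_im s).trans ?_
    have : s.im = t := by simp [hs]
    rw [this, hre, abs_of_nonneg (by linarith)]; linarith
  have d1 : ‖deriv riemannZeta₁ s‖ ≤ 256 * w^2 := by
    refine (zeta1_deriv_bound (by rw [hre]; linarith)).trans ?_
    calc 16 * (2 + ‖s‖)^2 ≤ 16 * (4 * w)^2 := by gcongr; linarith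
      _ = _ := by ring
  have d2 : ‖deriv (deriv riemannZeta₁) s‖ ≤ 1600 * w^2 := by
    refine (zeta1_deriv2_bound (by rw [hre]; linarith)).trans ?_
    calc 64 * (3 + ‖s‖)^2 ≤ 64 * (5 * w)^2 := by gcongr; linarith
      _ = _ := by ring
  have hne := zeta1_ne_zero (s := s) (by rw [hre]; linarith)
  have hinv : ‖riemannZeta₁ s‖⁻¹ ≤ w^8 / c := by
    rw [← inv_div]; gcongr
  have b1 : ‖deriv riemannZeta₁ s / riemannZeta₁ s‖ ≤ 256/c * w^10 := by
    rw [norm_div, div_eq_mul_inv]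
    calc _ ≤ (256 * w^2) * (w^8/c) := by gcongr
      _ = _ := by ring
  have b2 : ‖deriv (deriv riemannZeta₁) s / riemannZeta₁ s‖ ≤ 1600/c * w^10 := by
    rw [norm_div, div_eq_mul_inv]
    calc _ ≤ (1600 * w^2) * (w^8/c) := by gcongr
      _ = _ := by ring
  have hp : w^10 ≤ w^20 := pow_le_pow_right₀ hw1 (by norm_num)
  have hp' : 0 ≤ w^20 := by positivity
  constructor
  · refine b1.trans ?_
    calc 256/c * w^10 ≤ 256/c * w^20 := by gcongr
      _ ≤ _ := by gcongr; linarith [show 0 < 1600/c by positivity, show 0 < (256/c)^2 by positivity]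
  · have hd : deriv Gf s = deriv (deriv riemannZeta₁) s / riemannZeta₁ s - (deriv riemannZeta₁ s / riemannZeta₁ s)^2 := by
      have : HasDerivAt Gf ((deriv (deriv riemannZeta₁) s * riemannZeta₁ s - deriv riemannZeta₁ s * deriv riemannZeta₁ s) / riemannZeta₁ s ^ 2) s :=
        (differentiable_riemannZeta₁.deriv s).hasDerivAt.div (differentiable_riemannZeta₁ s).hasDerivAt hne
      rw [this.deriv]; field_simp
    rw [hd]
    refine (norm_sub_le _ _).trans ?_
    rw [norm_pow]
    calc _ ≤ 1600/c * w^10 + (256/c * w^10)^2 := by gcongr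
      _ ≤ 1600/c * w^20 + (256/c)^2 * w^20 := by
        have : (256/c * w^10)^2 = (256/c)^2 * w^20 := by ring
        rw [this]; gcongr
      _ ≤ _ := by nlinarith [show 0 < 256/c by positivity]

lemma Gf_diff {s : ℂ} (hs : 1 ≤ s.re) : DifferentiableAt ℂ Gf s :=
  (differentiable_riemannZeta₁.deriv s).div (differentiable_riemannZeta₁ s) (zeta1_ne_zero hs)

lemma LSeries_vonMangoldt_Gf {s : ℂ} (hs : 1 < s.re) :
    LSeries (fun n => ((ArithmeticFunction.vonMangoldt n : ℝ) : ℂ)) s = 1 / (s - 1) - Gf s := by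
  have hs1 : s ≠ 1 := by rintro rfl; simp at hs
  have h2 : s - 1 ≠ 0 := sub_ne_zero.mpr hs1
  have hne := zeta1_ne_zero hs.le
  rw [ArithmeticFunction.LSeries_vonMangoldt_eq_deriv_riemannZeta_div hs,
    deriv_riemannZeta_eq_neg_inv_sub_sq_mul_add hs1, riemannZeta_eq_inv_sub_mul hs1, Gf]
  field_simp
  ring

end

section
open Filter Complex MeasureTheory Set

lemma gaussF {b : ℝ} (hb : 0 < b) (w : ℝ) :
    ∫ t : ℝ, cexp (I * w * t) * cexp (-b * t ^ 2) = ((√(Real.pi / b) * Real.exp (-w^2 / (4 * b)) : ℝ) : ℂ) := by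
  rw [fourierIntegral_gaussian (by simpa using hb)]
  push_cast
  congr 1
  rw [Real.sqrt_eq_rpow, Complex.ofReal_cpow (by positivity)]
  push_cast; rfl

lemma gauss_norm (b t : ℝ) : ‖cexp (-(b:ℂ) * t ^ 2)‖ = Real.exp (-b * t^2) := by
  rw [Complex.norm_exp]; congr 1
  have : (-(b:ℂ) * t ^ 2) = ((-b * t^2 : ℝ) : ℂ) := by push_cast; ring
  rw [this, Complex.ofReal_re]

lemma osc_norm (u t : ℝ) : ‖cexp (I * u * t)‖ = 1 := by
  rw [Complex.norm_exp]; simp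

lemma gauss_osc_integrable {b : ℝ} (hb : 0 < b) (u : ℝ) :
    Integrable (fun t : ℝ => cexp (I * u * t) * cexp (-(b:ℂ) * t ^ 2)) := by
  refine (integrable_exp_neg_mul_sq hb).mono' (by fun_prop) (Eventually.of_forall fun t => ?_)
  rw [norm_mul, osc_norm, gauss_norm, one_mul]

open ArithmeticFunction in
lemma sum_side {b δ : ℝ} (hb : 0 < b) (hδ : 0 < δ) (u : ℝ) :
    HasSum (fun n : ℕ => ((√(Real.pi / b) * (vonMangoldt n / (n:ℝ)^(1+δ) * Real.exp (-(u - Real.log n)^2 / (4 * b))) : ℝ) : ℂ))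
      (∫ t : ℝ, (cexp (I * u * t) * cexp (-(b:ℂ) * t ^ 2)) * LSeries (fun n => ((vonMangoldt n : ℝ) : ℂ)) (1 + δ + I * t)) := by
  have hsum : Summable (fun n : ℕ => vonMangoldt n / (n:ℝ)^(1+δ)) := by
    have := (LSeriesSummable_vonMangoldt (s := ((1 + δ : ℝ) : ℂ)) (by simp; linarith)).norm
    refine this.congr fun n => ?_
    rw [LSeries.norm_term_eq]
    split_ifs with h
    · simp [h]
    · simp [abs_of_nonneg vonMangoldt_nonneg]
  have hterm : ∀ (n : ℕ) (t : ℝ), LSeries.term (fun n => ((vonMangoldt n : ℝ) : ℂ)) (1 + δ + I * t) n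
      = ((vonMangoldt n / (n:ℝ)^(1+δ) : ℝ) : ℂ) * cexp (-(I * Real.log n * t)) := by
    intro n t
    by_cases h : n = 0
    · simp [h]
    rw [LSeries.term_of_ne_zero h]
    have hn : (n:ℂ) ≠ 0 := by exact_mod_cast h
    rw [Complex.cpow_add _ _ hn, Complex.cpow_def_of_ne_zero hn (I * t), ← Complex.ofReal_natCast, ← Complex.ofReal_log (by positivity)]
    have : ((n:ℝ):ℂ) ^ ((1:ℂ) + δ) = (((n:ℝ)^(1+δ) : ℝ) : ℂ) := by
      rw [Complex.ofReal_cpow (by positivity)]; push_cast; rfl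
    rw [this, Complex.exp_neg]
    push_cast
    rw [show Complex.log n * (I * t) = I * Complex.log n * t by ring, div_mul_eq_div_div, div_eq_mul_inv _ (cexp _)]
  set F : ℕ → ℝ → ℂ := fun n t => (cexp (I * u * t) * cexp (-(b:ℂ) * t ^ 2)) * LSeries.term (fun n => ((vonMangoldt n : ℝ) : ℂ)) (1 + δ + I * t) n with hF
  have hFe : ∀ n t, F n t = ((vonMangoldt n / (n:ℝ)^(1+δ) : ℝ) : ℂ) * (cexp (I * (u - Real.log n : ℝ) * t) * cexp (-(b:ℂ) * t ^ 2)) := by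
    intro n t
    simp only [hF, hterm]
    have : cexp (I * (u - Real.log n : ℝ) * t) = cexp (I * u * t) * cexp (-(I * Real.log n * t)) := by
      rw [← Complex.exp_add]; congr 1; push_cast; ring
    rw [this]; ring
  have hFi : ∀ n, ∫ t, F n t = ((√(Real.pi / b) * (vonMangoldt n / (n:ℝ)^(1+δ) * Real.exp (-(u - Real.log n)^2 / (4 * b))) : ℝ) : ℂ) := by
    intro n
    simp only [hFe]
    rw [integral_const_mul, gaussF hb]
    push_cast; ring
  have hF1 : ∀ n, Integrable (F n) := by
    intro n
    have : F n = fun t : ℝ => ((vonMangoldt n / (n:ℝ)^(1+δ) : ℝ) : ℂ) * (cexp (I * (u - Real.log n : ℝ) * t) * cexp (-(b:ℂ) * t ^ 2)) := funext (hFe n)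
    rw [this]
    exact (gauss_osc_integrable hb _).const_mul _
  have hF2 : ∀ n, ∫ t, ‖F n t‖ = vonMangoldt n / (n:ℝ)^(1+δ) * √(Real.pi / b) := by
    intro n
    have : ∀ t, ‖F n t‖ = vonMangoldt n / (n:ℝ)^(1+δ) * Real.exp (-b * t^2) := by
      intro t
      rw [hFe, norm_mul, norm_mul, osc_norm, gauss_norm, one_mul, Complex.norm_real, Real.norm_of_nonneg]
      exact div_nonneg vonMangoldt_nonneg (by positivity)
    simp only [this]
    rw [integral_const_mul, integral_gaussian]
  have := hasSum_integral_of_summable_integral_norm hF1 (by simp only [hF2]; exact hsum.mul_right _)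
  simp only [hFi] at this
  have e : (fun t : ℝ => (cexp (I * u * t) * cexp (-(b:ℂ) * t ^ 2)) * LSeries (fun n => ((vonMangoldt n : ℝ) : ℂ)) (1 + δ + I * t))
      = fun t => ∑' n, F n t := by
    ext t
    simp only [hF]
    rw [tsum_mul_left]; rfl
  rw [e]; exact this

lemma int_side {b δ : ℝ} (hb : 0 < b) (hδ : 0 < δ) (u : ℝ) :
    ∫ t : ℝ, (cexp (I * u * t) * cexp (-(b:ℂ) * t ^ 2)) * (1 / ((δ:ℂ) + I * t)) =
      ((√(Real.pi / b) * ∫ v in Ioi (0:ℝ), Real.exp (-δ * v) * Real.exp (-(u-v)^2 / (4*b)) : ℝ) : ℂ) := by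
  have h1 : ∀ t : ℝ, 1 / ((δ:ℂ) + I * t) = ∫ v in Ioi (0:ℝ), cexp (-((δ:ℂ) + I * t) * v) := by
    intro t
    rw [integral_exp_mul_complex_Ioi (by simp; linarith)]
    rw [neg_div, ← div_neg]; simp
  have h2 : ∀ t : ℝ, (cexp (I * u * t) * cexp (-(b:ℂ) * t ^ 2)) * (1 / ((δ:ℂ) + I * t)) =
      ∫ v in Ioi (0:ℝ), (cexp (I * u * t) * cexp (-(b:ℂ) * t ^ 2)) * cexp (-((δ:ℂ) + I * t) * v) := by
    intro t; rw [h1, integral_const_mul]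
  simp only [h2]
  rw [integral_integral_swap]
  · have h3 : ∀ v : ℝ, ∫ t : ℝ, (cexp (I * u * t) * cexp (-(b:ℂ) * t ^ 2)) * cexp (-((δ:ℂ) + I * t) * v) =
       ((√(Real.pi / b) * (Real.exp (-δ * v) * Real.exp (-(u-v)^2 / (4*b))) : ℝ) : ℂ) := by
      intro v
      have : ∀ t : ℝ, (cexp (I * u * t) * cexp (-(b:ℂ) * t ^ 2)) * cexp (-((δ:ℂ) + I * t) * v) =
        cexp (-δ * v) * (cexp (I * (u - v : ℝ) * t) * cexp (-(b:ℂ) * t ^ 2)) := by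
        intro t
        simp only [← Complex.exp_add]; congr 1; push_cast; ring
      simp only [this]
      rw [integral_const_mul, gaussF hb]
      push_cast; ring
    simp only [h3]
    rw [← integral_const_mul]; exact integral_ofReal
  · have hi : Integrable (fun z : ℝ × ℝ => Real.exp (-b * z.1^2) * Real.exp (-δ * z.2)) ((volume : Measure ℝ).prod (volume.restrict (Ioi (0:ℝ)))) :=
      (integrable_exp_neg_mul_sq hb).mul_prod (integrableOn_exp_mul_Ioi (by linarith) 0)
    refine hi.mono' (by unfold Function.uncurry; fun_prop) (Eventually.of_forall fun z => ?_)
    simp only [Function.uncurry]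
    rw [norm_mul, norm_mul, osc_norm, gauss_norm, one_mul, Complex.norm_exp]
    simp

lemma poly_gauss {b : ℝ} (hb : 0 < b) (hb1 : b ≤ 1) (t : ℝ) :
    (1 + |t|)^21 * Real.exp (-b * t^2) ≤ (2^22 * (2^11 * Nat.factorial 11)) / b^11 * Real.exp (-(b/2) * t^2) := by
  have hx : 0 ≤ b/2 * t^2 := by positivity
  have h1 := Real.pow_div_factorial_le_exp (b/2 * t^2) hx 11
  have h0 : 1 ≤ Real.exp (b/2 * t^2) := Real.one_le_exp hx
  have hsplit : Real.exp (-b * t^2) = Real.exp (-(b/2) * t^2) * (Real.exp (b/2 * t^2))⁻¹ := by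
    rw [← Real.exp_neg, ← Real.exp_add]; congr 1; ring
  have key : (1 + |t|)^21 ≤ (2^22 * (2^11 * Nat.factorial 11)) / b^11 * Real.exp (b/2 * t^2) := by
    have hb11 : b^11 ≤ 1 := pow_le_one₀ hb.le hb1
    rcases le_total |t| 1 with h | h
    · calc (1 + |t|)^21 ≤ ((1:ℝ)+1)^21 := by gcongr
        _ ≤ (2^22 * (2^11 * (Nat.factorial 11 : ℝ))) / 1 * 1 := by norm_num [Nat.factorial]
        _ ≤ _ := by gcongr
    · calc (1 + |t|)^21 ≤ (1 + |t|)^22 := pow_le_pow_right₀ (by linarith) (by norm_num)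
        _ ≤ (2 * |t|)^22 := by gcongr; linarith
        _ = 2^22 * (t^2)^11 := by rw [mul_pow, ← sq_abs t]; ring
        _ = (2^22 * (2^11 * Nat.factorial 11)) / b^11 * ((b/2 * t^2)^11 / Nat.factorial 11) := by
          field_simp
        _ ≤ _ := by gcongr
  rw [hsplit, mul_comm (Real.exp (-(b/2) * t^2)), ← mul_assoc]
  gcongr
  rw [mul_inv_le_iff₀ (by positivity)]
  exact key

end

section
open Filter Complex MeasureTheory Set

lemma gf_side : ∃ K > (0:ℝ), ∀ b δ u : ℝ, 0 < b → b ≤ 1 → 0 < δ → δ ≤ 1 → 0 < u →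
    ‖∫ t : ℝ, (cexp (I * u * t) * cexp (-(b:ℂ) * t ^ 2)) * Gf (1 + δ + I * t)‖ ≤ K / b^11 * √(Real.pi/b) / u := by
  obtain ⟨K, hK, hG⟩ := Gf_bounds
  set M : ℝ := 2^22 * (2^11 * Nat.factorial 11) with hM
  have hM0 : 0 < M := by positivity
  refine ⟨2 * K * M * 2, by positivity, fun b δ u hb hb1 hδ hδ1 hu => ?_⟩
  set φ : ℝ → ℂ := fun t => cexp (-(b:ℂ) * t ^ 2) * Gf (1 + δ + I * t) with hφ
  set φ' : ℝ → ℂ := fun t => cexp (-(b:ℂ) * t ^ 2) * (-(b:ℂ) * (2 * t)) * Gf (1 + δ + I * t) + cexp (-(b:ℂ) * t ^ 2) * (deriv Gf (1 + δ + I * t) * I) with hφ'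
  have hd : ∀ t, HasDerivAt φ (φ' t) t := by
    intro t
    have h1 : HasDerivAt (fun t : ℝ => (t:ℂ)) 1 t := Complex.ofRealCLM.hasDerivAt
    have h2 : HasDerivAt (fun t : ℝ => cexp (-(b:ℂ) * t ^ 2)) (cexp (-(b:ℂ) * t ^ 2) * (-(b:ℂ) * (2 * t))) t := by
      have := ((h1.pow 2).const_mul (-(b:ℂ))).cexp
      simpa using this
    have h3 : HasDerivAt (fun t : ℝ => (1:ℂ) + δ + I * t) I t := by
      have := (h1.const_mul I).const_add ((1:ℂ) + δ)
      simpa using this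
    have h4 : HasDerivAt (fun t : ℝ => Gf (1 + δ + I * t)) (deriv Gf (1 + δ + I * t) * I) t := by
      have hdd := (Gf_diff (s := 1 + δ + I * t) (by simp; linarith)).hasDerivAt
      exact HasDerivAt.comp t hdd h3
    exact h2.mul h4
  have hφn : ∀ t, ‖φ t‖ ≤ K * M / b^11 * Real.exp (-(b/2) * t^2) := by
    intro t
    simp only [hφ, norm_mul, gauss_norm]
    have h1 := (hG δ t hδ hδ1).1
    have h2 := poly_gauss hb hb1 t
    have h3 : (1+|t|)^20 ≤ (1+|t|)^21 := pow_le_pow_right₀ (by linarith [abs_nonneg t]) (by norm_num)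
    calc Real.exp (-b * t^2) * ‖Gf (1 + δ + I * t)‖ ≤ Real.exp (-b * t^2) * (K * (1+|t|)^21) := by
          gcongr; exact h1.trans (by gcongr)
      _ = K * ((1+|t|)^21 * Real.exp (-b * t^2)) := by ring
      _ ≤ K * (M / b^11 * Real.exp (-(b/2) * t^2)) := by gcongr
      _ = _ := by ring
  have hφ'n : ∀ t, ‖φ' t‖ ≤ 2 * K * M / b^11 * Real.exp (-(b/2) * t^2) := by
    intro t
    have h1 := (hG δ t hδ hδ1).1
    have h1' := (hG δ t hδ hδ1).2
    have h2 := poly_gauss hb hb1 t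
    have e1 : ‖cexp (-(b:ℂ) * t ^ 2) * (-(b:ℂ) * (2 * t)) * Gf (1 + δ + I * t)‖ = Real.exp (-b * t^2) * (2 * b * |t|) * ‖Gf (1 + δ + I * t)‖ := by
      rw [norm_mul, norm_mul, gauss_norm]; congr 2
      simp [abs_of_pos hb]; ring
    have e2 : ‖cexp (-(b:ℂ) * t ^ 2) * (deriv Gf (1 + δ + I * t) * I)‖ = Real.exp (-b * t^2) * ‖deriv Gf (1 + δ + I * t)‖ := by
      rw [norm_mul, norm_mul, gauss_norm]; simp
    calc ‖φ' t‖ ≤ _ := norm_add_le _ _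
      _ = Real.exp (-b * t^2) * (2 * b * |t|) * ‖Gf (1 + δ + I * t)‖ + Real.exp (-b * t^2) * ‖deriv Gf (1 + δ + I * t)‖ := by rw [e1, e2]
      _ ≤ Real.exp (-b * t^2) * (2 * 1 * |t|) * (K * (1+|t|)^20) + Real.exp (-b * t^2) * (K * (1+|t|)^20) := by gcongr
      _ = K * (1+|t|)^20 * (1 + 2*|t|) * Real.exp (-b * t^2) := by ring
      _ ≤ K * (1+|t|)^20 * (2 * (1 + |t|)) * Real.exp (-b * t^2) := by gcongr; linarith
      _ = 2 * K * ((1+|t|)^21 * Real.exp (-b * t^2)) := by ring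
      _ ≤ 2 * K * (M / b^11 * Real.exp (-(b/2) * t^2)) := by gcongr
      _ = _ := by ring
  have hgi := integrable_exp_neg_mul_sq (b := b/2) (by positivity)
  have hφ'e : φ' = deriv φ := by ext t; exact (hd t).deriv.symm
  have hφc : Continuous φ := continuous_iff_continuousAt.mpr fun t => (hd t).continuousAt
  have hφi : Integrable φ := (hgi.const_mul _).mono' hφc.aestronglyMeasurable (Eventually.of_forall hφn)
  have hφ'i : Integrable φ' := (hgi.const_mul _).mono' (hφ'e ▸ (stronglyMeasurable_deriv φ).aestronglyMeasurable) (Eventually.of_forall hφ'n)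
  have huc : (u:ℂ) ≠ 0 := by exact_mod_cast hu.ne'
  set v : ℝ → ℂ := fun t => cexp (I * u * t) / (I * u) with hv
  have hvd : ∀ t : ℝ, HasDerivAt v (cexp (I * u * t)) t := by
    intro t
    have h1 : HasDerivAt (fun t : ℝ => (t:ℂ)) 1 t := Complex.ofRealCLM.hasDerivAt
    have := ((h1.const_mul (I * u)).cexp).div_const (I * u)
    have h0 : I * (u:ℂ) ≠ 0 := mul_ne_zero I_ne_zero huc
    rw [mul_one, mul_div_assoc, div_self h0, mul_one] at this
    exact this
  have hvn : ∀ t, ‖v t‖ = 1 / u := by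
    intro t; simp only [hv]; rw [norm_div, osc_norm]; simp [abs_of_pos hu]
  have hvc : Continuous v := by simp only [hv]; fun_prop
  have ibp := integral_mul_deriv_eq_deriv_mul_of_integrable (u := φ) (v := v) (u' := φ') (v' := fun t => cexp (I * u * t))
    (fun t _ => hd t) (fun t _ => hvd t)
    (by
      refine hφi.norm.mono' (hφc.aestronglyMeasurable.mul (by fun_prop)) (Eventually.of_forall fun t => ?_)
      simp only [Pi.mul_apply]; rw [norm_mul, osc_norm, mul_one])
    (by
      refine (hφ'i.norm.mul_const (1/u)).mono' (hφ'i.aestronglyMeasurable.mul hvc.aestronglyMeasurable) (Eventually.of_forall fun t => ?_)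
      simp only [Pi.mul_apply]; rw [norm_mul, hvn])
    (by
      refine (hφi.norm.mul_const (1/u)).mono' (hφc.aestronglyMeasurable.mul hvc.aestronglyMeasurable) (Eventually.of_forall fun t => ?_)
      simp only [Pi.mul_apply]; rw [norm_mul, hvn])
  have e : ∫ t : ℝ, (cexp (I * u * t) * cexp (-(b:ℂ) * t ^ 2)) * Gf (1 + δ + I * t) = ∫ t : ℝ, φ t * cexp (I * u * t) := by
    refine integral_congr_ae (Eventually.of_forall fun t => ?_)
    simp only [hφ]; ring
  rw [e, ibp, norm_neg]
  calc ‖∫ t, φ' t * v t‖ ≤ ∫ t, 2 * K * M / b^11 * Real.exp (-(b/2) * t^2) * (1/u) := by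
        refine norm_integral_le_of_norm_le ((hgi.const_mul _).mul_const _) (Eventually.of_forall fun t => ?_)
        rw [norm_mul, hvn]; gcongr; exact hφ'n t
    _ = 2 * K * M / b^11 * √(Real.pi/(b/2)) * (1/u) := by
        rw [integral_mul_const, integral_const_mul, integral_gaussian]
    _ ≤ 2 * K * M / b^11 * (2 * √(Real.pi/b)) * (1/u) := by
        gcongr
        rw [Real.sqrt_le_left (by positivity), mul_pow, Real.sq_sqrt (by positivity)]
        rw [div_div_eq_mul_div, mul_comm Real.pi 2, mul_div_assoc]
        have : 0 < Real.pi / b := by positivity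
        linarith
    _ = _ := by ring

open ArithmeticFunction in
/-- Smoothed explicit comparison. -/
lemma smooth_compare : ∃ K > (0:ℝ), ∀ β δ u : ℝ, 1/4 ≤ β → 0 < δ → δ ≤ 1 → 0 < u →
    Summable (fun n : ℕ => vonMangoldt n / (n:ℝ)^(1+δ) * Real.exp (-β * (u - Real.log n)^2)) ∧
    |∑' n : ℕ, (vonMangoldt n / (n:ℝ)^(1+δ) * Real.exp (-β * (u - Real.log n)^2)) -
      ∫ v in Ioi (0:ℝ), Real.exp (-δ * v) * Real.exp (-β * (u-v)^2)| ≤ K * β^11 / u := by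
  obtain ⟨K, hK, h⟩ := gf_side
  refine ⟨K * 4^11, by positivity, fun β δ u hβ hδ hδ1 hu => ?_⟩
  set b : ℝ := 1/(4*β) with hbdef
  have hβ0 : 0 < β := by linarith
  have hb : 0 < b := by positivity
  have hb1 : b ≤ 1 := by rw [hbdef, div_le_one (by positivity)]; linarith
  have eE : ∀ w : ℝ, -w^2/(4*b) = -β * w^2 := by intro w; rw [hbdef]; field_simp
  have hs := sum_side hb hδ u
  have hi := int_side hb hδ u
  have hg := h b δ u hb hb1 hδ hδ1 hu
  simp only [eE] at hs hi
  set s0 := √(Real.pi/b) with hs0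
  have hs0p : 0 < s0 := by rw [hs0]; positivity
  have hsr := Complex.hasSum_re hs
  simp only [Complex.ofReal_re] at hsr
  have hsum : Summable (fun n : ℕ => vonMangoldt n / (n:ℝ)^(1+δ) * Real.exp (-β * (u - Real.log n)^2)) :=
    (summable_mul_left_iff hs0p.ne').mp hsr.summable
  refine ⟨hsum, ?_⟩
  have hL : ∀ t : ℝ, LSeries (fun n => ((vonMangoldt n : ℝ) : ℂ)) (1 + δ + I * t) = 1 / ((δ:ℂ) + I * t) - Gf (1 + δ + I * t) := by
    intro t
    rw [LSeries_vonMangoldt_Gf (by simp; linarith)]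
    congr 2; ring
  have hgo := gauss_osc_integrable hb u
  have i1 : Integrable (fun t : ℝ => (cexp (I * u * t) * cexp (-(b:ℂ) * t ^ 2)) * (1 / ((δ:ℂ) + I * t))) := by
    have hne : ∀ t : ℝ, (δ:ℂ) + I * t ≠ 0 := by
      intro t h0; have := congrArg Complex.re h0; simp at this; linarith
    refine (hgo.norm.mul_const (1/δ)).mono' (Continuous.aestronglyMeasurable (by
      refine Continuous.mul (by fun_prop) (Continuous.div (by fun_prop) (by fun_prop) hne))) (Eventually.of_forall fun t => ?_)
    rw [norm_mul]; gcongr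
    rw [norm_div, norm_one]
    gcongr
    have := Complex.abs_re_le_norm ((δ:ℂ) + I * t)
    simp at this
    exact (le_abs_self δ).trans this
  have i2 : Integrable (fun t : ℝ => (cexp (I * u * t) * cexp (-(b:ℂ) * t ^ 2)) * Gf (1 + δ + I * t)) := by
    obtain ⟨K', hK', hG⟩ := Gf_bounds
    have hgi := integrable_exp_neg_mul_sq (b := b/2) (by positivity)
    refine (hgi.const_mul (K' * ((2^22 * (2^11 * Nat.factorial 11)) / b^11))).mono' (Continuous.aestronglyMeasurable (by
      refine Continuous.mul (by fun_prop) (continuous_iff_continuousAt.mpr fun t => ?_)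
      refine ContinuousAt.comp (f := fun t : ℝ => (1:ℂ) + δ + I * t) (Gf_diff (by simp; linarith)).continuousAt (by fun_prop))) (Eventually.of_forall fun t => ?_)
    rw [norm_mul, norm_mul, osc_norm, gauss_norm, one_mul]
    have h3 : (1+|t|)^20 ≤ (1+|t|)^21 := pow_le_pow_right₀ (by linarith [abs_nonneg t]) (by norm_num)
    calc Real.exp (-b * t^2) * ‖Gf (1 + δ + I * t)‖ ≤ Real.exp (-b * t^2) * (K' * (1+|t|)^21) := by
          gcongr; exact ((hG δ t hδ hδ1).1).trans (by gcongr)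
      _ = K' * ((1+|t|)^21 * Real.exp (-b * t^2)) := by ring
      _ ≤ _ := by rw [mul_assoc]; exact mul_le_mul_of_nonneg_left (poly_gauss hb hb1 t) hK'.le
  have hdiff : ∫ t : ℝ, (cexp (I * u * t) * cexp (-(b:ℂ) * t ^ 2)) * LSeries (fun n => ((vonMangoldt n : ℝ) : ℂ)) (1 + δ + I * t)
     = (∫ t : ℝ, (cexp (I * u * t) * cexp (-(b:ℂ) * t ^ 2)) * (1 / ((δ:ℂ) + I * t))) -
       ∫ t : ℝ, (cexp (I * u * t) * cexp (-(b:ℂ) * t ^ 2)) * Gf (1 + δ + I * t) := by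
    rw [← integral_sub i1 i2]
    refine integral_congr_ae (Eventually.of_forall fun t => ?_)
    simp only [hL]; ring
  have ht := hsr.tsum_eq
  rw [hdiff, hi, tsum_mul_left, Complex.sub_re, Complex.ofReal_re] at ht
  set G := ∫ t : ℝ, (cexp (I * u * t) * cexp (-(b:ℂ) * t ^ 2)) * Gf (1 + δ + I * t)
  have hGre : |G.re| ≤ K / b^11 * s0 / u := (Complex.abs_re_le_norm G).trans hg
  set S := ∑' n : ℕ, (vonMangoldt n / (n:ℝ)^(1+δ) * Real.exp (-β * (u - Real.log n)^2))
  set J := ∫ v in Ioi (0:ℝ), Real.exp (-δ * v) * Real.exp (-β * (u-v)^2)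
  have h5 : s0 * |S - J| ≤ s0 * (K * 4^11 * β^11 / u) := by
    rw [← abs_of_pos hs0p, ← abs_mul, abs_of_pos hs0p, mul_sub, ht]
    have : s0 * J - G.re - s0 * J = - G.re := by ring
    rw [this, abs_neg]
    refine hGre.trans (le_of_eq ?_)
    rw [hbdef]; field_simp
  exact le_of_mul_le_mul_left h5 hs0p

end

section
open Filter MeasureTheory Set ArithmeticFunction

lemma gint (β u : ℝ) (hβ : 0 < β) : Integrable (fun v : ℝ => Real.exp (-β * (u-v)^2)) :=
  (integrable_exp_neg_mul_sq hβ).comp_sub_left u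

lemma gint_eq (β u : ℝ) : ∫ v : ℝ, Real.exp (-β * (u-v)^2) = √(Real.pi/β) := by
  rw [integral_sub_left_eq_self (fun v => Real.exp (-β * v^2)) volume u, integral_gaussian]

lemma gtail {β u : ℝ} (hβ : 1/4 ≤ β) (hu : 1 ≤ u) : ∫ v in Iic (0:ℝ), Real.exp (-β * (u-v)^2) ≤ 2^28 * β^11 / u := by
  have hβ0 : 0 < β := by linarith
  have h1 : ∫ v in Iic (0:ℝ), Real.exp (-β * (u-v)^2) ≤ ∫ v in Iic (0:ℝ), Real.exp (-1/4 * u) * Real.exp (1/4 * v) := by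
    refine setIntegral_mono_on (gint β u hβ0).integrableOn ((integrableOn_exp_mul_Iic (by norm_num) 0).const_mul _) measurableSet_Iic ?_
    intro v hv
    simp only [mem_Iic] at hv
    rw [← Real.exp_add]
    apply Real.exp_le_exp.mpr
    have h2 : 1 ≤ u - v := by linarith
    nlinarith [mul_nonneg (by linarith : (0:ℝ) ≤ β - 1/4) (sq_nonneg (u-v))]
  refine h1.trans ?_
  rw [integral_const_mul, integral_exp_mul_Iic (by norm_num)]
  have h3 : Real.exp (-1/4 * u) ≤ 4 / u := by
    rw [le_div_iff₀ (by linarith)]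
    have h5 : u/4 + 1 ≤ Real.exp (u/4) := Real.add_one_le_exp _
    have h6 : Real.exp (-1/4*u) * Real.exp (u/4) = 1 := by rw [← Real.exp_add]; ring_nf; simp
    nlinarith [Real.exp_pos (-1/4*u)]
  have h4 : (1/4:ℝ)^11 ≤ β^11 := by gcongr
  have h7 : (16:ℝ)/u ≤ 2^28 * β^11 / u := by
    gcongr
    nlinarith
  have : Real.exp (-1/4 * u) * (Real.exp (1/4 * 0) / (1/4)) = 4 * Real.exp (-1/4*u) := by simp; ring
  rw [this]
  calc _ ≤ 4 * (4/u) := by gcongr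
    _ = 16/u := by ring
    _ ≤ _ := h7

lemma W_upper : ∃ K > (0:ℝ), ∀ β u : ℝ, 1/4 ≤ β → 0 < u → ∀ S : Finset ℕ,
    ∑ n ∈ S, vonMangoldt n / n * Real.exp (-β * (u - Real.log n)^2) ≤ √(Real.pi/β) + K * β^11 / u := by
  obtain ⟨K, hK, h⟩ := smooth_compare
  refine ⟨K, hK, fun β u hβ hu S => ?_⟩
  have hβ0 : 0 < β := by linarith
  have hlim : Tendsto (fun δ : ℝ => ∑ n ∈ S, vonMangoldt n / (n:ℝ)^(1+δ) * Real.exp (-β * (u - Real.log n)^2)) (nhdsWithin 0 (Ioi 0))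
     (nhds (∑ n ∈ S, vonMangoldt n / n * Real.exp (-β * (u - Real.log n)^2))) := by
    refine tendsto_finset_sum _ fun n _ => ?_
    by_cases hn : n = 0
    · simp [hn]
    refine Tendsto.mul_const _ (Tendsto.mono_left ?_ nhdsWithin_le_nhds)
    have hn' : (0:ℝ) < n := by positivity
    have : ContinuousAt (fun δ : ℝ => vonMangoldt n / (n:ℝ)^(1+δ)) 0 := by
      refine continuousAt_const.div (ContinuousAt.rpow continuousAt_const (by fun_prop) (Or.inl hn'.ne')) (by positivity)
    simpa [ContinuousAt] using this
  refine le_of_tendsto hlim ?_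
  filter_upwards [Ioo_mem_nhdsGT (zero_lt_one)] with δ hδ
  obtain ⟨hs, hc⟩ := h β δ u hβ hδ.1 hδ.2.le hu
  have h1 : ∑ n ∈ S, vonMangoldt n / (n:ℝ)^(1+δ) * Real.exp (-β * (u - Real.log n)^2) ≤ ∑' n : ℕ, vonMangoldt n / (n:ℝ)^(1+δ) * Real.exp (-β * (u - Real.log n)^2) :=
    hs.sum_le_tsum S (fun n _ => mul_nonneg (div_nonneg vonMangoldt_nonneg (by positivity)) (by positivity))
  have h2 : ∫ v in Ioi (0:ℝ), Real.exp (-δ * v) * Real.exp (-β * (u-v)^2) ≤ √(Real.pi/β) := by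
    rw [← gint_eq β u]
    refine le_trans ?_ (setIntegral_le_integral (gint β u hβ0) (s := Ioi 0) (Eventually.of_forall fun v => by positivity))
    have hle : ∀ v ∈ Ioi (0:ℝ), Real.exp (-δ * v) * Real.exp (-β * (u-v)^2) ≤ Real.exp (-β * (u-v)^2) := by
      intro v hv
      refine mul_le_of_le_one_left (by positivity) (Real.exp_le_one_iff.mpr ?_)
      have : (0:ℝ) < v := hv
      nlinarith [hδ.1]
    refine setIntegral_mono_on ?_ (gint β u hβ0).integrableOn measurableSet_Ioi hle
    refine (gint β u hβ0).integrableOn.mono' (by fun_prop) ?_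
    filter_upwards [ae_restrict_mem measurableSet_Ioi] with v hv
    rw [Real.norm_of_nonneg (by positivity)]; exact hle v hv
  have := (abs_le.mp hc).2
  linarith

lemma W_lower : ∃ K > (0:ℝ), ∀ β u : ℝ, 1/4 ≤ β → 1 ≤ u →
    Summable (fun n : ℕ => vonMangoldt n / n * Real.exp (-β * (u - Real.log n)^2)) ∧
    √(Real.pi/β) - K * β^11 / u ≤ ∑' n : ℕ, vonMangoldt n / n * Real.exp (-β * (u - Real.log n)^2) ∧
    ∑' n : ℕ, vonMangoldt n / n * Real.exp (-β * (u - Real.log n)^2) ≤ √(Real.pi/β) + K * β^11 / u := by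
  obtain ⟨K, hK, h⟩ := smooth_compare
  obtain ⟨K1, hK1, hW⟩ := W_upper
  refine ⟨K + K1 + 2^28, by positivity, fun β u hβ hu => ?_⟩
  have hβ0 : 0 < β := by linarith
  have hu0 : 0 < u := by linarith
  have hnn : ∀ n : ℕ, 0 ≤ vonMangoldt n / n * Real.exp (-β * (u - Real.log n)^2) := fun n =>
    mul_nonneg (div_nonneg vonMangoldt_nonneg (by positivity)) (by positivity)
  have hsum : Summable (fun n : ℕ => vonMangoldt n / n * Real.exp (-β * (u - Real.log n)^2)) :=
    summable_of_sum_le hnn (hW β u hβ hu0)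
  refine ⟨hsum, ?_, ?_⟩
  · have hlim : Tendsto (fun δ : ℝ => (∫ v in Ioi (0:ℝ), Real.exp (-δ * v) * Real.exp (-β * (u-v)^2)) - K * β^11/u) (nhdsWithin 0 (Ioi 0))
      (nhds ((∫ v in Ioi (0:ℝ), Real.exp (-β * (u-v)^2)) - K * β^11/u)) := by
      refine Tendsto.sub_const ?_ _
      refine tendsto_integral_filter_of_dominated_convergence (fun v => Real.exp (-β * (u-v)^2)) (Eventually.of_forall fun δ => by fun_prop) ?_ (gint β u hβ0).integrableOn ?_
      · filter_upwards [self_mem_nhdsWithin] with δ hδ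
        filter_upwards [ae_restrict_mem measurableSet_Ioi] with v hv
        rw [Real.norm_of_nonneg (by positivity)]
        refine mul_le_of_le_one_left (by positivity) (Real.exp_le_one_iff.mpr ?_)
        have h1 : (0:ℝ) < v := hv
        have h2 : (0:ℝ) < δ := hδ
        nlinarith
      · refine Eventually.of_forall fun v => ?_
        have : ContinuousAt (fun δ : ℝ => Real.exp (-δ * v) * Real.exp (-β * (u-v)^2)) 0 := by fun_prop
        have h3 := this.tendsto.mono_left (nhdsWithin_le_nhds (s := Ioi 0))
        simpa using h3
    have h1 : (∫ v in Ioi (0:ℝ), Real.exp (-β * (u-v)^2)) - K * β^11/u ≤ ∑' n : ℕ, vonMangoldt n / n * Real.exp (-β * (u - Real.log n)^2) := by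
      refine le_of_tendsto hlim ?_
      filter_upwards [Ioo_mem_nhdsGT (zero_lt_one)] with δ hδ
      obtain ⟨hs, hc⟩ := h β δ u hβ hδ.1 hδ.2.le hu0
      have h2 := (abs_le.mp hc).1
      have h3 : ∑' n : ℕ, vonMangoldt n / (n:ℝ)^(1+δ) * Real.exp (-β * (u - Real.log n)^2) ≤ ∑' n : ℕ, vonMangoldt n / n * Real.exp (-β * (u - Real.log n)^2) := by
        refine hs.tsum_le_tsum (fun n => ?_) hsum
        by_cases hn : n = 0
        · simp [hn]
        have hn1 : (1:ℝ) ≤ n := by exact_mod_cast Nat.one_le_iff_ne_zero.mpr hn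
        have hp : (n:ℝ) ≤ (n:ℝ)^(1+δ) := by
          conv_lhs => rw [← Real.rpow_one (n:ℝ)]
          exact Real.rpow_le_rpow_of_exponent_le hn1 (by linarith [hδ.1])
        have := vonMangoldt_nonneg (n := n)
        gcongr
      linarith
    have h4 : (∫ v in Iic (0:ℝ), Real.exp (-β * (u-v)^2)) + ∫ v in Ioi (0:ℝ), Real.exp (-β * (u-v)^2) = √(Real.pi/β) := by
      rw [← gint_eq β u]
      exact intervalIntegral.integral_Iic_add_Ioi (gint β u hβ0).integrableOn (gint β u hβ0).integrableOn
    have h5 := gtail hβ hu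
    have h6 : (K + K1 + 2^28) * β^11 / u = K * β^11/u + K1 * β^11/u + 2^28 * β^11/u := by ring
    have : 0 < K1 * β^11/u := by positivity
    linarith
  · have h1 := Real.tsum_le_of_sum_le hnn (hW β u hβ hu0)
    have h6 : (K + K1 + 2^28) * β^11 / u = K * β^11/u + K1 * β^11/u + 2^28 * β^11/u := by ring
    have : 0 < K * β^11/u := by positivity
    have : 0 < 2^28 * β^11/u := by positivity
    linarith

end

section
open Filter MeasureTheory Set ArithmeticFunction

lemma gint2 (β y : ℝ) (hβ : 0 < β) : Integrable (fun u : ℝ => Real.exp (-β * (u-y)^2)) :=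
  (integrable_exp_neg_mul_sq hβ).comp_sub_right y

lemma gint2_eq (β y : ℝ) : ∫ u : ℝ, Real.exp (-β * (u-y)^2) = √(Real.pi/β) := by
  rw [integral_sub_right_eq_self (fun v => Real.exp (-β * v^2)) y, integral_gaussian]

lemma sqrt_half {β : ℝ} (hβ : 0 < β) : √(Real.pi/(β/2)) ≤ 2 * √(Real.pi/β) := by
  rw [Real.sqrt_le_left (by positivity), mul_pow, Real.sq_sqrt (by positivity)]
  rw [div_div_eq_mul_div, mul_comm Real.pi 2, mul_div_assoc]
  have : 0 < Real.pi / β := by positivity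
  linarith

lemma E_split {β κ w : ℝ} (hβ : 0 < β) (hκ : 0 < κ) (hw : κ ≤ |w|) :
    Real.exp (-β * w^2) ≤ Real.exp (-(β * κ^2/2)) * Real.exp (-(β/2) * w^2) := by
  rw [← Real.exp_add]
  apply Real.exp_le_exp.mpr
  have : κ^2 ≤ w^2 := by rw [← sq_abs w]; gcongr
  nlinarith

lemma win_lo {β p q : ℝ} (hβ : 0 < β) (hpq : p ≤ q) (y : ℝ) :
    ∫ u in p..q, Real.exp (-β * (u-y)^2) ≤ √(Real.pi/β) := by
  rw [intervalIntegral.integral_of_le hpq, ← gint2_eq β y]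
  exact setIntegral_le_integral (gint2 β y hβ) (Eventually.of_forall fun v => by positivity)

lemma win_up {β κ p q y : ℝ} (hβ : 0 < β) (hκ : 0 < κ) (h1 : p + κ ≤ y) (h2 : y ≤ q - κ) :
    √(Real.pi/β) * (1 - 2 * Real.exp (-(β * κ^2/2))) ≤ ∫ u in p..q, Real.exp (-β * (u-y)^2) := by
  rw [intervalIntegral.integral_of_le (by linarith)]
  have e := integral_add_compl (μ := volume) (measurableSet_Ioc (a := p) (b := q)) (gint2 β y hβ)
  rw [gint2_eq] at e
  have h3 : ∫ u in (Ioc p q)ᶜ, Real.exp (-β * (u-y)^2) ≤ Real.exp (-(β * κ^2/2)) * (2 * √(Real.pi/β)) := by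
    calc _ ≤ ∫ u in (Ioc p q)ᶜ, Real.exp (-(β * κ^2/2)) * Real.exp (-(β/2) * (u-y)^2) := by
          refine setIntegral_mono_on (gint2 β y hβ).integrableOn ((gint2 (β/2) y (by positivity)).const_mul _).integrableOn measurableSet_Ioc.compl ?_
          intro u hu
          apply E_split hβ hκ
          simp only [mem_compl_iff, mem_Ioc, not_and_or, not_lt, not_le] at hu
          rcases hu with hu | hu
          · rw [abs_of_nonpos (by linarith)]; linarith
          · rw [abs_of_nonneg (by linarith)]; linarith
      _ ≤ ∫ u, Real.exp (-(β * κ^2/2)) * Real.exp (-(β/2) * (u-y)^2) :=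
          setIntegral_le_integral ((gint2 (β/2) y (by positivity)).const_mul _) (Eventually.of_forall fun v => by positivity)
      _ = Real.exp (-(β * κ^2/2)) * √(Real.pi/(β/2)) := by rw [integral_const_mul, gint2_eq]
      _ ≤ _ := by gcongr; exact sqrt_half hβ
  linarith

noncomputable def Ssum (a b : ℝ) : ℝ := ∑ n ∈ Finset.Ioc ⌊Real.exp a⌋₊ ⌊Real.exp b⌋₊, vonMangoldt n / n

lemma mem_win {a b : ℝ} {n : ℕ} (hn : n ∈ Finset.Ioc ⌊Real.exp a⌋₊ ⌊Real.exp b⌋₊) : a ≤ Real.log n ∧ Real.log n ≤ b := by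
  rw [Finset.mem_Ioc, Nat.floor_lt (by positivity), Nat.le_floor_iff (by positivity)] at hn
  have h0 : (0:ℝ) < n := (Real.exp_pos a).trans hn.1
  exact ⟨(Real.le_log_iff_exp_le h0).mpr hn.1.le, (Real.log_le_iff_le_exp h0).mpr hn.2⟩

lemma not_mem_win {a b : ℝ} {n : ℕ} (h0 : n ≠ 0) (hn : n ∉ Finset.Ioc ⌊Real.exp a⌋₊ ⌊Real.exp b⌋₊) : Real.log n ≤ a ∨ b ≤ Real.log n := by
  rw [Finset.mem_Ioc, Nat.floor_lt (by positivity), Nat.le_floor_iff (by positivity), not_and_or, not_lt, not_le] at hn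
  have h0 : (0:ℝ) < n := by positivity
  rcases hn with h | h
  · left; exact (Real.log_le_iff_le_exp h0).mpr h
  · right; exact (Real.le_log_iff_exp_le h0).mpr h.le

lemma vM_div_nonneg (n : ℕ) : 0 ≤ vonMangoldt n / (n:ℝ) := div_nonneg vonMangoldt_nonneg (by positivity)

lemma unsm : ∃ C > (0:ℝ), ∀ κ a b : ℝ, 0 < κ → κ ≤ 1/4 → 1 ≤ a * κ^50 → a ≤ b → b ≤ a + 1 → |Ssum a b - (b - a)| ≤ C * κ := by
  obtain ⟨K, hK, hW⟩ := W_lower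
  refine ⟨100 * (1 + K), by positivity, fun κ a b hκ hκ1 ha hab hb => ?_⟩
  set β : ℝ := (κ^4)⁻¹ with hβdef
  have hβκ : β * κ^4 = 1 := inv_mul_cancel₀ (by positivity)
  have hβ1 : 1 ≤ β := by rw [hβdef]; exact (one_le_inv₀ (by positivity)).mpr (pow_le_one₀ hκ.le (by linarith))
  have hβ0 : 0 < β := by linarith
  set σ : ℝ := √(Real.pi/β) with hσ
  have hσ0 : 0 < σ := by rw [hσ]; positivity
  have hσβ : 1 ≤ σ * β := by
    have : 1/β ≤ σ := by
      rw [hσ]; apply Real.le_sqrt_of_sq_le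
      rw [div_pow, one_pow, div_le_div_iff₀ (by positivity) hβ0]
      nlinarith [Real.pi_gt_three]
    rwa [div_le_iff₀ hβ0] at this
  have ha1 : 100 ≤ a := by
    have h1 : κ^50 ≤ (1/4)^50 := by gcongr
    have h2 : (1/4:ℝ)^50 ≤ 1/100 := by norm_num
    have h3 : 0 < a := by
      by_contra hcon
      push Not at hcon
      nlinarith [pow_pos hκ 50]
    nlinarith
  set η : ℝ := Real.exp (-(β * κ^2/2)) with hη
  have hη0 : 0 < η := by positivity
  have hη1 : η ≤ 2 * κ^2 := by
    have h1 : β * κ^2/2 + 1 ≤ Real.exp (β * κ^2/2) := Real.add_one_le_exp _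
    have h2 : η * Real.exp (β * κ^2/2) = 1 := by rw [hη, ← Real.exp_add]; simp
    have h3 : η * (β * κ^2/2) ≤ 1 := by rw [← h2]; gcongr; linarith
    have h4 : η * (β * κ^2/2) * κ^2 ≤ κ^2 := by nlinarith [sq_nonneg κ]
    have h5 : η * (β * κ^2/2) * κ^2 = η / 2 := by
      calc _ = η * (β * κ^4) / 2 := by ring
        _ = _ := by rw [hβκ]; ring
    linarith
  have hκ2 : κ^2 ≤ κ/4 := by nlinarith
  -- the error term
  have hβa : β^11 / a ≤ σ * κ^2 := by
    rw [div_le_iff₀ (by linarith)]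
    have h1 : β^12 ≤ κ^2 * a := by
      have h2 : β^12 * κ^48 = 1 := by
        calc _ = (β * κ^4)^12 := by ring
          _ = 1 := by rw [hβκ]; simp
      have h3 : β^12 * κ^48 ≤ κ^2 * a * κ^48 := by rw [h2]; linarith [show κ^2 * a * κ^48 = a * κ^50 by ring]
      exact le_of_mul_le_mul_right h3 (by positivity)
    calc β^11 = β^11 * 1 := by ring
      _ ≤ β^11 * (σ * β) := by gcongr
      _ = σ * β^12 := by ring
      _ ≤ σ * (κ^2 * a) := by gcongr
      _ = _ := by ring
  have herr : ∀ u, a - κ ≤ u → K * β^11 / u ≤ 2 * K * (σ * κ^2) := by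
    intro u hu
    have hu2 : a/2 ≤ u := by linarith
    calc K * β^11/u ≤ K * β^11 / (a/2) := by gcongr
      _ = 2 * K * (β^11/a) := by field_simp
      _ ≤ _ := by gcongr
  set F : Finset ℕ := Finset.Ioc ⌊Real.exp a⌋₊ ⌊Real.exp b⌋₊ with hF
  have hS0 : 0 ≤ Ssum a b := Finset.sum_nonneg fun n _ => vM_div_nonneg n
  have hIntervalEq : ∀ p q : ℝ, ∫ u in p..q, ∑ n ∈ F, vonMangoldt n / n * Real.exp (-β * (u - Real.log n)^2)
     = ∑ n ∈ F, vonMangoldt n / n * ∫ u in p..q, Real.exp (-β * (u - Real.log n)^2) := by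
    intro p q
    rw [intervalIntegral.integral_finsetSum]
    · simp only [intervalIntegral.integral_const_mul]
    · intro n _; apply Continuous.intervalIntegrable; fun_prop
  -- upper bound
  have hup : Ssum a b * (1 - 2 * η) ≤ (b - a + 2 * κ) * (1 + 2 * K * κ^2) := by
    have h1 : ∑ n ∈ F, vonMangoldt n / n * ∫ u in (a-κ)..(b+κ), Real.exp (-β * (u - Real.log n)^2) ≤ (b + κ - (a - κ)) * (σ + 2 * K * (σ * κ^2)) := by
      rw [← hIntervalEq, ← smul_eq_mul (b + κ - (a - κ)), ← intervalIntegral.integral_const]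
      apply intervalIntegral.integral_mono_on (by linarith)
      · apply Continuous.intervalIntegrable; fun_prop
      · simp
      · intro u hu
        obtain ⟨hs, _, hub⟩ := hW β u (by linarith) (by linarith [hu.1])
        refine (hs.sum_le_tsum F fun n _ => mul_nonneg (vM_div_nonneg n) (by positivity)).trans (hub.trans ?_)
        linarith [herr u hu.1]
    have h2 : Ssum a b * (σ * (1 - 2 * η)) ≤ ∑ n ∈ F, vonMangoldt n / n * ∫ u in (a-κ)..(b+κ), Real.exp (-β * (u - Real.log n)^2) := by
      rw [Ssum, Finset.sum_mul]
      refine Finset.sum_le_sum fun n hn => ?_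
      refine mul_le_mul_of_nonneg_left ?_ (vM_div_nonneg n)
      obtain ⟨m1, m2⟩ := mem_win hn
      exact win_up hβ0 hκ (by linarith) (by linarith)
    have h3 : σ * (Ssum a b * (1 - 2 * η)) ≤ σ * ((b - a + 2 * κ) * (1 + 2 * K * κ^2)) := by
      calc _ = Ssum a b * (σ * (1 - 2 * η)) := by ring
        _ ≤ _ := h2.trans h1
        _ = _ := by ring
    exact le_of_mul_le_mul_left h3 hσ0
  have hlo : (b - a - 2 * κ) * (1 - 2 * K * κ^2 - η * (2 + 2 * K * κ^2)) ≤ Ssum a b ∨ b - a < 2 * κ := by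
    by_cases hc : b - a < 2 * κ
    · right; exact hc
    left
    push Not at hc
    have h1 : (b - κ - (a + κ)) * (σ * (1 - 2 * K * κ^2 - η * (2 + 2 * K * κ^2))) ≤ ∑ n ∈ F, vonMangoldt n / n * ∫ u in (a+κ)..(b-κ), Real.exp (-β * (u - Real.log n)^2) := by
      rw [← hIntervalEq, ← smul_eq_mul (b - κ - (a + κ)), ← intervalIntegral.integral_const]
      apply intervalIntegral.integral_mono_on (by linarith)
      · simp
      · apply Continuous.intervalIntegrable; fun_prop
      · intro u hu
        obtain ⟨hs, hlb, _⟩ := hW β u (by linarith) (by linarith [hu.1])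
        obtain ⟨hs', _, hub'⟩ := hW (β/2) u (by linarith) (by linarith [hu.1])
        have e1 := herr u (by linarith [hu.1])
        have e2 : K * (β/2)^11/u ≤ K * β^11/u := by
          have : 0 < u := by linarith [hu.1]
          gcongr; linarith
        have hsplit : ∑' n : ℕ, vonMangoldt n / n * Real.exp (-β * (u - Real.log n)^2) ≤
          ∑ n ∈ F, vonMangoldt n / n * Real.exp (-β * (u - Real.log n)^2) + η * ∑' n : ℕ, vonMangoldt n / n * Real.exp (-(β/2) * (u - Real.log n)^2) := by
          have hf : HasSum (fun n : ℕ => if n ∈ F then vonMangoldt n / n * Real.exp (-β * (u - Real.log n)^2) else 0) (∑ n ∈ F, vonMangoldt n / n * Real.exp (-β * (u - Real.log n)^2)) := by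
            have := hasSum_sum_of_ne_finset_zero (L := SummationFilter.unconditional ℕ) (f := fun n : ℕ => if n ∈ F then vonMangoldt n / n * Real.exp (-β * (u - Real.log n)^2) else 0) (s := F) (fun n hn => by simp [hn])
            rwa [Finset.sum_congr rfl (g := fun n : ℕ => vonMangoldt n / n * Real.exp (-β * (u - Real.log n)^2)) (fun n hn => by simp [hn])] at this
          have hg := hf.add (hs'.hasSum.mul_left η)
          refine hasSum_le (fun n => ?_) hs.hasSum hg
          by_cases hn : n ∈ F
          · simp only [hn, if_true]
            have : 0 ≤ η * (vonMangoldt n / n * Real.exp (-(β/2) * (u - Real.log n)^2)) := mul_nonneg hη0.le (mul_nonneg (vM_div_nonneg n) (by positivity))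
            linarith
          · simp only [hn, if_false, zero_add]
            by_cases h0 : n = 0
            · simp [h0]
            have hk : κ ≤ |u - Real.log n| := by
              rcases not_mem_win h0 hn with h | h
              · rw [abs_of_nonneg (by linarith [hu.1])]; linarith [hu.1]
              · rw [abs_of_nonpos (by linarith [hu.2])]; linarith [hu.2]
            calc _ ≤ vonMangoldt n / n * (η * Real.exp (-(β/2) * (u - Real.log n)^2)) :=
                  mul_le_mul_of_nonneg_left (E_split hβ0 hκ hk) (vM_div_nonneg n)
              _ = _ := by ring
        have e3 : η * ∑' n : ℕ, vonMangoldt n / n * Real.exp (-(β/2) * (u - Real.log n)^2) ≤ η * (2 * σ + 2 * K * (σ * κ^2)) := by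
          gcongr
          refine hub'.trans ?_
          have := sqrt_half hβ0
          linarith
        have : σ * (1 - 2 * K * κ^2 - η * (2 + 2 * K * κ^2)) = σ - 2 * K * (σ * κ^2) - η * (2 * σ + 2 * K * (σ * κ^2)) := by ring
        linarith
    have h2 : ∑ n ∈ F, vonMangoldt n / n * ∫ u in (a+κ)..(b-κ), Real.exp (-β * (u - Real.log n)^2) ≤ Ssum a b * σ := by
      rw [Ssum, Finset.sum_mul]
      refine Finset.sum_le_sum fun n hn => ?_
      exact mul_le_mul_of_nonneg_left (win_lo hβ0 (by linarith) _) (vM_div_nonneg n)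
    have h3 : σ * ((b - a - 2 * κ) * (1 - 2 * K * κ^2 - η * (2 + 2 * K * κ^2))) ≤ σ * Ssum a b := by
      calc _ = (b - κ - (a + κ)) * (σ * (1 - 2 * K * κ^2 - η * (2 + 2 * K * κ^2))) := by ring
        _ ≤ _ := h1.trans h2
        _ = _ := by ring
    exact le_of_mul_le_mul_left h3 hσ0
  have hη8 : η ≤ κ/2 := by linarith
  have hη9 : η ≤ 1/8 := by linarith
  have hKk : 0 < K * κ := by positivity
  have hKk2 : K * κ^2 ≤ K * κ / 4 := by nlinarith
  rw [abs_le]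
  constructor
  · rcases hlo with h | h
    · have hx : 0 ≤ b - a := by linarith
      have e : 2 * K * κ^2 + η * (2 + 2 * K * κ^2) ≤ 2 * κ + 2 * (K * κ) := by
        have : η * (2 + 2 * K * κ^2) ≤ 2 * η + 2 * K * κ^2 := by nlinarith [show 0 ≤ K * κ^2 by positivity]
        linarith
      by_cases h9 : b - a < 2 * κ
      · linarith
      · push Not at h9
        have h10 : (b - a - 2 * κ) * (2 * K * κ^2 + η * (2 + 2 * K * κ^2)) ≤ 1 * (2 * κ + 2 * (K * κ)) := by
          apply mul_le_mul (by linarith) e (by positivity) (by norm_num)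
        nlinarith
    · nlinarith
  · have hR : (b - a + 2 * κ) * (1 + 2 * K * κ^2) ≤ (b - a) + 2 * κ + 2 * (K * κ) := by nlinarith [show 0 ≤ K * κ^2 by positivity]
    have hS2 : Ssum a b ≤ 2 * (3 + 2 * (K * κ)) := by nlinarith
    have h11 : Ssum a b * (2 * η) ≤ 2 * (3 + 2 * (K * κ)) * (2 * η) := by gcongr
    have h12 : (K * κ) * η ≤ K * κ := by nlinarith
    have h13 : Ssum a b * (1 - 2 * η) = Ssum a b - Ssum a b * (2 * η) := by ring
    have h14 : 2 * (3 + 2 * (K * κ)) * (2 * η) = 12 * η + 8 * ((K * κ) * η) := by ring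
    have h15 : 100 * (1 + K) * κ = 100 * κ + 100 * (K * κ) := by ring
    linarith

end

section
open Filter MeasureTheory Set ArithmeticFunction

lemma psi_block : ∃ C > (0:ℝ), ∀ h h' a : ℝ, 0 < h → h ≤ 1/4 → 1 ≤ a * h^100 → h/2 ≤ h' → h' ≤ h →
    |(Chebyshev.psi (Real.exp (a + h')) - Chebyshev.psi (Real.exp a)) - (Real.exp (a+h') - Real.exp a)| ≤ C * h * (Real.exp (a+h') - Real.exp a) := by
  obtain ⟨C, hC, hS⟩ := unsm
  refine ⟨2 + 6 * C, by positivity, fun h h' a hh hh1 ha h1 h2 => ?_⟩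
  have hh0 : 0 < h' := by linarith
  have hs := hS (h^2) a (a+h') (by positivity) (by nlinarith) (by rw [← pow_mul]; exact ha) (by linarith) (by linarith)
  rw [add_sub_cancel_left] at hs
  have hfl : ⌊Real.exp a⌋₊ ≤ ⌊Real.exp (a+h')⌋₊ := Nat.floor_mono (Real.exp_le_exp.mpr (by linarith))
  have hd : Chebyshev.psi (Real.exp (a + h')) - Chebyshev.psi (Real.exp a) = ∑ n ∈ Finset.Ioc ⌊Real.exp a⌋₊ ⌊Real.exp (a+h')⌋₊, vonMangoldt n := by
    rw [Chebyshev.psi, Chebyshev.psi, sub_eq_iff_eq_add, add_comm (∑ n ∈ Finset.Ioc ⌊Real.exp a⌋₊ _, _), Finset.sum_Ioc_consecutive _ (Nat.zero_le _) hfl]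
  have hbd : ∀ n ∈ Finset.Ioc ⌊Real.exp a⌋₊ ⌊Real.exp (a+h')⌋₊, Real.exp a * (vonMangoldt n / n) ≤ vonMangoldt n ∧ vonMangoldt n ≤ Real.exp (a+h') * (vonMangoldt n / n) := by
    intro n hn
    rw [Finset.mem_Ioc, Nat.floor_lt (by positivity), Nat.le_floor_iff (by positivity)] at hn
    have h0 : (0:ℝ) < n := (Real.exp_pos a).trans hn.1
    have hv := vonMangoldt_nonneg (n := n)
    constructor
    · rw [← mul_div_assoc, div_le_iff₀ h0, mul_comm]; gcongr; exact hn.1.le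
    · rw [← mul_div_assoc, le_div_iff₀ h0, mul_comm]; gcongr; exact hn.2
  have hlo : Real.exp a * Ssum a (a+h') ≤ Chebyshev.psi (Real.exp (a + h')) - Chebyshev.psi (Real.exp a) := by
    rw [hd, Ssum, Finset.mul_sum]; exact Finset.sum_le_sum fun n hn => (hbd n hn).1
  have hup : Chebyshev.psi (Real.exp (a + h')) - Chebyshev.psi (Real.exp a) ≤ Real.exp (a+h') * Ssum a (a+h') := by
    rw [hd, Ssum, Finset.mul_sum]; exact Finset.sum_le_sum fun n hn => (hbd n hn).2
  rw [Real.exp_add] at hup ⊢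
  rw [Real.exp_add] at hlo
  set Δ := Chebyshev.psi (Real.exp a * Real.exp h') - Chebyshev.psi (Real.exp a)
  set S := Ssum a (a+h')
  set E := Real.exp a with hE
  have hE0 : 0 < E := by positivity
  set g := Real.exp h' with hg
  have g1 : h' + 1 ≤ g := Real.add_one_le_exp _
  have g2 : g ≤ 1 + h' + h'^2 := by
    have := Real.abs_exp_sub_one_sub_id_le (x := h') (by rw [abs_of_pos hh0]; linarith)
    have := (abs_le.mp this).2
    linarith
  obtain ⟨s1, s2⟩ := abs_le.mp hs
  have hf : E * g - E = E * (g - 1) := by ring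
  have key : C * h^2 ≤ 2 * C * h * (g - 1) := by
    have : h ≤ 2 * (g-1) := by linarith
    calc C * h^2 = C * h * h := by ring
      _ ≤ C * h * (2 * (g-1)) := by gcongr
      _ = _ := by ring
  have hgh : h' * h' ≤ h * (g - 1) := mul_le_mul h2 (by linarith) hh0.le hh.le
  have hh2 : h'^2 ≤ h' := by nlinarith
  have hCh : 0 ≤ C * h^2 := by positivity
  rw [hf, abs_le]
  constructor
  · have : E * (-((2 + 6 * C) * h * (g - 1))) ≤ E * (S - (g - 1)) := by
      gcongr
      have : 0 ≤ C * h * (g-1) := mul_nonneg (by positivity) (by linarith)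
      have : 0 ≤ h * (g-1) := mul_nonneg (by positivity) (by linarith)
      nlinarith
    nlinarith
  · have : E * (g * S - (g - 1)) ≤ E * ((2 + 6 * C) * h * (g - 1)) := by
      gcongr
      have hg2 : g ≤ 2 := by nlinarith
      have : g * S ≤ g * (h' + C * h^2) := by gcongr; linarith
      have : g * (h' + C * h^2) ≤ (1 + h' + h'^2) * h' + 2 * (C * h^2) := by nlinarith
      nlinarith
    nlinarith

lemma psi_main : ∃ C > (0:ℝ), ∀ h L : ℝ, 0 < h → h ≤ 1/4 → 1 ≤ L/2 * h^100 →
    |Chebyshev.psi (Real.exp L) - Real.exp L| ≤ C * h * Real.exp L := by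
  obtain ⟨C, hC, hB⟩ := psi_block
  refine ⟨C + 10, by positivity, fun h L hh hh1 hL => ?_⟩
  have hh100 : h^100 ≤ h := pow_le_of_le_one hh.le (by linarith) (by norm_num)
  have hLp : 0 < L/2 := by
    by_contra hcon
    push Not at hcon
    nlinarith [pow_pos hh 100]
  have hLh : 1 ≤ L/2 * h := hL.trans (by gcongr)
  have hL4 : 4 ≤ L/2 := by nlinarith
  set J : ℕ := ⌈L/2/h⌉₊ with hJ
  have hJ1 : L/2/h ≤ J := Nat.le_ceil _
  have hJ2 : (J:ℝ) < L/2/h + 1 := Nat.ceil_lt_add_one (by positivity)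
  have hJ0 : (0:ℝ) < J := lt_of_lt_of_le (by positivity) hJ1
  set h' : ℝ := L/2/J with hh'
  have e1 : h' ≤ h := by
    rw [hh', div_le_iff₀ hJ0]
    rw [div_le_iff₀ hh] at hJ1; linarith
  have e2 : h/2 ≤ h' := by
    rw [hh', le_div_iff₀ hJ0]
    have : h * (J:ℝ) ≤ L/2 + h := by
      have := mul_le_mul_of_nonneg_left hJ2.le hh.le
      have h3 : h * (L/2/h + 1) = L/2 + h := by field_simp
      linarith
    linarith
  have e3 : L/2 + J * h' = L := by rw [hh']; field_simp; ring
  have ind : ∀ j : ℕ, |(Chebyshev.psi (Real.exp (L/2 + j * h')) - Chebyshev.psi (Real.exp (L/2))) - (Real.exp (L/2 + j * h') - Real.exp (L/2))| ≤ C * h * (Real.exp (L/2 + j * h') - Real.exp (L/2)) := by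
    intro j
    induction j with
    | zero => simp
    | succ j ih =>
      have hj0 : 0 ≤ (j:ℝ) * h' := mul_nonneg (by positivity) (by linarith)
      have := hB h h' (L/2 + j * h') hh hh1 (hL.trans (by gcongr; linarith)) e2 e1
      have ee : L/2 + j * h' + h' = L/2 + ((j+1 : ℕ) : ℝ) * h' := by push_cast; ring
      rw [ee] at this
      rw [abs_le] at *
      constructor <;> linarith [this.1, this.2, ih.1, ih.2]
  have := ind J
  rw [e3] at this
  have hp1 := Chebyshev.psi_nonneg (Real.exp (L/2))
  have hp2 := Chebyshev.psi_le_const_mul_self (x := Real.exp (L/2)) (by positivity)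
  have hlog4 : Real.log 4 ≤ 4 := (Real.log_le_sub_one_of_pos (by norm_num)).trans (by norm_num)
  have hsm : Real.exp (L/2) ≤ h * Real.exp L := by
    have : Real.exp L = Real.exp (L/2) * Real.exp (L/2) := by rw [← Real.exp_add]; ring_nf
    rw [this]
    have h5 : L/2 + 1 ≤ Real.exp (L/2) := Real.add_one_le_exp _
    have h6 : 1 ≤ h * Real.exp (L/2) := by nlinarith
    nlinarith [Real.exp_pos (L/2)]
  have hp3 : Chebyshev.psi (Real.exp (L/2)) ≤ 8 * Real.exp (L/2) := hp2.trans (by gcongr; linarith)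
  have hx : 0 ≤ C * h * Real.exp (L/2) := by positivity
  have hy := Real.exp_pos (L/2)
  rw [abs_le] at *
  constructor <;> nlinarith [this.1, this.2]

lemma loglog_cond (n : ℕ) : ∀ᶠ t : ℝ in atTop, Real.log (Real.log t) ^ n ≤ Real.log t / 2 := by
  have h := (Real.isLittleO_pow_log_id_atTop (n := n)).comp_tendsto Real.tendsto_log_atTop
  have h2 := h.def (c := 1/2) (by norm_num)
  filter_upwards [h2, Real.tendsto_log_atTop.eventually_ge_atTop 1] with t ht h1
  simp only [Function.comp, id] at ht
  have : Real.log (Real.log t) ^ n ≤ ‖Real.log (Real.log t) ^ n‖ := Real.le_norm_self _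
  rw [Real.norm_of_nonneg (by linarith : 0 ≤ Real.log t)] at ht
  linarith

open Asymptotics in
/-- Quantitative prime number theorem. -/
lemma pnt : ∃ K > (0:ℝ), ∃ t₀ : ℝ, ∀ t ≥ t₀,
    |(Nat.primeCounting ⌊t⌋₊ : ℝ) - t / Real.log t| ≤ K * (t / Real.log t) / Real.log (Real.log t) := by
  obtain ⟨C, hC, h⟩ := psi_main
  obtain ⟨C', hC', hO⟩ := Chebyshev.primeCounting_sub_theta_div_log_isBigO.exists_pos
  refine ⟨C + C', by positivity, ?_⟩
  rw [← Filter.eventually_atTop]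
  have hll := Real.tendsto_log_atTop.comp (Real.tendsto_log_atTop)
  filter_upwards [loglog_cond 100, hO.bound, hll.eventually_ge_atTop 4, Real.tendsto_log_atTop.eventually_ge_atTop 4, eventually_gt_atTop 1] with t h1 h2 h3 h4 h5
  simp only [Function.comp] at h3
  set l := Real.log t with hl
  set m := Real.log l with hm
  have ht0 : 0 < t := by linarith
  have hexp : Real.exp l = t := Real.exp_log ht0
  have hm0 : 0 < m := by linarith
  have hl0 : 0 < l := by linarith
  have hψ := h (1/m) l (by positivity) (by rw [div_le_div_iff₀ hm0 (by norm_num)]; linarith) (by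
    rw [one_div, inv_pow, ← div_eq_mul_inv, le_div_iff₀ (by positivity)]; linarith)
  rw [hexp] at hψ
  have e : C * (1/m) * t = C * t / m := by ring
  rw [e] at hψ
  obtain ⟨p1, p2⟩ := abs_le.mp hψ
  have hlow := Chebyshev.psi_le_primeCounting_mul_log' t
  have hth := Chebyshev.theta_le_psi t
  rw [Real.norm_eq_abs, Real.norm_of_nonneg (by positivity)] at h2
  have h2' := (abs_le.mp h2).2
  rw [← hl] at hlow
  have hml : m ≤ l := (Real.log_le_sub_one_of_pos hl0).trans (by linarith)
  rw [abs_le]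
  constructor
  · have : t / l - C * t/m / l ≤ (Nat.primeCounting ⌊t⌋₊ : ℝ) := by
      rw [← sub_div, div_le_iff₀ hl0]; linarith
    have e2 : (C + C') * (t/l)/m = C * t/m/l + C' * (t/l)/m := by field_simp
    have : 0 ≤ C' * (t/l)/m := by positivity
    linarith
  · have e2 : (C + C') * (t/l)/m = C * t/m/l + C' * (t/l)/m := by field_simp
    have e3 : C' * (t/l^2) ≤ C' * (t/l)/m := by
      calc C' * (t/l^2) = C' * (t/l)/l := by field_simp
        _ ≤ _ := by gcongr
    have e4 : Chebyshev.theta t / l ≤ t/l + C*t/m/l := by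
      rw [← add_div]; gcongr; linarith
    linarith

end

section
open Filter MeasureTheory Set ArithmeticFunction

/-- sum of reciprocals of primes up to `n`. -/
noncomputable def Rec (n : ℕ) : ℝ := ∑ p ∈ (Finset.Icc 1 n).filter Nat.Prime, (1 / (p:ℝ))

noncomputable def invHom : ℕ →* ℝ where
  toFun n := if n = 0 then 0 else ((n:ℝ))⁻¹
  map_one' := by simp
  map_mul' a b := by
    by_cases ha : a = 0 <;> by_cases hb : b = 0 <;> simp [ha, hb, mul_comm]

lemma Rec_lower (n : ℕ) (hn : 2 ≤ n) : Real.log (Real.log n) - 1 ≤ Rec n := by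
  have h1 : ∀ {p : ℕ}, p.Prime → ‖invHom p‖ < 1 := by
    intro p hp
    have : (1:ℝ) < p := by exact_mod_cast hp.one_lt
    simp only [invHom, MonoidHom.coe_mk, OneHom.coe_mk, hp.ne_zero, if_false, norm_inv]
    rw [Real.norm_of_nonneg (by positivity)]
    exact inv_lt_one_of_one_lt₀ this
  obtain ⟨hs, hsum⟩ := EulerProduct.summable_and_hasSum_factoredNumbers_prod_filter_prime_geometric (f := invHom) h1 (Finset.Icc 1 n)
  have hharm : Real.log n ≤ ∏ p ∈ (Finset.Icc 1 n).filter Nat.Prime, (1 - invHom p)⁻¹ := by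
    have a1 : Real.log n ≤ ∑ k ∈ Finset.Icc 1 n, ((k:ℝ))⁻¹ := by
      have := log_add_one_le_harmonic n
      rw [harmonic_eq_sum_Icc] at this
      push_cast at this
      refine le_trans ?_ this
      apply Real.log_le_log
      · positivity
      · linarith
    refine a1.trans ?_
    have hmem : ∀ k ∈ Finset.Icc 1 n, k ∈ Nat.factoredNumbers (Finset.Icc 1 n) := by
      intro k hk
      rw [Finset.mem_Icc] at hk
      rw [Nat.mem_factoredNumbers]
      refine ⟨by omega, fun p hp => ?_⟩
      have := Nat.le_of_mem_primeFactorsList hp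
      have := Nat.prime_of_mem_primeFactorsList hp
      rw [Finset.mem_Icc]
      exact ⟨this.one_lt.le, by omega⟩
    have := sum_le_hasSum ((Finset.Icc 1 n).attach.map ⟨fun k => (⟨k.1, hmem k.1 k.2⟩ : Nat.factoredNumbers (Finset.Icc 1 n)), fun a b h => Subtype.ext (congrArg (fun z => z.1) h)⟩) (fun i _ => by
      simp only [invHom, MonoidHom.coe_mk, OneHom.coe_mk]; positivity) hsum
    refine le_trans (le_of_eq ?_) this
    rw [Finset.sum_map]
    rw [← Finset.sum_attach]
    apply Finset.sum_congr rfl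
    intro k _
    change _ = invHom k.1
    have := k.2
    rw [Finset.mem_Icc] at this
    simp only [invHom, MonoidHom.coe_mk, OneHom.coe_mk]
    rw [if_neg (by omega)]
  have hlogpos : 0 < Real.log n := Real.log_pos (by exact_mod_cast (by omega : 1 < n))
  have h2 := Real.log_le_log hlogpos hharm
  have hterm : ∀ p ∈ (Finset.Icc 1 n).filter Nat.Prime, 0 < (1 - invHom p)⁻¹ ∧ Real.log ((1 - invHom p)⁻¹) ≤ 1 / (p:ℝ) + 1 / ((p:ℝ) * ((p:ℝ) - 1)) := by
    intro p hp
    rw [Finset.mem_filter] at hp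
    have : (2:ℝ) ≤ p := by exact_mod_cast hp.2.two_le
    have e : (1 - invHom p)⁻¹ = p/((p:ℝ) - 1) := by
      simp only [invHom, MonoidHom.coe_mk, OneHom.coe_mk, hp.2.ne_zero, if_false]
      have : (p:ℝ) - 1 ≠ 0 := by linarith
      field_simp
    rw [e]
    have hp1 : 0 < (p:ℝ) - 1 := by linarith
    refine ⟨by positivity, ?_⟩
    refine (Real.log_le_sub_one_of_pos (by positivity)).trans (le_of_eq ?_)
    field_simp; ring
  rw [Real.log_prod (fun p hp => (hterm p hp).1.ne')] at h2
  have h3 := Finset.sum_le_sum (fun p hp => (hterm p hp).2)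
  rw [Finset.sum_add_distrib] at h3
  have h4 : ∑ p ∈ (Finset.Icc 1 n).filter Nat.Prime, 1 / ((p:ℝ) * ((p:ℝ) - 1)) ≤ 1 := by
    have tel : ∀ m : ℕ, 1 ≤ m → ∑ p ∈ Finset.Icc 2 m, 1 / ((p:ℝ) * ((p:ℝ) - 1)) = 1 - 1/m := by
      intro m hm
      induction m, hm using Nat.le_induction with
      | base => simp
      | succ m hm ih =>
        rw [Finset.sum_Icc_succ_top (by omega), ih]
        have : (0:ℝ) < m := by exact_mod_cast hm
        push_cast
        rw [add_sub_cancel_right]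
        field_simp
        ring
    calc _ ≤ ∑ p ∈ Finset.Icc 2 n, 1 / ((p:ℝ) * ((p:ℝ) - 1)) := by
          apply Finset.sum_le_sum_of_subset_of_nonneg
          · intro p hp
            rw [Finset.mem_filter, Finset.mem_Icc] at hp
            rw [Finset.mem_Icc]; exact ⟨hp.2.two_le, hp.1.2⟩
          · intro p hp _
            rw [Finset.mem_Icc] at hp
            have : (2:ℝ) ≤ p := by exact_mod_cast hp.1
            have : 0 ≤ (p:ℝ) - 1 := by linarith
            positivity
      _ = 1 - 1/n := tel n (by omega)
      _ ≤ 1 := by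
        have : (0:ℝ) ≤ 1/n := by positivity
        linarith
  unfold Rec
  linarith

/-- block bound -/
lemma block_bound : ∃ C > (0:ℝ), ∃ k₀ : ℕ, 1 ≤ k₀ ∧ ∀ k : ℕ, k₀ ≤ k → Ssum k (k+1) ≤ 1 + C * (k:ℝ)^(-(1/50:ℝ)) := by
  obtain ⟨C, hC, h⟩ := unsm
  refine ⟨C, hC, 4^50, by norm_num, fun k hk => ?_⟩
  have hk' : (4:ℝ)^50 ≤ k := by exact_mod_cast hk
  have hk0 : (0:ℝ) < k := lt_of_lt_of_le (by norm_num) hk'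
  have e : ((k:ℝ)^(-(1/50:ℝ)))^50 = (k:ℝ)⁻¹ := by
    rw [← Real.rpow_natCast, ← Real.rpow_mul hk0.le]
    norm_num
    rw [Real.rpow_neg_one]
  have := h ((k:ℝ)^(-(1/50:ℝ))) k (k+1) (by positivity) ?_ ?_ (by linarith) le_rfl
  · have := (abs_le.mp this).2
    linarith
  · by_contra hcon
    push Not at hcon
    have h1 : (1/4:ℝ)^50 < ((k:ℝ)^(-(1/50:ℝ)))^50 := pow_lt_pow_left₀ hcon (by norm_num) (by norm_num)
    rw [e] at h1
    have : (k:ℝ)⁻¹ ≤ ((4:ℝ)^50)⁻¹ := by gcongr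
    rw [div_pow, one_pow, one_div] at h1
    linarith
  · rw [e, mul_inv_cancel₀ hk0.ne']

lemma prime_le_vM {p : ℕ} (hp : p.Prime) : vonMangoldt p = Real.log p := vonMangoldt_apply_prime hp

lemma sum_blocks (f : ℕ → ℝ) (k₀ K : ℕ) (h : k₀ ≤ K) :
    ∑ n ∈ Finset.Icc 1 ⌊Real.exp K⌋₊, f n = ∑ n ∈ Finset.Icc 1 ⌊Real.exp k₀⌋₊, f n + ∑ k ∈ Finset.Ico k₀ K, ∑ n ∈ Finset.Ioc ⌊Real.exp k⌋₊ ⌊Real.exp (k+1)⌋₊, f n := by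
  induction K, h using Nat.le_induction with
  | base => simp
  | succ K hK ih =>
    rw [Finset.sum_Ico_succ_top hK, ← add_assoc, ← ih]
    push_cast
    rw [← Finset.sum_union]
    · congr 1
      have : ⌊Real.exp (K:ℝ)⌋₊ ≤ ⌊Real.exp ((K:ℝ)+1)⌋₊ := Nat.floor_mono (Real.exp_le_exp.mpr (by linarith))
      ext n; simp only [Finset.mem_Icc, Finset.mem_union, Finset.mem_Ioc]; omega
    · rw [Finset.disjoint_left]
      intro n; simp only [Finset.mem_Icc, Finset.mem_Ioc]; omega

lemma Rec_upper : ∃ A > (0:ℝ), ∀ n : ℕ, 3 ≤ n → Rec n ≤ Real.log (Real.log n) + A := by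
  obtain ⟨C, hC, k₀, hk₀, hb⟩ := block_bound
  have hsumm : Summable (fun k : ℕ => C * (k:ℝ)^(-(51/50:ℝ))) := (Real.summable_nat_rpow.mpr (by norm_num)).mul_left C
  set T := ∑' k : ℕ, C * (k:ℝ)^(-(51/50:ℝ))
  have hT : 0 ≤ T := tsum_nonneg fun k => by positivity
  set f : ℕ → ℝ := fun n => if n.Prime then 1/(n:ℝ) else 0 with hf
  have hf0 : ∀ n, 0 ≤ f n := fun n => by simp only [hf]; split_ifs <;> positivity
  set B := ∑ n ∈ Finset.Icc 1 ⌊Real.exp k₀⌋₊, f n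
  have hB : 0 ≤ B := Finset.sum_nonneg fun n _ => hf0 n
  refine ⟨B + T + 5 + k₀, by positivity, fun n hn => ?_⟩
  have hn3 : (3:ℝ) ≤ n := by exact_mod_cast hn
  have hl1 : 1 ≤ Real.log n := by
    rw [Real.le_log_iff_exp_le (by linarith)]
    exact (Real.exp_one_lt_d9.le.trans (by norm_num)).trans hn3
  set K := max k₀ ⌈Real.log n⌉₊ with hK
  have hKk : k₀ ≤ K := le_max_left _ _
  have hKn : n ≤ ⌊Real.exp K⌋₊ := by
    rw [Nat.le_floor_iff (by positivity)]
    have : Real.log n ≤ K := (Nat.le_ceil _).trans (by exact_mod_cast le_max_right _ _)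
    rwa [Real.log_le_iff_le_exp (by linarith)] at this
  have h1 : Rec n ≤ ∑ m ∈ Finset.Icc 1 ⌊Real.exp K⌋₊, f m := by
    unfold Rec
    rw [Finset.sum_filter]
    exact Finset.sum_le_sum_of_subset_of_nonneg (Finset.Icc_subset_Icc le_rfl hKn) (fun i _ _ => hf0 i)
  rw [sum_blocks f k₀ K hKk] at h1
  have h2 : ∀ k ∈ Finset.Ico k₀ K, ∑ m ∈ Finset.Ioc ⌊Real.exp k⌋₊ ⌊Real.exp (k+1)⌋₊, f m ≤ 1/(k:ℝ) + C * (k:ℝ)^(-(51/50:ℝ)) := by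
    intro k hk
    rw [Finset.mem_Ico] at hk
    have hk0 : (0:ℝ) < k := by exact_mod_cast (by omega : 0 < k)
    calc _ ≤ ∑ m ∈ Finset.Ioc ⌊Real.exp k⌋₊ ⌊Real.exp (k+1)⌋₊, (1/(k:ℝ)) * (vonMangoldt m / m) := by
          apply Finset.sum_le_sum
          intro m hm
          have hw := (mem_win hm).1
          simp only [hf]
          split_ifs with hp
          · rw [vonMangoldt_apply_prime hp]
            have : (0:ℝ) < m := by exact_mod_cast hp.pos
            rw [div_mul_div_comm, div_le_div_iff₀ this (by positivity)]
            nlinarith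
          · have := vM_div_nonneg m
            positivity
      _ = (1/(k:ℝ)) * Ssum k (k+1) := by rw [← Finset.mul_sum]; rfl
      _ ≤ (1/(k:ℝ)) * (1 + C * (k:ℝ)^(-(1/50:ℝ))) := by gcongr; exact hb k hk.1
      _ = _ := by
        have : (k:ℝ)^(-(51/50:ℝ)) = (k:ℝ)⁻¹ * (k:ℝ)^(-(1/50:ℝ)) := by
          rw [← Real.rpow_neg_one, ← Real.rpow_add hk0]; norm_num
        rw [this]; ring
  have h3 := Finset.sum_le_sum h2
  rw [Finset.sum_add_distrib] at h3
  have h4 : ∑ k ∈ Finset.Ico k₀ K, C * (k:ℝ)^(-(51/50:ℝ)) ≤ T := hsumm.sum_le_tsum _ (fun k _ => by positivity)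
  have hKpos : 1 ≤ K := hk₀.trans hKk
  have h5 : ∑ k ∈ Finset.Ico k₀ K, 1/(k:ℝ) ≤ 1 + Real.log K := by
    have := harmonic_le_one_add_log K
    rw [harmonic_eq_sum_Icc] at this
    push_cast at this
    refine le_trans ?_ this
    simp only [one_div]
    apply Finset.sum_le_sum_of_subset_of_nonneg
    · intro k hk
      rw [Finset.mem_Ico] at hk
      rw [Finset.mem_Icc]; omega
    · intros; positivity
  have h6 : Real.log K ≤ Real.log (Real.log n) + 1 + k₀ := by
    have hk0' : (1:ℝ) ≤ k₀ := by exact_mod_cast hk₀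
    have hKle : (K:ℝ) ≤ Real.log n * (2 * k₀) := by
      rw [hK]; push_cast
      apply max_le
      · nlinarith
      · have := (Nat.ceil_lt_add_one (by linarith : 0 ≤ Real.log n)).le
        nlinarith
    have : Real.log K ≤ Real.log (Real.log n * (2 * k₀)) := Real.log_le_log (by exact_mod_cast hKpos) hKle
    rw [Real.log_mul (by linarith) (by positivity), Real.log_mul (by norm_num) (by positivity)] at this
    have e1 := Real.log_le_sub_one_of_pos (by norm_num : (0:ℝ) < 2)
    have e2 := Real.log_le_sub_one_of_pos (by linarith : (0:ℝ) < k₀)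
    linarith
  linarith

noncomputable def RecL (n : ℕ) : ℝ := ∑ p ∈ (Finset.Icc 1 n).filter Nat.Prime, (Real.log p / (p:ℝ))

lemma RecL_upper : ∃ A > (0:ℝ), ∀ n : ℕ, 3 ≤ n → RecL n ≤ A * Real.log n := by
  obtain ⟨C, hC, k₀, hk₀, hb⟩ := block_bound
  set f : ℕ → ℝ := fun n => vonMangoldt n / n with hf
  have hf0 : ∀ n, 0 ≤ f n := fun n => vM_div_nonneg n
  set B := ∑ n ∈ Finset.Icc 1 ⌊Real.exp k₀⌋₊, f n
  have hB : 0 ≤ B := Finset.sum_nonneg fun n _ => hf0 n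
  have hk0' : (1:ℝ) ≤ k₀ := by exact_mod_cast hk₀
  refine ⟨B + (1 + C) * (2 * k₀), by positivity, fun n hn => ?_⟩
  have hn3 : (3:ℝ) ≤ n := by exact_mod_cast hn
  have hl1 : 1 ≤ Real.log n := by
    rw [Real.le_log_iff_exp_le (by linarith)]
    exact (Real.exp_one_lt_d9.le.trans (by norm_num)).trans hn3
  set K := max k₀ ⌈Real.log n⌉₊ with hK
  have hKk : k₀ ≤ K := le_max_left _ _
  have hKn : n ≤ ⌊Real.exp K⌋₊ := by
    rw [Nat.le_floor_iff (by positivity)]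
    have : Real.log n ≤ K := (Nat.le_ceil _).trans (by exact_mod_cast le_max_right _ _)
    rwa [Real.log_le_iff_le_exp (by linarith)] at this
  have h1 : RecL n ≤ ∑ m ∈ Finset.Icc 1 ⌊Real.exp K⌋₊, f m := by
    unfold RecL
    calc _ ≤ ∑ m ∈ Finset.Icc 1 n with m.Prime, f m := by
          apply Finset.sum_le_sum
          intro p hp
          rw [Finset.mem_filter] at hp
          simp only [hf, vonMangoldt_apply_prime hp.2, le_refl]
      _ ≤ _ := Finset.sum_le_sum_of_subset_of_nonneg ((Finset.filter_subset _ _).trans (Finset.Icc_subset_Icc le_rfl hKn)) (fun i _ _ => hf0 i)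
  rw [sum_blocks f k₀ K hKk] at h1
  have h2 : ∀ k ∈ Finset.Ico k₀ K, ∑ m ∈ Finset.Ioc ⌊Real.exp k⌋₊ ⌊Real.exp (k+1)⌋₊, f m ≤ 1 + C := by
    intro k hk
    rw [Finset.mem_Ico] at hk
    have hk0 : (1:ℝ) ≤ k := by exact_mod_cast (by omega : 1 ≤ k)
    refine (hb k hk.1).trans ?_
    have : (k:ℝ)^(-(1/50:ℝ)) ≤ 1 := Real.rpow_le_one_of_one_le_of_nonpos hk0 (by norm_num)
    nlinarith
  have h3 := Finset.sum_le_sum h2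
  rw [Finset.sum_const, Nat.card_Ico, nsmul_eq_mul] at h3
  have hKle : (K:ℝ) ≤ Real.log n * (2 * k₀) := by
    rw [hK]; push_cast
    apply max_le
    · nlinarith
    · have := (Nat.ceil_lt_add_one (by linarith : 0 ≤ Real.log n)).le
      nlinarith
  have h4 : ((K - k₀ : ℕ):ℝ) ≤ K := by exact_mod_cast Nat.sub_le _ _
  have h5 : ((K - k₀ : ℕ):ℝ) * (1 + C) ≤ Real.log n * (2 * k₀) * (1 + C) := by gcongr; linarith
  nlinarith

end

section
open Filter

noncomputable def PIr (m : ℕ) : ℝ := (Nat.primeCounting m : ℝ)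

lemma PIr_nonneg (m : ℕ) : 0 ≤ PIr m := by unfold PIr; positivity

lemma PIr_eq (m : ℕ) : PIr m = (((Finset.Icc 1 m).filter Nat.Prime).card : ℝ) := by
  unfold PIr Nat.primeCounting Nat.primeCounting'
  rw [Nat.count_eq_card_filter_range]
  congr 2
  ext q
  simp only [Finset.mem_filter, Finset.mem_range, Finset.mem_Icc]
  constructor
  · rintro ⟨h1, h2⟩; exact ⟨⟨h2.one_lt.le, by omega⟩, h2⟩
  · rintro ⟨h1, h2⟩; exact ⟨by omega, h2⟩

lemma pi_div (x : ℝ) (p : ℕ) : PIr (⌊x⌋₊ / p) = (Nat.primeCounting ⌊x / p⌋₊ : ℝ) := by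
  unfold PIr
  rw [Nat.floor_div_natCast]

lemma tendsto_ll : Tendsto (fun x : ℝ => Real.log (Real.log x)) atTop atTop :=
  Real.tendsto_log_atTop.comp Real.tendsto_log_atTop

lemma tendsto_lll : Tendsto (fun x : ℝ => Real.log (Real.log (Real.log x))) atTop atTop :=
  Real.tendsto_log_atTop.comp tendsto_ll

lemma pi_bounds : ∃ K > (0:ℝ), ∀ᶠ x : ℝ in atTop, ∀ p : ℕ, 1 ≤ p → (p:ℝ) ≤ √x →
    PIr (⌊x⌋₊ / p) ≤ (1 + K / Real.log (Real.log x)) * (x / Real.log x) * (1 / p * (1 + 2 * Real.log p / Real.log x)) ∧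
    (1 - K / Real.log (Real.log x)) * (x / Real.log x) * (1 / p) ≤ PIr (⌊x⌋₊ / p) := by
  obtain ⟨K, hK, t₀, h⟩ := pnt
  refine ⟨2 * K, by positivity, ?_⟩
  filter_upwards [eventually_ge_atTop (t₀^2), eventually_gt_atTop 1, Real.tendsto_log_atTop.eventually_ge_atTop 4, tendsto_ll.eventually_ge_atTop 4, tendsto_ll.eventually_ge_atTop (4*K)] with x h1 h2 h3 h4 h4'
  intro p hp hpx
  have hx0 : 0 < x := by linarith
  have hp0 : (0:ℝ) < p := by exact_mod_cast hp
  have hp1 : (1:ℝ) ≤ p := by exact_mod_cast hp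
  have hsx : √x * √x = x := Real.mul_self_sqrt hx0.le
  have hsx0 : 0 < √x := Real.sqrt_pos.mpr hx0
  have hge : √x ≤ x / p := by
    rw [le_div_iff₀ hp0]; nlinarith
  have ht : t₀ ≤ x / p := by
    refine le_trans ?_ hge
    exact Real.le_sqrt_of_sq_le h1
  have hb := h _ ht
  rw [pi_div]
  set l := Real.log x with hl
  set ll := Real.log l with hll
  have hlp0 : 0 ≤ Real.log p := Real.log_nonneg hp1
  have hlp : Real.log p ≤ l/2 := by
    have := Real.log_le_log hp0 hpx
    rw [Real.log_sqrt hx0.le] at this; exact this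
  have e1 : Real.log (x / p) = l - Real.log p := Real.log_div hx0.ne' hp0.ne'
  set t := x / p with htdef
  have ht0 : 0 < t := by positivity
  have hlt : l/2 ≤ Real.log t := by rw [e1]; linarith
  have hlt0 : 0 < Real.log t := by linarith
  have hllt : ll / 2 ≤ Real.log (Real.log t) := by
    have h5 : Real.log (l/2) ≤ Real.log (Real.log t) := Real.log_le_log (by linarith) hlt
    rw [Real.log_div (by linarith) (by norm_num)] at h5
    have h6 := Real.log_le_sub_one_of_pos (by norm_num : (0:ℝ) < 2)
    linarith
  have herr : K * (t / Real.log t) / Real.log (Real.log t) ≤ (2 * K / ll) * (t / Real.log t) := by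
    calc _ = K * (t / Real.log t) * (1 / Real.log (Real.log t)) := by ring
      _ ≤ K * (t / Real.log t) * (1 / (ll/2)) := by gcongr
      _ = _ := by field_simp
  have hab := abs_le.mp hb
  have hl0 : 0 < l := by linarith
  have hll0 : 0 < ll := by linarith
  have hinv : 1 / Real.log t ≤ 1 / l * (1 + 2 * Real.log p / l) := by
    rw [e1, div_le_iff₀ (by linarith)]
    have : 1 / l * (1 + 2 * Real.log p / l) * (l - Real.log p) = 1 + (Real.log p / l) * (1 - 2 * Real.log p / l) := by
      field_simp; ring
    rw [this]
    have : 2 * Real.log p / l ≤ 1 := by rw [div_le_one hl0]; linarith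
    have : 0 ≤ (Real.log p / l) * (1 - 2 * Real.log p / l) := mul_nonneg (by positivity) (by linarith)
    linarith
  have hinv2 : 1 / l ≤ 1 / Real.log t := by
    apply one_div_le_one_div_of_le hlt0
    rw [e1]; linarith
  constructor
  · calc _ ≤ (1 + 2 * K / ll) * (t * (1 / Real.log t)) := by
          rw [mul_one_div]; linarith [hab.2]
      _ ≤ (1 + 2 * K / ll) * (t * (1 / l * (1 + 2 * Real.log p / l))) := by gcongr
      _ = _ := by rw [htdef]; ring
  · have h7 : 0 ≤ 1 - 2 * K / ll := by
      have : 2 * K / ll ≤ 1 := by rw [div_le_one hll0]; linarith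
      linarith
    calc _ = (1 - 2 * K / ll) * (t * (1 / l)) := by rw [htdef]; ring
      _ ≤ (1 - 2 * K / ll) * (t * (1 / Real.log t)) := by gcongr
      _ ≤ _ := by rw [mul_one_div]; linarith [hab.1]

/-- crude bound -/
lemma pi_crude : ∃ K > (0:ℝ), ∀ᶠ x : ℝ in atTop, ∀ p : ℕ, 1 ≤ p → (p:ℝ) ≤ √x →
    PIr (⌊x⌋₊ / p) ≤ K * (x / Real.log x) / p := by
  obtain ⟨K, hK, h⟩ := pi_bounds
  refine ⟨2 * (1 + K), by positivity, ?_⟩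
  filter_upwards [h, eventually_gt_atTop 1, Real.tendsto_log_atTop.eventually_ge_atTop 4, tendsto_ll.eventually_ge_atTop 4] with x h h2 h3 h4
  intro p hp hpx
  have hx0 : 0 < x := by linarith
  have hp0 : (0:ℝ) < p := by exact_mod_cast hp
  refine (h p hp hpx).1.trans ?_
  have hlp : Real.log p ≤ Real.log x/2 := by
    have := Real.log_le_log hp0 hpx
    rw [Real.log_sqrt hx0.le] at this; exact this
  have a1 : K / Real.log (Real.log x) ≤ K := div_le_self hK.le (by linarith)
  have a2 : 2 * Real.log p / Real.log x ≤ 1 := by rw [div_le_one (by linarith)]; linarith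
  have a3 : 0 ≤ K / Real.log (Real.log x) := by apply div_nonneg <;> linarith
  have a4 : 0 < Real.log x := by linarith
  calc _ ≤ (1 + K) * (x / Real.log x) * (1 / p * (1 + 1)) := by gcongr
    _ = _ := by ring

def PP (n : ℕ) : Finset (ℕ × ℕ) := ((Finset.Icc 1 n) ×ˢ (Finset.Icc 1 n)).filter (fun pq => pq.1.Prime ∧ pq.2.Prime ∧ pq.1 * pq.2 ≤ n)

lemma mem_PP {n : ℕ} {pq : ℕ × ℕ} : pq ∈ PP n ↔ pq.1.Prime ∧ pq.2.Prime ∧ pq.1 * pq.2 ≤ n := by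
  unfold PP
  rw [Finset.mem_filter, Finset.mem_product, Finset.mem_Icc, Finset.mem_Icc]
  constructor
  · exact fun h => h.2
  · rintro ⟨h1, h2, h3⟩
    refine ⟨⟨⟨h1.pos, ?_⟩, ⟨h2.pos, ?_⟩⟩, h1, h2, h3⟩
    · exact (Nat.le_mul_of_pos_right _ h2.pos).trans h3
    · exact (Nat.le_mul_of_pos_left _ h1.pos).trans h3

lemma PP_sum (n : ℕ) (g : ℕ → ℕ → ℝ) :
    ∑ pq ∈ PP n, g pq.1 pq.2 = ∑ p ∈ (Finset.Icc 1 n).filter Nat.Prime, ∑ q ∈ (Finset.Icc 1 (n/p)).filter Nat.Prime, g p q := by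
  rw [Finset.sum_sigma']
  refine Finset.sum_bij' (fun pq _ => ⟨pq.1, pq.2⟩) (fun s _ => (s.1, s.2)) ?_ ?_ ?_ ?_ ?_
  · intro pq hpq
    have h := mem_PP.mp hpq
    have h2 := (Finset.mem_filter.mp hpq).1
    rw [Finset.mem_product] at h2
    simp only [Finset.mem_sigma, Finset.mem_filter]
    refine ⟨⟨h2.1, h.1⟩, ?_, h.2.1⟩
    rw [Finset.mem_Icc, Nat.le_div_iff_mul_le h.1.pos]
    exact ⟨h.2.1.pos, by rw [mul_comm]; exact h.2.2⟩
  · rintro ⟨p, q⟩ hs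
    simp only [Finset.mem_sigma, Finset.mem_filter, Finset.mem_Icc] at hs
    rw [mem_PP]
    refine ⟨hs.1.2, hs.2.2, ?_⟩
    have := hs.2.1.2
    rw [Nat.le_div_iff_mul_le hs.1.2.pos] at this
    change p * q ≤ n
    rw [mul_comm]; exact this
  · intros; rfl
  · intros; rfl
  · intros; rfl

lemma PP_sum_fst (n : ℕ) (f : ℕ → ℝ) :
    ∑ pq ∈ PP n, f pq.1 = ∑ p ∈ (Finset.Icc 1 n).filter Nat.Prime, f p * PIr (n/p) := by
  rw [PP_sum n (fun p _ => f p)]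
  apply Finset.sum_congr rfl
  intro p _
  rw [PIr_eq]; simp [mul_comm]

lemma PP_sum_swap (n : ℕ) (g : ℕ → ℕ → ℝ) : ∑ pq ∈ PP n, g pq.1 pq.2 = ∑ pq ∈ PP n, g pq.2 pq.1 := by
  refine Finset.sum_bij' (fun pq _ => (pq.2, pq.1)) (fun pq _ => (pq.2, pq.1)) ?_ ?_ ?_ ?_ ?_
  · intro pq h; rw [mem_PP] at *; exact ⟨h.2.1, h.1, by rw [mul_comm]; exact h.2.2⟩
  · intro pq h; rw [mem_PP] at *; exact ⟨h.2.1, h.1, by rw [mul_comm]; exact h.2.2⟩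
  · intros; rfl
  · intros; rfl
  · intros; rfl

lemma PP_card_le (n s : ℕ) (hs : n < (s+1)^2) (hsn : s ≤ n) : ((PP n).card : ℝ) ≤ 2 * ∑ p ∈ (Finset.Icc 1 s).filter Nat.Prime, PIr (n/p) := by
  have h1 : ((PP n).card : ℝ) = ∑ pq ∈ PP n, (1:ℝ) := by simp
  have h2 : ∑ pq ∈ PP n, (1:ℝ) ≤ ∑ pq ∈ PP n, ((if pq.1 ≤ s then (1:ℝ) else 0) + (if pq.2 ≤ s then 1 else 0)) := by
    apply Finset.sum_le_sum
    intro pq h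
    have h := (mem_PP.mp h).2.2
    by_cases ha : pq.1 ≤ s
    · simp only [ha, if_true]
      have : (0:ℝ) ≤ if pq.2 ≤ s then 1 else 0 := by split_ifs <;> norm_num
      linarith
    · by_cases hb : pq.2 ≤ s
      · simp [ha, hb]
      · exfalso
        push Not at ha hb
        have : (s+1) * (s+1) ≤ pq.1 * pq.2 := Nat.mul_le_mul ha hb
        nlinarith
  rw [Finset.sum_add_distrib, ← PP_sum_swap n (fun p _ => if p ≤ s then (1:ℝ) else 0), PP_sum_fst n (fun p => if p ≤ s then (1:ℝ) else 0)] at h2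
  have h3 : ∑ p ∈ (Finset.Icc 1 n).filter Nat.Prime, (if p ≤ s then (1:ℝ) else 0) * PIr (n/p) = ∑ p ∈ (Finset.Icc 1 s).filter Nat.Prime, PIr (n/p) := by
    simp only [ite_mul, one_mul, zero_mul]
    rw [← Finset.sum_filter]
    apply Finset.sum_congr _ (fun _ _ => rfl)
    ext p
    simp only [Finset.mem_filter, Finset.mem_Icc]
    constructor
    · rintro ⟨⟨⟨a, b⟩, c⟩, d⟩; exact ⟨⟨a, d⟩, c⟩
    · rintro ⟨⟨a, b⟩, c⟩; exact ⟨⟨⟨a, by omega⟩, c⟩, b⟩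
  rw [h3] at h2
  linarith

lemma N_upper : ∃ A > (0:ℝ), ∀ᶠ x : ℝ in atTop, ((PP ⌊x⌋₊).card : ℝ) ≤ 2 * (x / Real.log x) * (Real.log (Real.log x) + A) := by
  obtain ⟨K, hK, h⟩ := pi_bounds
  obtain ⟨A, hA, hRec⟩ := Rec_upper
  obtain ⟨A', hA', hRecL⟩ := RecL_upper
  refine ⟨(A + 2 * A') * (1 + K) + K, by positivity, ?_⟩
  filter_upwards [h, eventually_ge_atTop 16, Real.tendsto_log_atTop.eventually_ge_atTop 4, tendsto_ll.eventually_ge_atTop 4] with x h h2 h3 h4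
  set l := Real.log x with hl
  set ll := Real.log l with hll
  have hx0 : 0 < x := by linarith
  set s := ⌊√x⌋₊ with hs
  have hsx : √x * √x = x := Real.mul_self_sqrt hx0.le
  have hsx4 : 4 ≤ √x := Real.le_sqrt_of_sq_le (by linarith)
  have hs_le : (s:ℝ) ≤ √x := Nat.floor_le (by positivity)
  have hs_lt : √x < s + 1 := Nat.lt_floor_add_one _
  have hs3 : 3 ≤ s := Nat.le_floor (by push_cast; linarith)
  have hs3' : (3:ℝ) ≤ s := by exact_mod_cast hs3
  have c1 : ⌊x⌋₊ < (s+1)^2 := by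
    rw [Nat.floor_lt hx0.le]
    push_cast
    nlinarith
  have c2 : s ≤ ⌊x⌋₊ := Nat.floor_mono (by nlinarith)
  refine (PP_card_le _ s c1 c2).trans ?_
  rw [mul_assoc]
  gcongr
  have hl0 : 0 < l := by linarith
  have hll0 : 0 < ll := by linarith
  have hls : Real.log s ≤ l := Real.log_le_log (by linarith) (by nlinarith)
  have hls0 : 1 < Real.log s := by
    rw [Real.lt_log_iff_exp_lt (by linarith)]
    exact (Real.exp_one_lt_d9.trans (by norm_num)).trans_le hs3'
  calc ∑ p ∈ (Finset.Icc 1 s).filter Nat.Prime, PIr (⌊x⌋₊/p)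
      ≤ ∑ p ∈ (Finset.Icc 1 s).filter Nat.Prime, (1 + K / ll) * (x / l) * (1 / p * (1 + 2 * Real.log p / l)) := by
        apply Finset.sum_le_sum
        intro p hp
        rw [Finset.mem_filter, Finset.mem_Icc] at hp
        have : (p:ℝ) ≤ s := by exact_mod_cast hp.1.2
        exact (h p hp.1.1 (by linarith)).1
    _ = (1 + K / ll) * (x / l) * (Rec s + 2 / l * RecL s) := by
        rw [← Finset.mul_sum]
        congr 1
        unfold Rec RecL
        rw [Finset.mul_sum, ← Finset.sum_add_distrib]
        apply Finset.sum_congr rfl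
        intro p _
        ring
    _ ≤ (1 + K / ll) * (x / l) * ((ll + A) + 2 / l * (A' * l)) := by
        gcongr
        · exact (hRec s hs3).trans (by have := Real.log_le_log (by linarith) hls; linarith)
        · exact (hRecL s hs3).trans (by gcongr)
    _ = (x / l) * ((1 + K / ll) * (ll + (A + 2 * A'))) := by
        have : 2 / l * (A' * l) = 2 * A' := by field_simp
        rw [this]; ring
    _ ≤ _ := by
        gcongr
        have : (1 + K / ll) * (ll + (A + 2 * A')) = ll + (A + 2 * A') + K + (K/ll) * (A + 2 * A') := by
          field_simp; ring
        rw [this]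
        have : (K/ll) * (A + 2 * A') ≤ K * (A + 2 * A') := by
          gcongr; exact div_le_self hK.le (by linarith)
        linarith

lemma T_lower : ∃ A > (0:ℝ), ∀ᶠ x : ℝ in atTop, ∀ y : ℕ, 3 ≤ y → (y:ℝ) ≤ √x →
    (x / Real.log x) * (Real.log (Real.log y) - A) ≤ ∑ p ∈ (Finset.Icc 1 y).filter Nat.Prime, PIr (⌊x⌋₊/p) := by
  obtain ⟨K, hK, h⟩ := pi_bounds
  obtain ⟨A, hA, hRec⟩ := Rec_upper
  refine ⟨1 + K * (1 + A), by positivity, ?_⟩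
  filter_upwards [h, eventually_ge_atTop 16, Real.tendsto_log_atTop.eventually_ge_atTop 4, tendsto_ll.eventually_ge_atTop 4] with x h h2 h3 h4
  intro y hy hyx
  set l := Real.log x with hl
  set ll := Real.log l with hll
  have hx0 : 0 < x := by linarith
  have hl0 : 0 < l := by linarith
  have hll0 : 0 < ll := by linarith
  have hsx : √x * √x = x := Real.mul_self_sqrt hx0.le
  have hsx4 : 4 ≤ √x := Real.le_sqrt_of_sq_le (by linarith)
  have hy3' : (3:ℝ) ≤ y := by exact_mod_cast hy
  have hly0 : 1 < Real.log y := by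
    rw [Real.lt_log_iff_exp_lt (by linarith)]
    exact (Real.exp_one_lt_d9.trans (by norm_num)).trans_le hy3'
  have hly : Real.log y ≤ l := Real.log_le_log (by linarith) (by nlinarith)
  have hlly : Real.log (Real.log y) ≤ ll := Real.log_le_log (by linarith) hly
  have r1 := Rec_lower y (by omega)
  have r2 := hRec y hy
  calc _ ≤ (x / l) * (Rec y - (K / ll) * (ll + A)) := by
        apply mul_le_mul_of_nonneg_left _ (by positivity)
        have : (K / ll) * (ll + A) = K + K / ll * A := by field_simp
        rw [this]
        have : K / ll * A ≤ K * A := by gcongr; exact div_le_self hK.le (by linarith)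
        linarith
    _ ≤ (x / l) * (Rec y - (K / ll) * Rec y) := by
        apply mul_le_mul_of_nonneg_left _ (by positivity)
        have : (K / ll) * Rec y ≤ (K / ll) * (ll + A) := mul_le_mul_of_nonneg_left (by linarith) (by positivity)
        linarith
    _ = ∑ p ∈ (Finset.Icc 1 y).filter Nat.Prime, (1 - K / ll) * (x / l) * (1 / p) := by
        rw [← Finset.mul_sum]; unfold Rec; ring
    _ ≤ _ := by
        apply Finset.sum_le_sum
        intro p hp
        rw [Finset.mem_filter, Finset.mem_Icc] at hp
        have : (p:ℝ) ≤ y := by exact_mod_cast hp.1.2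
        exact (h p hp.1.1 (by linarith)).2

lemma Rec_diff (u v : ℕ) (h : u ≤ v) : ∑ p ∈ (Finset.Ioc u v).filter Nat.Prime, (1/(p:ℝ)) = Rec v - Rec u := by
  unfold Rec
  have : (Finset.Icc 1 v).filter Nat.Prime = (Finset.Icc 1 u).filter Nat.Prime ∪ (Finset.Ioc u v).filter Nat.Prime := by
    ext p; simp only [Finset.mem_union, Finset.mem_filter, Finset.mem_Icc, Finset.mem_Ioc]
    constructor
    · rintro ⟨h1, h2⟩
      rcases le_or_gt p u with h | h
      · left; exact ⟨⟨h1.1, h⟩, h2⟩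
      · right; exact ⟨⟨h, h1.2⟩, h2⟩
    · rintro (⟨h1, h2⟩ | ⟨h1, h2⟩)
      · exact ⟨by omega, h2⟩
      · exact ⟨by omega, h2⟩
  rw [this, Finset.sum_union]
  · ring
  · rw [Finset.disjoint_left]; intro p; simp only [Finset.mem_filter, Finset.mem_Icc, Finset.mem_Ioc]; omega

end

section

/-- real valued Jacobi symbol with natural number arguments -/
noncomputable def JR (a b : ℕ) : ℝ := ((jacobiSym (a:ℤ) b : ℤ) : ℝ)

lemma JR_abs (a b : ℕ) : |JR a b| ≤ 1 := by
  unfold JR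
  rcases jacobiSym.trichotomy (a:ℤ) b with h | h | h <;> simp [h]

lemma JR_mul_left (a a' b : ℕ) : JR (a * a') b = JR a b * JR a' b := by
  unfold JR
  push_cast
  rw [jacobiSym.mul_left]; push_cast; rfl

lemma JR_mul_right (a b b' : ℕ) (hb : b ≠ 0) (hb' : b' ≠ 0) : JR a (b * b') = JR a b * JR a b' := by
  unfold JR
  rw [jacobiSym.mul_right' _ hb hb']; push_cast; rfl

lemma JR_mod {a a' b : ℕ} (h : a ≡ a' [MOD b]) : JR a b = JR a' b := by
  unfold JR
  congr 1
  apply jacobiSym.mod_left'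
  exact_mod_cast h

lemma sum_affine (f : ℕ → ℝ) (b r M : ℕ) (hb : b ≠ 0) (hM : M.Coprime b)
    (hf : ∀ k k', k ≡ k' [MOD b] → f k = f k') :
    ∑ k ∈ Finset.range b, f (r + M * k) = ∑ k ∈ Finset.range b, f k := by
  apply Finset.sum_bij (fun k _ => (r + M * k) % b)
  · intro k _
    exact Finset.mem_range.mpr (Nat.mod_lt _ (Nat.pos_of_ne_zero hb))
  · intro k hk k' hk' h
    have h1 : r + M * k ≡ r + M * k' [MOD b] := h
    have h2 := Nat.ModEq.add_left_cancel' r h1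
    have h3 := Nat.ModEq.cancel_left_of_coprime (hM.symm) h2
    rw [Finset.mem_range] at hk hk'
    exact Nat.ModEq.eq_of_lt_of_lt h3 hk hk'
  · intro j hj
    rw [Finset.mem_range] at hj
    have hinj : Set.InjOn (fun k => (r + M * k) % b) (Finset.range b : Set ℕ) := by
      intro k hk k' hk' h
      have h1 : r + M * k ≡ r + M * k' [MOD b] := h
      have h2 := Nat.ModEq.add_left_cancel' r h1
      have h3 := Nat.ModEq.cancel_left_of_coprime (hM.symm) h2
      rw [Finset.coe_range, Set.mem_Iio] at hk hk'
      exact Nat.ModEq.eq_of_lt_of_lt h3 hk hk'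
    have := Finset.surj_on_of_inj_on_of_card_le (s := Finset.range b) (t := Finset.range b) (fun k _ => (r + M * k) % b)
      (fun k _ => Finset.mem_range.mpr (Nat.mod_lt _ (Nat.pos_of_ne_zero hb)))
      (fun a a' ha ha' h => hinj (by simpa using ha) (by simpa using ha') h) le_rfl j (Finset.mem_range.mpr hj)
    obtain ⟨a, ha, h⟩ := this
    exact ⟨a, ha, h.symm⟩
  · intro k _
    apply hf
    exact (Nat.mod_modEq _ _).symm

lemma sum_period_zero (f : ℕ → ℝ) (b a : ℕ) (hb : b ≠ 0) (ha : a.Coprime b)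
    (hf : ∀ k k', k ≡ k' [MOD b] → f k = f k') (hneg : ∀ k, f (a * k) = - f k) :
    ∑ k ∈ Finset.range b, f k = 0 := by
  have := sum_affine f b 0 a hb ha hf
  simp only [zero_add, hneg, Finset.sum_neg_distrib] at this
  linarith

lemma sum_incomplete (f : ℕ → ℝ) (b : ℕ) (hb : b ≠ 0) 
    (hf : ∀ k k', k ≡ k' [MOD b] → f k = f k') (h1 : ∀ k, |f k| ≤ 1)
    (h0 : ∑ k ∈ Finset.range b, f k = 0) (N : ℕ) : |∑ k ∈ Finset.range N, f k| ≤ b := by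
  have hq : ∀ q : ℕ, ∑ k ∈ Finset.range (q * b), f k = 0 := by
    intro q
    induction q with
    | zero => simp
    | succ q ih =>
      rw [Nat.succ_mul, Finset.sum_range_add, ih, zero_add, ← h0]
      apply Finset.sum_congr rfl
      intro k _
      apply hf
      have : q * b ≡ 0 [MOD b] := (Nat.modEq_zero_iff_dvd).mpr (dvd_mul_left _ _)
      simpa using this.add_right k
  have : N = (N / b) * b + N % b := (Nat.div_add_mod' N b).symm
  rw [this, Finset.sum_range_add, hq, zero_add]
  refine (Finset.abs_sum_le_sum_abs _ _).trans ?_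
  refine (Finset.sum_le_sum (fun k _ => h1 _)).trans ?_
  simp only [Finset.sum_const, Finset.card_range, nsmul_eq_mul, mul_one]
  exact_mod_cast (Nat.mod_lt N (Nat.pos_of_ne_zero hb)).le

lemma exists_nonres (p : ℕ) (hp : p.Prime) (h2 : p ≠ 2) : ∃ a : ℕ, jacobiSym (a:ℤ) p = -1 := by
  have := Fact.mk hp
  obtain ⟨a, ha⟩ := FiniteField.exists_nonsquare (F := ZMod p) (by rwa [ZMod.ringChar_zmod_n])
  refine ⟨a.val, ?_⟩
  rw [ZMod.nonsquare_iff_jacobiSym_eq_neg_one]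
  simpa using ha

lemma exists_neg (p e : ℕ) (hp : p.Prime) (h2 : p ≠ 2) (he : e ≠ 0) (hpe : ¬ p ∣ e) :
    ∃ a : ℕ, a ≡ 1 [MOD e] ∧ a.Coprime (p * e) ∧ JR a (p * e) = -1 := by
  obtain ⟨b, hb⟩ := exists_nonres p hp h2
  have hc : p.Coprime e := (Nat.Prime.coprime_iff_not_dvd hp).mpr hpe
  obtain ⟨a, ha1, ha2⟩ := Nat.chineseRemainder hc b 1
  have hJ : JR a (p * e) = -1 := by
    rw [JR_mul_right _ _ _ hp.ne_zero he, JR_mod ha1, JR_mod ha2]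
    simp [JR, hb, jacobiSym.one_left]
  refine ⟨a, ha2, ?_, hJ⟩
  have : jacobiSym (a:ℤ) (p*e) ≠ 0 := by
    intro h
    simp [JR, h] at hJ
  by_contra hcon
  exact this (jacobiSym.eq_zero_iff.mpr ⟨mul_ne_zero hp.ne_zero he, by rw [Int.gcd_natCast_natCast]; exact hcon⟩)

/-- complete sums vanish -/
lemma JR_sum_zero (p e : ℕ) (hp : p.Prime) (h2 : p ≠ 2) (he : e ≠ 0) (hpe : ¬ p ∣ e) :
    ∑ k ∈ Finset.range (p * e), JR k (p * e) = 0 := by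
  obtain ⟨a, _, hc, hJ⟩ := exists_neg p e hp h2 he hpe
  apply sum_period_zero _ (p * e) a (mul_ne_zero hp.ne_zero he) hc
  · intro k k' h; exact JR_mod h
  · intro k; rw [JR_mul_left, hJ]; ring

/-- two distinct odd squarefree moduli -/
lemma JR_orth (d d' N : ℕ) (hd : Squarefree d) (hd' : Squarefree d') (ho : Odd d) (ho' : Odd d') (hne : d ≠ d') :
    |∑ k ∈ Finset.range N, JR k d * JR k d'| ≤ d * d' := by
  have hd0 : d ≠ 0 := hd.ne_zero
  have hd0' : d' ≠ 0 := hd'.ne_zero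
  have key : ∀ d d' : ℕ, Squarefree d → Squarefree d' → Odd d → Odd d' → (∃ p, p.Prime ∧ p ∣ d ∧ ¬ p ∣ d') → ∑ k ∈ Finset.range (d * d'), JR k (d * d') = 0 := by
    rintro d d' hd hd' ho ho' ⟨p, hp, ⟨e, rfl⟩, hpd'⟩
    have h2 : p ≠ 2 := by
      rintro rfl
      rw [Nat.odd_iff] at ho
      omega
    have he : ¬ p ∣ e := by
      rintro ⟨f, rfl⟩
      have := hd p ⟨f, by ring⟩
      exact hp.one_lt.ne' (Nat.isUnit_iff.mp this)
    rw [mul_assoc]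
    apply JR_sum_zero p (e * d') hp h2
    · exact mul_ne_zero (fun h => hd.ne_zero (by simp [h])) hd'.ne_zero
    · intro h
      rcases hp.dvd_mul.mp h with h | h
      exacts [he h, hpd' h]
  have h0 : ∑ k ∈ Finset.range (d * d'), JR k (d * d') = 0 := by
    by_cases h : ∃ p, p.Prime ∧ p ∣ d ∧ ¬ p ∣ d'
    · exact key d d' hd hd' ho ho' h
    by_cases h' : ∃ p, p.Prime ∧ p ∣ d' ∧ ¬ p ∣ d
    · rw [mul_comm]; exact key d' d hd' hd ho' ho h'
    exfalso
    push Not at h h'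
    apply hne
    rw [← Nat.prod_primeFactors_of_squarefree hd, ← Nat.prod_primeFactors_of_squarefree hd']
    congr 1
    ext p
    simp only [Nat.mem_primeFactors]
    constructor
    · rintro ⟨h1, h2, _⟩; exact ⟨h1, h p h1 h2, hd0'⟩
    · rintro ⟨h1, h2, _⟩; exact ⟨h1, h' p h1 h2, hd0⟩
  have := sum_incomplete (fun k => JR k (d * d')) (d * d') (mul_ne_zero hd0 hd0') (fun k k' h => JR_mod h) (fun k => JR_abs _ _) h0 N
  simp only [JR_mul_right _ _ _ hd0 hd0'] at this
  exact_mod_cast this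

/-- affine version for distinct primes -/
lemma JR_affine (p q r M N : ℕ) (hp : p.Prime) (hq : q.Prime) (h2 : p ≠ 2) (hne : p ≠ q) (hMp : M.Coprime p) (hMq : M.Coprime q) :
    |∑ k ∈ Finset.range N, JR (r + M * k) p * JR (r + M * k) q| ≤ p * q := by
  have hpq : ¬ p ∣ q := fun h => hne ((Nat.prime_dvd_prime_iff_eq hp hq).mp h)
  have h0 := JR_sum_zero p q hp h2 hq.ne_zero hpq
  rw [← sum_affine (fun k => JR k (p * q)) (p * q) r M (mul_ne_zero hp.ne_zero hq.ne_zero) (Nat.Coprime.mul_right hMp hMq) (fun k k' h => JR_mod h)] at h0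
  have := sum_incomplete (fun k => JR (r + M * k) (p * q)) (p * q) (mul_ne_zero hp.ne_zero hq.ne_zero) (fun k k' h => JR_mod ((h.mul_left M).add_left r)) (fun k => JR_abs _ _) h0 N
  simp only [JR_mul_right _ _ _ hp.ne_zero hq.ne_zero] at this
  exact_mod_cast this

/-- The real character attached to the Jacobi symbol. -/
noncomputable def jchar (d : ℕ) [NeZero d] : DirichletCharacter ℂ d where
  toFun u := ((jacobiSym (u.val : ℤ) d : ℤ) : ℂ)
  map_one' := by
    have : jacobiSym (((1 : ZMod d).val : ℕ) : ℤ) d = jacobiSym (1:ℤ) d := by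
      apply jacobiSym.mod_left'
      rw [ZMod.val_one_eq_one_mod]
      push_cast
      simp
    rw [this, jacobiSym.one_left]; simp
  map_mul' u v := by
    have : jacobiSym (((u * v : ZMod d).val : ℕ) : ℤ) d = jacobiSym ((u.val : ℤ) * (v.val : ℤ)) d := by
      apply jacobiSym.mod_left'
      rw [ZMod.val_mul]
      push_cast
      simp
    rw [this, jacobiSym.mul_left]; push_cast; rfl
  map_nonunit' u hu := by
    have : jacobiSym (u.val : ℤ) d = 0 := by
      rw [jacobiSym.eq_zero_iff]
      refine ⟨NeZero.ne d, fun h => hu ?_⟩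
      rw [← ZMod.natCast_zmod_val u, ZMod.isUnit_iff_coprime]
      rw [Int.gcd_natCast_natCast] at h
      exact h
    change ((jacobiSym (u.val : ℤ) d : ℤ) : ℂ) = 0
    rw [this]; simp

lemma jchar_apply (d : ℕ) [NeZero d] (k : ℕ) : jchar d (k : ZMod d) = ((jacobiSym (k:ℤ) d : ℤ) : ℂ) := by
  change ((jacobiSym (((k : ZMod d)).val : ℤ) d : ℤ) : ℂ) = _
  congr 1
  apply jacobiSym.mod_left'
  rw [ZMod.val_natCast]
  push_cast
  simp

lemma jchar_quad (d : ℕ) [NeZero d] : MulChar.IsQuadratic (jchar d) := by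
  intro u
  rw [← ZMod.natCast_zmod_val u, jchar_apply]
  rcases jacobiSym.trichotomy (u.val:ℤ) d with h | h | h <;> rw [h] <;> simp

lemma jchar_prim (d : ℕ) [NeZero d] (hd : Squarefree d) (ho : Odd d) : (jchar d).IsPrimitive := by
  have hf := DirichletCharacter.factorsThrough_conductor (jchar d)
  set c := (jchar d).conductor with hc
  rw [DirichletCharacter.isPrimitive_def, ← hc]
  by_contra hcd
  obtain ⟨g, hg⟩ := hf.dvd
  have hg1 : g ≠ 1 := by rintro rfl; exact hcd (by omega)
  obtain ⟨p, hp, f, rfl⟩ := Nat.exists_prime_and_dvd hg1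
  have hd0 := hd.ne_zero
  have hde : d = p * (c * f) := by rw [hg]; ring
  have h2 : p ≠ 2 := by
    rintro rfl
    rw [Nat.odd_iff] at ho; omega
  have he : ¬ p ∣ c * f := by
    rintro ⟨f', hf'⟩
    have := hd p ⟨f', by rw [hde, hf']; ring⟩
    exact hp.one_lt.ne' (Nat.isUnit_iff.mp this)
  have he0 : c * f ≠ 0 := fun h => hd0 (by rw [hde, h]; simp)
  obtain ⟨a, ha1, hac, haJ⟩ := exists_neg p (c * f) hp h2 he0 he
  rw [← hde] at hac haJ
  have hm : a ≡ 1 [MOD c] := ha1.of_mul_right f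
  obtain ⟨hdvd, χ₀, hχ⟩ := hf
  have e1 : jchar d (a : ZMod d) = 1 := by
    rw [hχ]
    have hu : IsUnit (a : ZMod d) := (ZMod.isUnit_iff_coprime _ _).mpr hac
    obtain ⟨u, hu⟩ := hu
    rw [← hu, DirichletCharacter.changeLevel_eq_cast_of_dvd, hu]
    rw [ZMod.cast_natCast hdvd]
    have : ((a:ℕ) : ZMod c) = ((1:ℕ) : ZMod c) := (ZMod.natCast_eq_natCast_iff _ _ _).mpr hm
    rw [this]; simp
  rw [jchar_apply] at e1
  have : jacobiSym (a:ℤ) d = 1 := by exact_mod_cast e1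
  unfold JR at haJ
  rw [this] at haJ
  norm_num at haJ

end

section

/-- odd primes up to y -/
def oddPrimes (y : ℕ) : Finset ℕ := (Finset.Icc 3 y).filter Nat.Prime

def Mmod (y : ℕ) : ℕ := 8 * ∏ p ∈ oddPrimes y, p

lemma oddPrimes_prime {y p : ℕ} (h : p ∈ oddPrimes y) : p.Prime ∧ p ≠ 2 := by
  simp only [oddPrimes, Finset.mem_filter, Finset.mem_Icc] at h
  exact ⟨h.2, by omega⟩

lemma exists_r (s : Finset ℕ) (hs : ∀ p ∈ s, p.Prime ∧ p ≠ 2) :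
    ∃ r : ℕ, r ≡ 5 [MOD 8] ∧ ∀ p ∈ s, jacobiSym (r:ℤ) p = -1 := by
  induction s using Finset.induction_on with
  | empty => exact ⟨5, rfl, by simp⟩
  | insert q s hq ih =>
    obtain ⟨r, hr, hrs⟩ := ih (fun p hp => hs p (Finset.mem_insert_of_mem hp))
    obtain ⟨hqp, hq2⟩ := hs q (Finset.mem_insert_self _ _)
    obtain ⟨a, ha⟩ := exists_nonres q hqp hq2
    have hc : Nat.Coprime (8 * ∏ p ∈ s, p) q := by
      apply Nat.Coprime.mul_left
      · rw [Nat.coprime_comm]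
        refine (Nat.Prime.coprime_iff_not_dvd hqp).mpr fun h => ?_
        have : q ∣ 2 ^ 3 := h
        have := hqp.dvd_of_dvd_pow this
        exact hq2 ((Nat.prime_dvd_prime_iff_eq hqp Nat.prime_two).mp this)
      · apply Nat.Coprime.prod_left
        intro p hp
        rw [Nat.coprime_primes (hs p (Finset.mem_insert_of_mem hp)).1 hqp]
        rintro rfl; exact hq hp
    obtain ⟨t, ht1, ht2⟩ := Nat.chineseRemainder hc r a
    refine ⟨t, (ht1.of_mul_right _).trans hr, ?_⟩
    intro p hp
    rcases Finset.mem_insert.mp hp with rfl | hp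
    · rw [← ha]; apply jacobiSym.mod_left'; exact_mod_cast ht2
    · rw [← hrs p hp]; apply jacobiSym.mod_left'
      have : t ≡ r [MOD p] := ht1.of_dvd ((Finset.dvd_prod_of_mem _ hp).mul_left 8)
      exact_mod_cast this

lemma Mmod_pos (y : ℕ) : 0 < Mmod y := by
  unfold Mmod
  have : 0 < ∏ p ∈ oddPrimes y, p := Finset.prod_pos fun p hp => (oddPrimes_prime hp).1.pos
  omega

lemma Mmod_le (y : ℕ) (hy : 2 ≤ y) : Mmod y ≤ 4 * 4 ^ y := by
  have h : Mmod y = 4 * primorial y := by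
    unfold Mmod primorial
    have : Finset.filter Nat.Prime (Finset.range (y+1)) = insert 2 (oddPrimes y) := by
      ext p
      simp only [oddPrimes, Finset.mem_filter, Finset.mem_range, Finset.mem_insert, Finset.mem_Icc]
      constructor
      · rintro ⟨h1, h2⟩
        have := h2.two_le
        rcases eq_or_ne p 2 with h | h
        · left; exact h
        · right; exact ⟨by omega, h2⟩
      · rintro (rfl | ⟨h1, h2⟩)
        · exact ⟨by omega, Nat.prime_two⟩
        · exact ⟨by omega, h2⟩
    rw [this, Finset.prod_insert]
    · ring
    · intro h; exact (oddPrimes_prime h).2 rfl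
  rw [h]
  have := primorial_le_four_pow y
  omega

lemma Mmod_coprime {y p : ℕ} (hp : p.Prime) (hy : 2 ≤ y) (h : y < p) : (Mmod y).Coprime p := by
  unfold Mmod
  apply Nat.Coprime.mul_left
  · rw [Nat.coprime_comm]
    refine (Nat.Prime.coprime_iff_not_dvd hp).mpr fun h => ?_
    have : p ∣ 2 ^ 3 := h
    have := Nat.le_of_dvd (by norm_num) (hp.dvd_of_dvd_pow this)
    omega
  · apply Nat.Coprime.prod_left
    intro q hq
    rw [Nat.coprime_primes (oddPrimes_prime hq).1 hp]
    simp only [oddPrimes, Finset.mem_filter, Finset.mem_Icc] at hq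
    omega

/-- properties of the residue class -/
structure GoodR (y r : ℕ) : Prop where
  lt : r < Mmod y
  five : r ≡ 5 [MOD 8]
  neg : ∀ p ∈ oddPrimes y, jacobiSym (r:ℤ) p = -1

lemma exists_goodR (y : ℕ) : ∃ r, GoodR y r := by
  obtain ⟨r, h1, h2⟩ := exists_r (oddPrimes y) (fun p hp => oddPrimes_prime hp)
  refine ⟨r % Mmod y, Nat.mod_lt _ (Mmod_pos y), ?_, ?_⟩
  · exact ((Nat.mod_modEq r (Mmod y)).of_dvd (Dvd.intro _ rfl)).trans h1
  · intro p hp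
    rw [← h2 p hp]
    apply jacobiSym.mod_left'
    have : r % Mmod y ≡ r [MOD p] := (Nat.mod_modEq r (Mmod y)).of_dvd ((Finset.dvd_prod_of_mem _ hp).mul_left 8)
    exact_mod_cast this

lemma GoodR.mod8 {y r : ℕ} (h : GoodR y r) (m : ℕ) : (r + Mmod y * m) % 8 = 5 := by
  have h5 := h.five
  unfold Nat.ModEq at h5
  unfold Mmod
  rw [mul_assoc]; omega

lemma GoodR.odd {y r : ℕ} (h : GoodR y r) (m : ℕ) : Odd (r + Mmod y * m) := by
  have := h.mod8 m
  rw [Nat.odd_iff]; omega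

lemma GoodR.recip {y r : ℕ} (h : GoodR y r) (m p : ℕ) (hp : p.Prime) (h2 : p ≠ 2) :
    JR p (r + Mmod y * m) = JR (r + Mmod y * m) p := by
  unfold JR
  rw [jacobiSym.quadratic_reciprocity_one_mod_four (a := r + Mmod y * m) (b := p) (by have := h.mod8 m; omega) (hp.odd_of_ne_two h2)]

lemma GoodR.small {y r : ℕ} (h : GoodR y r) (m p : ℕ) (hp : p.Prime) (hy : p ≤ y) :
    JR p (r + Mmod y * m) = -1 := by
  by_cases h2 : p = 2
  · subst h2
    unfold JR
    have e := jacobiSym.at_two (h.odd m)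
    push_cast at e ⊢
    rw [e]
    have : ((r:ZMod 8) + (Mmod y : ZMod 8) * (m : ZMod 8)) = 5 := by
      have h1 : ((r + Mmod y * m : ℕ) : ZMod 8) = ((5:ℕ) : ZMod 8) := by
        rw [ZMod.natCast_eq_natCast_iff]; exact h.mod8 m
      push_cast at h1; exact h1
    rw [this]
    have : ZMod.χ₈ 5 = -1 := by decide
    rw [this]; norm_num
  · rw [h.recip m p hp h2]
    have hpm : p ∈ oddPrimes y := by
      simp only [oddPrimes, Finset.mem_filter, Finset.mem_Icc]
      have := hp.two_le
      exact ⟨by omega, hp⟩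
    have : r + Mmod y * m ≡ r [MOD p] := by
      have h1 : Mmod y * m ≡ 0 [MOD p] := (Nat.modEq_zero_iff_dvd).mpr (((Finset.dvd_prod_of_mem _ hpm).mul_left 8).mul_right m)
      simpa using h1.add_left r
    rw [JR_mod this]
    unfold JR
    rw [h.neg p hpm]; norm_num

lemma GoodR.factor_gt {y r : ℕ} (h : GoodR y r) (m p : ℕ) (hp : p.Prime) (hd : p ∣ r + Mmod y * m) : y < p := by
  by_contra hcon
  push Not at hcon
  have h1 := h.small m p hp hcon
  have : jacobiSym (p:ℤ) (r + Mmod y * m) = 0 := by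
    rw [jacobiSym.eq_zero_iff]
    refine ⟨(h.odd m).pos.ne', ?_⟩
    rw [Int.gcd_natCast_natCast, Nat.gcd_eq_left hd]
    exact hp.one_lt.ne'
  unfold JR at h1
  rw [this] at h1
  norm_num at h1

/-- counting in a residue class -/
lemma count_class (R k r M : ℕ) (hk : 0 < k) (hM : M.Coprime k) :
    (((Finset.range R).filter (fun m => k ∣ r + M * m)).card : ℝ) ≤ R / k + 1 := by
  classical
  by_cases hne : ∃ m₀, k ∣ r + M * m₀
  · obtain ⟨m₀, hm₀⟩ := hne
    have hsub : (Finset.range R).filter (fun m => k ∣ r + M * m) ⊆ (Finset.range R).filter (fun m => m ≡ m₀ [MOD k]) := by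
      intro m hm
      rw [Finset.mem_filter] at hm ⊢
      refine ⟨hm.1, ?_⟩
      have h1 : r + M * m ≡ r + M * m₀ [MOD k] := ((Nat.modEq_zero_iff_dvd).mpr hm.2).trans ((Nat.modEq_zero_iff_dvd).mpr hm₀).symm
      exact Nat.ModEq.cancel_left_of_coprime hM.symm (Nat.ModEq.add_left_cancel' r h1)
    have h1 := Finset.card_le_card hsub
    rw [← Nat.count_eq_card_filter_range (fun m => m ≡ m₀ [MOD k]), Nat.count_modEq_card _ hk] at h1
    have h2 : ((Finset.range R).filter (fun m => k ∣ r + M * m)).card ≤ R / k + 1 := by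
      split_ifs at h1 <;> omega
    calc _ ≤ ((R / k + 1 : ℕ) : ℝ) := by exact_mod_cast h2
      _ ≤ _ := by push_cast; gcongr; exact Nat.cast_div_le
  · push Not at hne
    rw [Finset.filter_false_of_mem (fun m _ => hne m)]
    simp; positivity

lemma sum_inv_sq (y Z : ℕ) (hy : 1 ≤ y) : ∑ k ∈ Finset.Ioc y Z, (1 / (k:ℝ)^2 : ℝ) ≤ 1 / (y:ℝ) := by
  have := sum_Ioc_inv_sq_le_sub (α := ℝ) (k := y) (n := max y Z) (by omega) (le_max_left _ _)
  have h2 : Finset.Ioc y Z ⊆ Finset.Ioc y (max y Z) := Finset.Ioc_subset_Ioc le_rfl (le_max_right _ _)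
  calc _ ≤ ∑ k ∈ Finset.Ioc y (max y Z), 1 / (k:ℝ)^2 := Finset.sum_le_sum_of_subset_of_nonneg h2 (fun _ _ _ => by positivity)
    _ ≤ (y:ℝ)⁻¹ - ((max y Z : ℕ):ℝ)⁻¹ := by simpa [one_div] using this
    _ ≤ _ := by
      have : (0:ℝ) ≤ ((max y Z : ℕ):ℝ)⁻¹ := by positivity
      rw [one_div]; linarith

lemma sqf_count {y r : ℕ} (h : GoodR y r) (hy : 2 ≤ y) (R Z : ℕ) (hZ : ∀ m < R, r + Mmod y * m ≤ Z ^ 2) :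
    (((Finset.range R).filter (fun m => ¬ Squarefree (r + Mmod y * m))).card : ℝ) ≤ R / y + Z := by
  classical
  have hsub : (Finset.range R).filter (fun m => ¬ Squarefree (r + Mmod y * m)) ⊆
      ((Finset.Ioc y Z).filter Nat.Prime).biUnion (fun k => (Finset.range R).filter (fun m => k^2 ∣ r + Mmod y * m)) := by
    intro m hm
    rw [Finset.mem_filter] at hm
    rw [Nat.squarefree_iff_prime_squarefree] at hm
    obtain ⟨hm1, hm2⟩ := hm
    push Not at hm2
    obtain ⟨p, hp, hpd⟩ := hm2
    rw [Finset.mem_biUnion]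
    refine ⟨p, ?_, ?_⟩
    · rw [Finset.mem_filter, Finset.mem_Ioc]
      refine ⟨⟨h.factor_gt m p hp ((dvd_mul_right p p).trans hpd), ?_⟩, hp⟩
      have h1 := Nat.le_of_dvd (h.odd m).pos hpd
      have h2 := hZ m (Finset.mem_range.mp hm1)
      by_contra hcon
      push Not at hcon
      nlinarith
    · rw [Finset.mem_filter]
      exact ⟨hm1, by rw [sq]; exact hpd⟩
  have h1 := (Finset.card_le_card hsub).trans Finset.card_biUnion_le
  calc _ ≤ ((∑ k ∈ (Finset.Ioc y Z).filter Nat.Prime, ((Finset.range R).filter (fun m => k^2 ∣ r + Mmod y * m)).card : ℕ) : ℝ) := by exact_mod_cast h1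
    _ ≤ ∑ k ∈ (Finset.Ioc y Z).filter Nat.Prime, ((R:ℝ) * (1 / (k:ℝ)^2) + 1) := by
      push_cast
      apply Finset.sum_le_sum
      intro k hk
      rw [Finset.mem_filter, Finset.mem_Ioc] at hk
      have := count_class R (k^2) r (Mmod y) (by have := hk.2.pos; positivity) ((Mmod_coprime hk.2 hy hk.1.1).pow_right 2)
      push_cast at this
      rw [mul_one_div]; exact this
    _ ≤ ∑ k ∈ Finset.Ioc y Z, ((R:ℝ) * (1 / (k:ℝ)^2) + 1) := Finset.sum_le_sum_of_subset_of_nonneg (Finset.filter_subset _ _) (fun _ _ _ => by positivity)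
    _ = R * ∑ k ∈ Finset.Ioc y Z, (1 / (k:ℝ)^2) + ((Z - y : ℕ) : ℝ) := by
      rw [Finset.sum_add_distrib, ← Finset.mul_sum]; simp
    _ ≤ R * (1 / y) + Z := by
      gcongr
      · exact sum_inv_sq y Z (by omega)
      · omega
    _ = _ := by ring

end

section

lemma sq_expand (I : Finset ℕ) (c : ℕ → ℝ) (φ : ℕ → ℕ → ℝ) (N : ℕ) :
    ∑ k ∈ Finset.range N, (∑ i ∈ I, c i * φ i k)^2 = ∑ i ∈ I, ∑ j ∈ I, c i * c j * ∑ k ∈ Finset.range N, φ i k * φ j k := by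
  simp_rw [sq, Finset.sum_mul_sum, Finset.mul_sum]
  rw [Finset.sum_comm]
  apply Finset.sum_congr rfl
  intro i _
  rw [Finset.sum_comm]
  apply Finset.sum_congr rfl
  intro j _
  apply Finset.sum_congr rfl
  intro k _
  ring

lemma diag_sum (I : Finset ℕ) (t : ℕ → ℝ) (B : ℝ) :
    ∑ i ∈ I, ∑ j ∈ I, (B + if i = j then t i else 0) = B * (I.card:ℝ)^2 + ∑ i ∈ I, t i := by
  simp_rw [Finset.sum_add_distrib]
  simp only [Finset.sum_const, nsmul_eq_mul, Finset.sum_ite_eq]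
  congr 1
  · ring
  · apply Finset.sum_congr rfl
    intro i hi
    rw [if_pos hi]

lemma X_moment {y r : ℕ} (h : GoodR y r) (hy : 2 ≤ y) (R z : ℕ) (b : ℕ → ℝ) (B : ℝ)
    (hb : ∀ p ∈ (Finset.Ioc y z).filter Nat.Prime, 0 ≤ b p ∧ b p ≤ B / p) :
    ∑ m ∈ Finset.range R, (∑ p ∈ (Finset.Ioc y z).filter Nat.Prime, b p * JR p (r + Mmod y * m))^2 ≤ B^2 * (R / y + z^2) := by
  rw [sq_expand ((Finset.Ioc y z).filter Nat.Prime) b (fun p m => JR p (r + Mmod y * m)) R]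
  have key : ∀ p ∈ (Finset.Ioc y z).filter Nat.Prime, ∀ q ∈ (Finset.Ioc y z).filter Nat.Prime,
      b p * b q * ∑ k ∈ Finset.range R, JR p (r + Mmod y * k) * JR q (r + Mmod y * k) ≤ B^2 + if p = q then B^2 * R * (1 / (p:ℝ)^2) else 0 := by
    intro p hp q hq
    obtain ⟨hp1, hp2⟩ := hb p hp
    obtain ⟨hq1, hq2⟩ := hb q hq
    simp only [Finset.mem_filter, Finset.mem_Ioc] at hp hq
    have hpp : (0:ℝ) < p := by exact_mod_cast hp.2.pos
    have hqp : (0:ℝ) < q := by exact_mod_cast hq.2.pos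
    have hbb : b p * b q ≤ (B/p) * (B/q) := by
      apply mul_le_mul hp2 hq2 hq1 (hp1.trans hp2)
    have hbb0 : 0 ≤ b p * b q := mul_nonneg hp1 hq1
    split_ifs with hpq
    · subst hpq
      have h1 : ∑ k ∈ Finset.range R, JR p (r + Mmod y * k) * JR p (r + Mmod y * k) ≤ R := by
        calc _ ≤ ∑ k ∈ Finset.range R, (1:ℝ) := by
              apply Finset.sum_le_sum
              intro k _
              have := abs_le.mp (JR_abs p (r + Mmod y * k))
              nlinarith
          _ = R := by simp
      calc _ ≤ b p * b p * R := by gcongr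
        _ ≤ (B/p) * (B/p) * R := by gcongr
        _ = B^2 * R * (1 / (p:ℝ)^2) := by field_simp
        _ ≤ _ := by nlinarith [sq_nonneg B]
    · have h1 := JR_affine p q r (Mmod y) R hp.2 hq.2 (by omega) hpq (Mmod_coprime hp.2 hy hp.1.1) (Mmod_coprime hq.2 hy hq.1.1)
      have h2 : ∑ k ∈ Finset.range R, JR p (r + Mmod y * k) * JR q (r + Mmod y * k) ≤ p * q := by
        refine le_trans (le_of_eq ?_) ((le_abs_self _).trans h1)
        apply Finset.sum_congr rfl
        intro k _
        rw [h.recip k p hp.2 (by omega), h.recip k q hq.2 (by omega)]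
      calc _ ≤ b p * b q * (p * q) := by gcongr
        _ ≤ (B/p) * (B/q) * (p * q) := by gcongr
        _ = B^2 := by field_simp
        _ ≤ _ := by simp
  refine (Finset.sum_le_sum fun p hp => Finset.sum_le_sum fun q hq => key p hp q hq).trans ?_
  rw [diag_sum]
  have hcard : (((Finset.Ioc y z).filter Nat.Prime).card : ℝ) ≤ z := by
    have h1 := (Finset.card_filter_le (Finset.Ioc y z) Nat.Prime)
    rw [Nat.card_Ioc] at h1
    exact_mod_cast h1.trans (Nat.sub_le _ _)
  have hs : ∑ i ∈ (Finset.Ioc y z).filter Nat.Prime, B^2 * R * (1 / (i:ℝ)^2) ≤ B^2 * R * (1/y) := by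
    rw [← Finset.mul_sum]
    gcongr
    exact (Finset.sum_le_sum_of_subset_of_nonneg (Finset.filter_subset _ _) (fun _ _ _ => by positivity)).trans (sum_inv_sq y z (by omega))
  have : B^2 * (((Finset.Ioc y z).filter Nat.Prime).card : ℝ)^2 ≤ B^2 * (z:ℝ)^2 := by gcongr
  calc _ ≤ B^2 * (z:ℝ)^2 + B^2 * R * (1/y) := add_le_add this hs
    _ = _ := by ring

lemma large_sieve (I : Finset ℕ) (δ : ℕ → ℕ) (D : ℝ) (N : ℕ) (a : ℕ → ℝ) (α : ℝ) (hα : 0 ≤ α)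
    (hinj : ∀ i ∈ I, ∀ j ∈ I, δ i = δ j → i = j)
    (hδ : ∀ i ∈ I, Squarefree (δ i) ∧ Odd (δ i) ∧ (δ i : ℝ) ≤ D) (hI : (I.card : ℝ) ≤ D) (hN : D^3 ≤ N)
    (ha : ∀ k, |a k| ≤ α) :
    ∑ i ∈ I, |∑ k ∈ Finset.range N, a k * JR k (δ i)| ≤ 2 * α * N * √(I.card) := by
  have hD : 0 ≤ D := le_trans (by positivity) hI
  set c : ℕ → ℝ := fun i => SignType.sign (∑ k ∈ Finset.range N, a k * JR k (δ i)) with hc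
  have hc1 : ∀ i, |c i| ≤ 1 := by
    intro i
    simp only [hc]
    rcases lt_trichotomy (∑ k ∈ Finset.range N, a k * JR k (δ i)) 0 with h | h | h
    · rw [sign_neg h]; simp
    · rw [h]; simp
    · rw [sign_pos h]; simp
  have e1 : ∑ i ∈ I, |∑ k ∈ Finset.range N, a k * JR k (δ i)| = ∑ k ∈ Finset.range N, a k * ∑ i ∈ I, c i * JR k (δ i) := by
    simp_rw [Finset.mul_sum]
    rw [Finset.sum_comm]
    apply Finset.sum_congr rfl
    intro i _
    rw [← sign_mul_self (∑ k ∈ Finset.range N, a k * JR k (δ i)), Finset.mul_sum]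
    apply Finset.sum_congr rfl
    intro k _
    simp only [hc]; ring
  have hQ : ∑ k ∈ Finset.range N, (∑ i ∈ I, c i * JR k (δ i))^2 ≤ 2 * N * I.card := by
    rw [sq_expand I c (fun i k => JR k (δ i)) N]
    have key : ∀ i ∈ I, ∀ j ∈ I, c i * c j * ∑ k ∈ Finset.range N, JR k (δ i) * JR k (δ j) ≤ D^2 + if i = j then (N:ℝ) else 0 := by
      intro i hi j hj
      have hcc : |c i * c j| ≤ 1 := by
        rw [abs_mul]; exact mul_le_one₀ (hc1 i) (abs_nonneg _) (hc1 j)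
      refine (le_abs_self _).trans ?_
      rw [abs_mul]
      refine (mul_le_of_le_one_left (abs_nonneg _) hcc).trans ?_
      split_ifs with hij
      · subst hij
        calc _ ≤ ∑ k ∈ Finset.range N, (1:ℝ) := by
              refine (Finset.abs_sum_le_sum_abs _ _).trans (Finset.sum_le_sum fun k _ => ?_)
              rw [abs_mul]; exact mul_le_one₀ (JR_abs _ _) (abs_nonneg _) (JR_abs _ _)
          _ = N := by simp
          _ ≤ _ := by nlinarith [sq_nonneg D]
      · have := JR_orth (δ i) (δ j) N (hδ i hi).1 (hδ j hj).1 (hδ i hi).2.1 (hδ j hj).2.1 (fun h => hij (hinj i hi j hj h))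
        refine this.trans ?_
        rw [add_zero, sq]
        exact mul_le_mul (hδ i hi).2.2 (hδ j hj).2.2 (by positivity) hD
    refine (Finset.sum_le_sum fun i hi => Finset.sum_le_sum fun j hj => key i hi j hj).trans ?_
    rw [diag_sum]
    simp only [Finset.sum_const, nsmul_eq_mul]
    have : D^2 * (I.card:ℝ)^2 ≤ N * I.card := by
      calc D^2 * (I.card:ℝ)^2 = D^2 * I.card * I.card := by ring
        _ ≤ D^2 * D * I.card := by gcongr
        _ = D^3 * I.card := by ring
        _ ≤ _ := by gcongr
    linarith
  rw [e1]
  have hcs := Finset.sum_mul_sq_le_sq_mul_sq (Finset.range N) a (fun k => ∑ i ∈ I, c i * JR k (δ i))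
  have ha2 : ∑ k ∈ Finset.range N, a k ^ 2 ≤ α^2 * N := by
    calc _ ≤ ∑ k ∈ Finset.range N, α^2 := by
          apply Finset.sum_le_sum
          intro k _
          rw [← sq_abs]; gcongr; exact ha k
      _ = _ := by simp [mul_comm]
  refine (abs_le_of_sq_le_sq' ?_ (by positivity)).2
  refine hcs.trans ?_
  calc _ ≤ α^2 * N * (2 * N * I.card) := by
        apply mul_le_mul ha2 hQ (Finset.sum_nonneg fun _ _ => sq_nonneg _) (by positivity)
    _ ≤ (2 * α * N)^2 * (√(I.card))^2 := by
      rw [Real.sq_sqrt (by positivity)]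
      have : 0 ≤ α^2 * (N:ℝ)^2 * I.card := by positivity
      nlinarith
    _ = _ := by ring

lemma markov (I : Finset ℕ) (f : ℕ → ℝ) (hf : ∀ i ∈ I, 0 ≤ f i) (T : ℝ) (hT : 0 < T) :
    ((I.filter (fun i => T < f i)).card : ℝ) ≤ (∑ i ∈ I, f i) / T := by
  rw [le_div_iff₀ hT]
  calc _ = ∑ i ∈ I.filter (fun i => T < f i), T := by simp
    _ ≤ ∑ i ∈ I.filter (fun i => T < f i), f i := Finset.sum_le_sum fun i hi => (Finset.mem_filter.mp hi).2.le
    _ ≤ _ := Finset.sum_le_sum_of_subset_of_nonneg (Finset.filter_subset _ _) (fun i hi _ => hf i hi)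

end

section
open Filter

/-- the linear character sum -/
noncomputable def S1 (n d : ℕ) : ℝ := ∑ p ∈ (Finset.Icc 1 n).filter Nat.Prime, JR p d * PIr (n/p)
/-- the bilinear character sum -/
noncomputable def S2 (n d : ℕ) : ℝ := ∑ pq ∈ PP n, JR pq.1 d * JR pq.2 d
/-- pairs sharing a factor with the modulus -/
noncomputable def E1 (n d : ℕ) : ℝ := ∑ p ∈ (Finset.Icc 1 n).filter Nat.Prime, (if p ∣ d then (1:ℝ) else 0) * PIr (n/p)

lemma race_upper (n d : ℕ) :
    4 * (((PP n).filter (fun pq => JR pq.1 d = 1 ∧ JR pq.2 d = 1)).card : ℝ) ≤ (PP n).card + 2 * S1 n d + S2 n d := by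
  have h : 4 * (((PP n).filter (fun pq => JR pq.1 d = 1 ∧ JR pq.2 d = 1)).card : ℝ) ≤
      ∑ pq ∈ PP n, (1 + JR pq.1 d + JR pq.2 d + JR pq.1 d * JR pq.2 d) := by
    rw [Finset.card_filter]
    push_cast
    rw [Finset.mul_sum]
    apply Finset.sum_le_sum
    intro pq _
    have h1 := abs_le.mp (JR_abs pq.1 d)
    have h2 := abs_le.mp (JR_abs pq.2 d)
    split_ifs with hh
    · rw [hh.1, hh.2]; norm_num
    · nlinarith [h1.1, h2.1]
  rw [Finset.sum_add_distrib, Finset.sum_add_distrib, Finset.sum_add_distrib,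
    ← PP_sum_swap n (fun p _ => JR p d), PP_sum_fst n (fun p => JR p d)] at h
  simp only [Finset.sum_const, nsmul_eq_mul, mul_one] at h
  unfold S1 S2
  linarith

lemma race_lower (n d : ℕ) :
    ((PP n).card : ℝ) ≤ (((PP n).filter (fun pq => Nat.gcd (pq.1*pq.2) d = 1)).card : ℝ) + 2 * E1 n d := by
  have h : ∑ pq ∈ PP n, (1:ℝ) ≤ ∑ pq ∈ PP n, ((if Nat.gcd (pq.1*pq.2) d = 1 then (1:ℝ) else 0) + (if pq.1 ∣ d then (1:ℝ) else 0) + (if pq.2 ∣ d then (1:ℝ) else 0)) := by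
    apply Finset.sum_le_sum
    intro pq hpq
    have hm := mem_PP.mp hpq
    by_cases h1 : pq.1 ∣ d
    · simp only [h1, if_true]; split_ifs <;> norm_num
    · by_cases h2 : pq.2 ∣ d
      · simp only [h2, if_true]; split_ifs <;> norm_num
      · have : Nat.gcd (pq.1*pq.2) d = 1 := by
          apply Nat.Coprime.mul_left
          · exact (Nat.Prime.coprime_iff_not_dvd hm.1).mpr h1
          · exact (Nat.Prime.coprime_iff_not_dvd hm.2.1).mpr h2
        simp [this, h1, h2]
  rw [Finset.sum_add_distrib, Finset.sum_add_distrib,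
    ← PP_sum_swap n (fun p _ => if p ∣ d then (1:ℝ) else 0), PP_sum_fst n (fun p => if p ∣ d then (1:ℝ) else 0)] at h
  simp only [Finset.sum_const, nsmul_eq_mul, mul_one] at h
  rw [Finset.card_filter]
  push_cast
  unfold E1
  linarith

/-- number of representations as a product of two primes -/
noncomputable def acoef (n k : ℕ) : ℝ := (((PP n).filter (fun pq => pq.1 * pq.2 = k)).card : ℝ)

lemma acoef_le (n k : ℕ) : |acoef n k| ≤ 2 := by
  unfold acoef
  rw [abs_of_nonneg (by positivity)]
  by_cases hne : ((PP n).filter (fun pq => pq.1 * pq.2 = k)).Nonempty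
  · obtain ⟨ab, hab⟩ := hne
    rw [Finset.mem_filter, mem_PP] at hab
    have : (PP n).filter (fun pq => pq.1 * pq.2 = k) ⊆ {(ab.1, ab.2), (ab.2, ab.1)} := by
      rintro ⟨p, q⟩ h
      rw [Finset.mem_filter, mem_PP] at h
      obtain ⟨⟨h1, h2, h3⟩, h4⟩ := h
      obtain ⟨⟨g1, g2, g3⟩, g4⟩ := hab
      simp only at h1 h2 h4
      have hd : p ∣ ab.1 * ab.2 := by rw [g4, ← h4]; exact Dvd.intro _ rfl
      simp only [Finset.mem_insert, Finset.mem_singleton, Prod.mk.injEq]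
      rcases (h1.dvd_mul).mp hd with h | h
      · left
        have e := (Nat.prime_dvd_prime_iff_eq h1 g1).mp h
        refine ⟨e, ?_⟩
        subst e
        exact Nat.eq_of_mul_eq_mul_left h1.pos (h4.trans g4.symm)
      · right
        have e := (Nat.prime_dvd_prime_iff_eq h1 g2).mp h
        refine ⟨e, ?_⟩
        subst e
        exact Nat.eq_of_mul_eq_mul_left h1.pos (by rw [h4, ← g4, mul_comm])
    have := (Finset.card_le_card this).trans Finset.card_le_two
    exact_mod_cast this
  · rw [Finset.not_nonempty_iff_eq_empty] at hne
    rw [hne]; norm_num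

lemma S2_eq (n d : ℕ) : S2 n d = ∑ k ∈ Finset.range (n+1), acoef n k * JR k d := by
  unfold S2
  rw [← Finset.sum_fiberwise_of_maps_to (s := PP n) (t := Finset.range (n+1)) (g := fun pq => pq.1 * pq.2)]
  · apply Finset.sum_congr rfl
    intro k _
    unfold acoef
    rw [← nsmul_eq_mul, ← Finset.sum_const]
    apply Finset.sum_congr rfl
    intro pq hpq
    rw [Finset.mem_filter] at hpq
    rw [← hpq.2, JR_mul_left]
  · intro pq h
    rw [Finset.mem_range]
    have := (mem_PP.mp h).2.2
    omega

lemma prime_split (f : ℕ → ℝ) (u v : ℕ) (h : u ≤ v) :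
    ∑ p ∈ (Finset.Icc 1 v).filter Nat.Prime, f p =
      ∑ p ∈ (Finset.Icc 1 u).filter Nat.Prime, f p + ∑ p ∈ (Finset.Ioc u v).filter Nat.Prime, f p := by
  have : (Finset.Icc 1 v).filter Nat.Prime = (Finset.Icc 1 u).filter Nat.Prime ∪ (Finset.Ioc u v).filter Nat.Prime := by
    ext p; simp only [Finset.mem_union, Finset.mem_filter, Finset.mem_Icc, Finset.mem_Ioc]
    constructor
    · rintro ⟨h1, h2⟩
      rcases le_or_gt p u with h | h
      · left; exact ⟨⟨h1.1, h⟩, h2⟩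
      · right; exact ⟨⟨h, h1.2⟩, h2⟩
    · rintro (⟨h1, h2⟩ | ⟨h1, h2⟩)
      · exact ⟨by omega, h2⟩
      · exact ⟨by omega, h2⟩
  rw [this, Finset.sum_union]
  rw [Finset.disjoint_left]; intro p; simp only [Finset.mem_filter, Finset.mem_Icc, Finset.mem_Ioc]; omega

/-- large prime part -/
noncomputable def Ysum (n w d : ℕ) : ℝ := ∑ p ∈ (Finset.Ioc w n).filter Nat.Prime, JR p d * PIr (n/p)

lemma Ysum_eq (n w d : ℕ) (hw : 0 < w) : Ysum n w d = ∑ q ∈ (Finset.Icc 1 (n/w)).filter Nat.Prime,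
    ∑ k ∈ Finset.range (n/q+1), (if k.Prime ∧ w < k then (1:ℝ) else 0) * JR k d := by
  unfold Ysum
  have e1 : ∀ p ∈ (Finset.Ioc w n).filter Nat.Prime, JR p d * PIr (n/p) = ∑ q ∈ (Finset.Icc 1 (n/p)).filter Nat.Prime, JR p d := by
    intro p _
    rw [PIr_eq]; simp [mul_comm]
  rw [Finset.sum_congr rfl e1]
  have e2 : ∀ q ∈ (Finset.Icc 1 (n/w)).filter Nat.Prime, ∑ k ∈ Finset.range (n/q+1), (if k.Prime ∧ w < k then (1:ℝ) else 0) * JR k d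
      = ∑ p ∈ (Finset.Ioc w (n/q)).filter Nat.Prime, JR p d := by
    intro q _
    simp only [ite_mul, one_mul, zero_mul]
    rw [← Finset.sum_filter]
    apply Finset.sum_congr _ (fun _ _ => rfl)
    ext k
    simp only [Finset.mem_filter, Finset.mem_range, Finset.mem_Ioc]
    constructor
    · rintro ⟨a, b, c⟩; exact ⟨⟨c, by omega⟩, b⟩
    · rintro ⟨⟨a, b⟩, c⟩; exact ⟨by omega, c, a⟩
  rw [Finset.sum_congr rfl e2]
  apply Finset.sum_comm'
  intro p q
  simp only [Finset.mem_filter, Finset.mem_Ioc, Finset.mem_Icc]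
  constructor
  · rintro ⟨⟨⟨a, b⟩, c⟩, ⟨d1, d2⟩, e⟩
    rw [Nat.le_div_iff_mul_le c.pos] at d2
    refine ⟨⟨⟨a, ?_⟩, c⟩, ⟨d1, ?_⟩, e⟩
    · rw [Nat.le_div_iff_mul_le e.pos, mul_comm]; exact d2
    · rw [Nat.le_div_iff_mul_le hw]; exact (Nat.mul_le_mul_left q a.le).trans d2
  · rintro ⟨⟨⟨a, b⟩, c⟩, ⟨d1, d2⟩, e⟩
    rw [Nat.le_div_iff_mul_le e.pos] at b
    refine ⟨⟨⟨a, ?_⟩, c⟩, ⟨d1, ?_⟩, e⟩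
    · exact (Nat.le_mul_of_pos_right p e.pos).trans b
    · rw [Nat.le_div_iff_mul_le c.pos, mul_comm]; exact b

lemma Y_moment (I : Finset ℕ) (δ : ℕ → ℕ) (D : ℝ) (n w : ℕ) (hw : 0 < w)
    (hinj : ∀ i ∈ I, ∀ j ∈ I, δ i = δ j → i = j)
    (hδ : ∀ i ∈ I, Squarefree (δ i) ∧ Odd (δ i) ∧ (δ i : ℝ) ≤ D) (hI : (I.card : ℝ) ≤ D) (hN : D^3 ≤ w) :
    ∑ i ∈ I, |Ysum n w (δ i)| ≤ 4 * n * (1 + Real.log n) * √(I.card) := by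
  calc ∑ i ∈ I, |Ysum n w (δ i)| ≤ ∑ i ∈ I, ∑ q ∈ (Finset.Icc 1 (n/w)).filter Nat.Prime,
    |∑ k ∈ Finset.range (n/q+1), (if k.Prime ∧ w < k then (1:ℝ) else 0) * JR k (δ i)| := by
        apply Finset.sum_le_sum
        intro i _
        rw [Ysum_eq n w _ hw]
        exact Finset.abs_sum_le_sum_abs _ _
    _ = ∑ q ∈ (Finset.Icc 1 (n/w)).filter Nat.Prime, ∑ i ∈ I,
    |∑ k ∈ Finset.range (n/q+1), (if k.Prime ∧ w < k then (1:ℝ) else 0) * JR k (δ i)| := Finset.sum_comm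
    _ ≤ ∑ q ∈ (Finset.Icc 1 (n/w)).filter Nat.Prime, 4 * n * √(I.card) * (q:ℝ)⁻¹ := by
        apply Finset.sum_le_sum
        intro q hq
        rw [Finset.mem_filter, Finset.mem_Icc] at hq
        have hq0 : 0 < q := hq.1.1
        have hwq : w ≤ n / q := by
          have := hq.1.2
          rw [Nat.le_div_iff_mul_le hw] at this
          rw [Nat.le_div_iff_mul_le hq0, mul_comm]; exact this
        have hwq' : (w:ℝ) ≤ ((n/q : ℕ):ℝ) := by exact_mod_cast hwq
        have hnq : ((n/q : ℕ):ℝ) ≤ n / q := Nat.cast_div_le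
        have hw1 : (1:ℝ) ≤ w := by exact_mod_cast hw
        have ls := large_sieve I δ D (n/q+1) (fun k => if k.Prime ∧ w < k then (1:ℝ) else 0) 1 zero_le_one hinj hδ hI
          (by push_cast; linarith) (by intro k; split_ifs <;> norm_num)
        refine ls.trans ?_
        push_cast
        calc 2 * 1 * (((n/q : ℕ):ℝ) + 1) * √(I.card) ≤ 2 * 1 * ((n/q:ℝ) + (n/q:ℝ)) * √(I.card) := by
              gcongr; linarith
          _ = _ := by ring
    _ = 4 * n * √(I.card) * ∑ q ∈ (Finset.Icc 1 (n/w)).filter Nat.Prime, (q:ℝ)⁻¹ := by rw [Finset.mul_sum]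
    _ ≤ 4 * n * √(I.card) * ∑ q ∈ (Finset.Icc 1 n), (q:ℝ)⁻¹ := by
        apply mul_le_mul_of_nonneg_left _ (by positivity)
        apply Finset.sum_le_sum_of_subset_of_nonneg
        · intro q hq
          rw [Finset.mem_filter, Finset.mem_Icc] at hq
          rw [Finset.mem_Icc]
          exact ⟨hq.1.1, hq.1.2.trans (Nat.div_le_self _ _)⟩
        · intros; positivity
    _ ≤ 4 * n * √(I.card) * (1 + Real.log n) := by
        gcongr
        have := harmonic_le_one_add_log n
        rw [harmonic_eq_sum_Icc] at this
        push_cast at this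
        exact this
    _ = _ := by ring

lemma S2_moment (I : Finset ℕ) (δ : ℕ → ℕ) (D : ℝ) (n : ℕ) (hn : 1 ≤ n)
    (hinj : ∀ i ∈ I, ∀ j ∈ I, δ i = δ j → i = j)
    (hδ : ∀ i ∈ I, Squarefree (δ i) ∧ Odd (δ i) ∧ (δ i : ℝ) ≤ D) (hI : (I.card : ℝ) ≤ D) (hN : D^3 ≤ n) :
    ∑ i ∈ I, |S2 n (δ i)| ≤ 8 * n * √(I.card) := by
  have hn' : (1:ℝ) ≤ n := by exact_mod_cast hn
  have ls := large_sieve I δ D (n+1) (acoef n) 2 (by norm_num) hinj hδ hI (by push_cast; linarith) (acoef_le n)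
  simp_rw [S2_eq]
  refine ls.trans ?_
  push_cast
  calc 2 * 2 * ((n:ℝ) + 1) * √(I.card) ≤ 2 * 2 * (n + n) * √(I.card) := by gcongr
    _ = _ := by ring

end

section
open Filter

/-- medium prime part -/
noncomputable def Xsum (n y z d : ℕ) : ℝ := ∑ p ∈ (Finset.Ioc y z).filter Nat.Prime, PIr (n/p) * JR p d

lemma core_count {y r : ℕ} (h : GoodR y r) (hy : 2 ≤ y) (R z w n Z : ℕ) (D U K : ℝ) (hU : 0 < U) (hK : 0 < K)
    (hD : ∀ m < R, ((r + Mmod y * m : ℕ) : ℝ) ≤ D) (hRD : (R:ℝ) ≤ D)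
    (hZ : ∀ m < R, r + Mmod y * m ≤ Z ^ 2) (hzw : z ≤ w) (hwn : w ≤ n) (hDw : D ^ 3 ≤ w) (hw : 0 < w)
    (hcr : ∀ p : ℕ, 1 ≤ p → p ≤ w → PIr (n/p) ≤ K * U / p) :
    ∃ G : Finset ℕ, (∀ m ∈ G, m < R ∧ Squarefree (r + Mmod y * m) ∧ |Xsum n y z (r + Mmod y * m)| ≤ K * U ∧
      |Ysum n w (r + Mmod y * m)| ≤ U ∧ |S2 n (r + Mmod y * m)| ≤ U) ∧
      (R:ℝ) - (R / y + Z) - (R / y + z^2) - (4 * n * (1 + Real.log n) * √R) / U - (8 * n * √R) / U ≤ G.card := by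
  classical
  set δ : ℕ → ℕ := fun m => r + Mmod y * m with hδdef
  set I := (Finset.range R).filter (fun m => Squarefree (δ m)) with hI
  set J := (Finset.range R).filter (fun m => ¬ Squarefree (δ m)) with hJ
  set B1 := (Finset.range R).filter (fun m => (K*U)^2 < (Xsum n y z (δ m))^2) with hB1
  set B2 := I.filter (fun m => U < |Ysum n w (δ m)|) with hB2
  set B3 := I.filter (fun m => U < |S2 n (δ m)|) with hB3
  have hinj : ∀ i ∈ I, ∀ j ∈ I, δ i = δ j → i = j := by
    intro i _ j _ hij
    simp only [hδdef] at hij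
    exact Nat.eq_of_mul_eq_mul_left (Mmod_pos y) (by omega)
  have hδ : ∀ i ∈ I, Squarefree (δ i) ∧ Odd (δ i) ∧ (δ i : ℝ) ≤ D := by
    intro i hi
    rw [hI, Finset.mem_filter, Finset.mem_range] at hi
    exact ⟨hi.2, h.odd i, hD i hi.1⟩
  have hIR : I.card ≤ R := by
    have := Finset.card_filter_le (Finset.range R) (fun m => Squarefree (δ m))
    rwa [Finset.card_range] at this
  have hIR' : (I.card:ℝ) ≤ R := by exact_mod_cast hIR
  have hsq : √(I.card:ℝ) ≤ √R := Real.sqrt_le_sqrt hIR'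
  have hn : 1 ≤ n := by omega
  have hn' : (1:ℝ) ≤ n := by exact_mod_cast hn
  have hln : 0 ≤ Real.log n := Real.log_nonneg hn'
  have cJ : (J.card:ℝ) ≤ R / y + Z := sqf_count h hy R Z hZ
  have cB1 : (B1.card:ℝ) ≤ R / y + z^2 := by
    have m1 := markov (Finset.range R) (fun m => (Xsum n y z (δ m))^2) (fun _ _ => sq_nonneg _) ((K*U)^2) (by positivity)
    have m2 := X_moment h hy R z (fun p => PIr (n/p)) (K*U) (by
      intro p hp
      rw [Finset.mem_filter, Finset.mem_Ioc] at hp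
      exact ⟨PIr_nonneg _, hcr p (by omega) (by omega)⟩)
    refine m1.trans ?_
    rw [div_le_iff₀ (by positivity), mul_comm]
    exact m2
  have cB2 : (B2.card:ℝ) ≤ (4 * n * (1 + Real.log n) * √R) / U := by
    have m1 := markov I (fun m => |Ysum n w (δ m)|) (fun _ _ => abs_nonneg _) U hU
    refine m1.trans ?_
    have m2 := Y_moment I δ D n w hw hinj hδ (hIR'.trans hRD) hDw
    apply div_le_div_of_nonneg_right _ hU.le
    exact m2.trans (by gcongr)
  have cB3 : (B3.card:ℝ) ≤ (8 * n * √R) / U := by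
    have m1 := markov I (fun m => |S2 n (δ m)|) (fun _ _ => abs_nonneg _) U hU
    refine m1.trans ?_
    have m2 := S2_moment I δ D n hn hinj hδ (hIR'.trans hRD) (hDw.trans (by exact_mod_cast hwn))
    apply div_le_div_of_nonneg_right _ hU.le
    exact m2.trans (by gcongr)
  refine ⟨(Finset.range R) \ (J ∪ B1 ∪ B2 ∪ B3), ?_, ?_⟩
  · intro m hm
    simp only [Finset.mem_sdiff, Finset.mem_union, not_or, Finset.mem_range] at hm
    obtain ⟨hmR, ⟨⟨h1, h2⟩, h3⟩, h4⟩ := hm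
    have hs : Squarefree (δ m) := by
      by_contra hcon
      exact h1 (Finset.mem_filter.mpr ⟨Finset.mem_range.mpr hmR, hcon⟩)
    have hmI : m ∈ I := Finset.mem_filter.mpr ⟨Finset.mem_range.mpr hmR, hs⟩
    refine ⟨hmR, hs, ?_, ?_, ?_⟩
    · by_contra hcon
      push Not at hcon
      apply h2
      rw [hB1, Finset.mem_filter]
      refine ⟨Finset.mem_range.mpr hmR, ?_⟩
      rw [← sq_abs (Xsum n y z (δ m))]
      have : 0 < K * U := by positivity
      exact pow_lt_pow_left₀ hcon this.le (by norm_num)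
    · by_contra hcon
      push Not at hcon
      exact h3 (Finset.mem_filter.mpr ⟨hmI, hcon⟩)
    · by_contra hcon
      push Not at hcon
      exact h4 (Finset.mem_filter.mpr ⟨hmI, hcon⟩)
  · have k1 : R ≤ ((Finset.range R) \ (J ∪ B1 ∪ B2 ∪ B3)).card + (J.card + B1.card + B2.card + B3.card) := by
      have a1 := Finset.le_card_sdiff (J ∪ B1 ∪ B2 ∪ B3) (Finset.range R)
      rw [Finset.card_range] at a1
      have a2 := Finset.card_union_le (J ∪ B1 ∪ B2) B3
      have a3 := Finset.card_union_le (J ∪ B1) B2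
      have a4 := Finset.card_union_le J B1
      omega
    have k2 : (R:ℝ) ≤ (((Finset.range R) \ (J ∪ B1 ∪ B2 ∪ B3)).card:ℝ) + ((J.card:ℝ) + B1.card + B2.card + B3.card) := by
      exact_mod_cast k1
    linarith

lemma omega_bound (d : ℕ) (hd : d ≠ 0) : (d.primeFactors.card : ℝ) ≤ 2 * Real.log d := by
  have h1 : 2 ^ d.primeFactors.card ≤ d := by
    calc 2 ^ d.primeFactors.card ≤ ∏ p ∈ d.primeFactors, p :=
          Finset.pow_card_le_prod _ _ _ (fun p hp => (Nat.prime_of_mem_primeFactors hp).two_le)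
      _ ≤ d := Nat.le_of_dvd (Nat.pos_of_ne_zero hd) (Nat.prod_primeFactors_dvd d)
  have h2 : ((2:ℝ) ^ d.primeFactors.card) ≤ d := by exact_mod_cast h1
  have h3 := Real.log_le_log (by positivity) h2
  rw [Real.log_pow] at h3
  have := Real.log_two_gt_d9
  have h5 : (0:ℝ) ≤ d.primeFactors.card := by positivity
  nlinarith

lemma E1_bound (n d y w : ℕ) (K U : ℝ) (hU : 0 < U) (hK : 0 < K) (hd : d ≠ 0) (hy : 0 < y)
    (hf : ∀ p : ℕ, p.Prime → p ∣ d → y < p) (hdw : d ≤ w)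
    (hcr : ∀ p : ℕ, 1 ≤ p → p ≤ w → PIr (n/p) ≤ K * U / p) :
    E1 n d ≤ 2 * Real.log d * (K * U / y) := by
  unfold E1
  simp only [ite_mul, one_mul, zero_mul]
  rw [← Finset.sum_filter]
  have hy' : (0:ℝ) < y := by exact_mod_cast hy
  calc _ ≤ ∑ p ∈ d.primeFactors, PIr (n/p) := by
        apply Finset.sum_le_sum_of_subset_of_nonneg
        · intro p hp
          rw [Finset.mem_filter, Finset.mem_filter] at hp
          exact Nat.mem_primeFactors.mpr ⟨hp.1.2, hp.2, hd⟩
        · intros; exact PIr_nonneg _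
    _ ≤ ∑ p ∈ d.primeFactors, K * U / y := by
        apply Finset.sum_le_sum
        intro p hp
        have hp' := Nat.mem_primeFactors.mp hp
        refine (hcr p hp'.1.pos ((Nat.le_of_dvd (Nat.pos_of_ne_zero hd) hp'.2.1).trans hdw)).trans ?_
        have : y ≤ p := (hf p hp'.1 hp'.2.1).le
        gcongr
    _ = d.primeFactors.card * (K * U / y) := by simp
    _ ≤ _ := by
        gcongr
        exact omega_bound d hd

lemma S1_bound {y r : ℕ} (h : GoodR y r) (m n z w : ℕ) (K U V W : ℝ) (hU : 0 < U) (hK : 0 < K)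
    (hyz : y ≤ z) (hzw : z ≤ w) (hwn : w ≤ n)
    (hcr : ∀ p : ℕ, 1 ≤ p → p ≤ w → PIr (n/p) ≤ K * U / p)
    (hT : V ≤ ∑ p ∈ (Finset.Icc 1 y).filter Nat.Prime, PIr (n/p))
    (hW : Rec w - Rec z ≤ W)
    (hX : |Xsum n y z (r + Mmod y * m)| ≤ K * U) (hY : |Ysum n w (r + Mmod y * m)| ≤ U) :
    S1 n (r + Mmod y * m) ≤ - V + K * U + K * U * W + U := by
  unfold S1
  set d := r + Mmod y * m with hd
  rw [prime_split _ w n hwn, prime_split _ z w hzw, prime_split _ y z hyz]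
  have e1 : ∑ p ∈ (Finset.Icc 1 y).filter Nat.Prime, JR p d * PIr (n/p) = - ∑ p ∈ (Finset.Icc 1 y).filter Nat.Prime, PIr (n/p) := by
    rw [← Finset.sum_neg_distrib]
    apply Finset.sum_congr rfl
    intro p hp
    rw [Finset.mem_filter, Finset.mem_Icc] at hp
    rw [h.small m p hp.2 hp.1.2]; ring
  have e2 : ∑ p ∈ (Finset.Ioc y z).filter Nat.Prime, JR p d * PIr (n/p) = Xsum n y z d := by
    unfold Xsum
    apply Finset.sum_congr rfl
    intros; ring
  have e3 : ∑ p ∈ (Finset.Ioc z w).filter Nat.Prime, JR p d * PIr (n/p) ≤ K * U * W := by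
    calc _ ≤ ∑ p ∈ (Finset.Ioc z w).filter Nat.Prime, K * U * (1 / (p:ℝ)) := by
          apply Finset.sum_le_sum
          intro p hp
          rw [Finset.mem_filter, Finset.mem_Ioc] at hp
          have a1 := hcr p (by omega) hp.1.2
          have a2 := PIr_nonneg (n/p)
          have a3 := (abs_le.mp (JR_abs p d)).2
          rw [mul_one_div]
          nlinarith
      _ = K * U * (Rec w - Rec z) := by rw [← Finset.mul_sum, Rec_diff z w hzw]
      _ ≤ _ := by gcongr
  have e4 : ∑ p ∈ (Finset.Ioc w n).filter Nat.Prime, JR p d * PIr (n/p) = Ysum n w d := rfl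
  rw [e1, e2, e4]
  have := (abs_le.mp hX).2
  have := (abs_le.mp hY).2
  linarith

lemma final_ratio (N N0 N1 s1 s2 e U ll lll A2 A3 : ℝ) (hU : 0 < U) (hN1 : 0 ≤ N1) (hll : 0 < ll) (hA2 : 0 < A2)
    (h1 : 4 * N1 ≤ N + 2 * s1 + s2) (h2 : N ≤ N0 + 2 * e) (h2' : N0 ≤ N) (h3 : 2 * s1 + s2 + 2 * e ≤ - (2 * U * (lll - A3)))
    (h4 : A3 < lll) (hN : N ≤ 2 * U * (ll + A2)) (h5 : A2 * (lll - A3 - 1) ≤ ll) :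
    N1 / ((1/4) * N0) ≤ 1 - (lll - (A3 + 1)) / ll := by
  set Q := 2 * U * (lll - A3) with hQ
  have hQ0 : 0 < Q := by
    have : 0 < lll - A3 := by linarith
    positivity
  have hN0 : 0 < N0 := by linarith
  have k1 : N1 / ((1/4) * N0) ≤ 1 - Q / N0 := by
    rw [div_le_iff₀ (by positivity)]
    have : (1 - Q / N0) * (1/4 * N0) = (N0 - Q) / 4 := by field_simp
    rw [this]; linarith
  have k2 : (lll - A3) / (ll + A2) ≤ Q / N0 := by
    rw [div_le_div_iff₀ (by positivity) hN0, hQ]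
    have : 0 < lll - A3 := by linarith
    nlinarith
  have k3 : (lll - (A3 + 1)) / ll ≤ (lll - A3) / (ll + A2) := by
    rw [div_le_div_iff₀ hll (by positivity)]
    nlinarith
  linarith


end

section
open Filter

lemma par_y (η : ℝ) (hη : 0 < η) : ∀ᶠ L : ℝ in atTop, 8 ≤ ⌊η * L⌋₊ ∧ η * L / 2 ≤ (⌊η * L⌋₊ : ℝ) ∧ (⌊η * L⌋₊ : ℝ) ≤ η * L ∧
    Real.log (Real.log (Real.log (Real.exp (L^2)))) - 2 ≤ Real.log (Real.log (⌊η * L⌋₊ : ℝ)) := by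
  filter_upwards [eventually_ge_atTop (9/η), eventually_ge_atTop 1, Real.tendsto_log_atTop.eventually_ge_atTop (-2 * Real.log (η/2)), Real.tendsto_log_atTop.eventually_ge_atTop 1] with L h1 h2 h3 h4
  have hL : 9 ≤ η * L := by rw [div_le_iff₀ hη] at h1; linarith
  have a := Nat.lt_floor_add_one (η * L)
  have b : η * L / 2 ≤ (⌊η * L⌋₊ : ℝ) := by linarith
  refine ⟨Nat.le_floor (by push_cast; linarith), b, Nat.floor_le (by linarith), ?_⟩
  rw [Real.log_exp]
  have c1 : Real.log (L^2) = 2 * Real.log L := by rw [Real.log_pow]; norm_num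
  rw [c1]
  have c2 : Real.log L / 2 ≤ Real.log (⌊η * L⌋₊ : ℝ) := by
    have : Real.log (η * L / 2) ≤ Real.log (⌊η * L⌋₊ : ℝ) := Real.log_le_log (by linarith) b
    have e : η * L / 2 = (η / 2) * L := by ring
    rw [e, Real.log_mul (by positivity) (by positivity)] at this
    linarith
  have c3 : Real.log (Real.log L / 2) ≤ Real.log (Real.log (⌊η * L⌋₊ : ℝ)) := Real.log_le_log (by linarith) c2
  rw [Real.log_div (by linarith) (by norm_num)] at c3
  rw [Real.log_mul (by norm_num) (by linarith)]
  have := Real.log_two_lt_d9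
  linarith

lemma par_zw : ∀ᶠ L : ℝ in atTop, Real.exp (3 * L) ≤ (⌊Real.exp (4 * L)⌋₊ : ℝ) ∧ (⌊Real.exp (4 * L)⌋₊ : ℝ) ≤ Real.exp (L^2/2) ∧
    L ≤ (⌊Real.exp (L/4)⌋₊ : ℝ) ∧ ⌊Real.exp (L/4)⌋₊ ≤ ⌊Real.exp (4 * L)⌋₊ ∧ 3 ≤ ⌊Real.exp (L/4)⌋₊ ∧
    Real.log (Real.log (⌊Real.exp (4 * L)⌋₊ : ℝ)) - Real.log (Real.log (⌊Real.exp (L/4)⌋₊ : ℝ)) ≤ 31 := by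
  filter_upwards [eventually_ge_atTop 100] with L hL
  have f1 := Nat.lt_floor_add_one (Real.exp (4 * L))
  have f2 := Nat.floor_le (Real.exp_pos (4 * L)).le
  have g1 := Nat.lt_floor_add_one (Real.exp (L/4))
  have g2 := Nat.floor_le (Real.exp_pos (L/4)).le
  have e1 : Real.exp (4 * L) = Real.exp (3 * L) * Real.exp L := by rw [← Real.exp_add]; ring_nf
  have e2 : L + 1 ≤ Real.exp L := Real.add_one_le_exp L
  have e3 : 1 ≤ Real.exp (3 * L) := Real.one_le_exp (by linarith)
  have e4 : Real.exp (L/4) = Real.exp (L/8) * Real.exp (L/8) := by rw [← Real.exp_add]; ring_nf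
  have e5 : L / 8 + 1 ≤ Real.exp (L/8) := Real.add_one_le_exp _
  have w1 : Real.exp (3 * L) ≤ (⌊Real.exp (4 * L)⌋₊ : ℝ) := by nlinarith
  have z1 : Real.exp (L/8) ≤ (⌊Real.exp (L/4)⌋₊ : ℝ) := by nlinarith
  have z2 : L ≤ (⌊Real.exp (L/4)⌋₊ : ℝ) := by nlinarith
  refine ⟨w1, f2.trans (Real.exp_le_exp.mpr (by nlinarith)), z2, Nat.floor_mono (Real.exp_le_exp.mpr (by linarith)), ?_, ?_⟩
  · have : (3:ℝ) ≤ (⌊Real.exp (L/4)⌋₊ : ℝ) := by linarith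
    exact_mod_cast this
  · have lw : Real.log (⌊Real.exp (4 * L)⌋₊ : ℝ) ≤ 4 * L := by
      have := Real.log_le_log (by linarith) f2
      rwa [Real.log_exp] at this
    have lw0 : 3 * L ≤ Real.log (⌊Real.exp (4 * L)⌋₊ : ℝ) := by
      have := Real.log_le_log (by linarith) w1
      rwa [Real.log_exp] at this
    have lz : L / 8 ≤ Real.log (⌊Real.exp (L/4)⌋₊ : ℝ) := by
      have := Real.log_le_log (by linarith) z1
      rwa [Real.log_exp] at this
    have k1 := Real.log_le_log (by linarith) lw
    have k2 := Real.log_le_log (by linarith) lz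
    have k3 : Real.log (4 * L) = Real.log 32 + Real.log (L/8) := by
      rw [← Real.log_mul (by norm_num) (by linarith)]; congr 1; ring
    have k4 := Real.log_le_sub_one_of_pos (by norm_num : (0:ℝ) < 32)
    linarith

lemma par_poly : ∀ᶠ L : ℝ in atTop, 4 * L^2 * (1 + L^2) + 8 * L^2 ≤ Real.exp (7/16*L) / 12 := by
  have h := (isLittleO_pow_exp_pos_mul_atTop 4 (by norm_num : (0:ℝ) < 7/16)).def (by norm_num : (0:ℝ) < 1/192)
  filter_upwards [h, eventually_ge_atTop 1] with L h h1
  rw [Real.norm_of_nonneg (by positivity), Real.norm_of_nonneg (Real.exp_pos _).le] at h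
  have : L^2 ≤ L^4 := pow_le_pow_right₀ h1 (by norm_num)
  nlinarith

lemma exp_aux (L : ℝ) (hL : 20 ≤ L) : 100 * Real.exp (L/2) ≤ Real.exp (7/8 * L) := by
  have e : Real.exp (7/8 * L) = Real.exp (3/8 * L) * Real.exp (L/2) := by
    rw [← Real.exp_add]; ring_nf
  have e2 : Real.exp (3/8 * L) = (Real.exp (3/64 * L))^8 := by
    rw [← Real.exp_nat_mul]; congr 1; push_cast; ring
  have e5 := Real.add_one_le_exp (3/64*L)
  have e6 : (1.9:ℝ)^8 ≤ (Real.exp (3/64*L))^8 := pow_le_pow_left₀ (by norm_num) (by linarith) 8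
  have e7 : (100:ℝ) ≤ 1.9^8 := by norm_num
  rw [e, e2]
  exact mul_le_mul_of_nonneg_right (e7.trans e6) (Real.exp_pos _).le

lemma par_count (ε η : ℝ) (hη : 0 < η) (hη1 : η ≤ 1/16) (hη2 : η ≤ ε/4) : ∀ᶠ L : ℝ in atTop,
    ∀ R : ℕ, R = ⌊Real.exp L / Mmod ⌊η * L⌋₊⌋₊ →
    (R:ℝ) ≤ Real.exp L ∧ (R:ℝ) * Mmod ⌊η * L⌋₊ ≤ Real.exp L ∧
    Real.exp ((1-ε) * L) ≤ (R:ℝ) - (R / (⌊η * L⌋₊:ℝ) + ((⌊Real.exp (L/2)⌋₊ + 1 : ℕ) : ℝ)) - (R / (⌊η * L⌋₊:ℝ) + (⌊Real.exp (L/4)⌋₊:ℝ)^2)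
      - 4 * L^2 * (1 + L^2) * √R - 8 * L^2 * √R := by
  filter_upwards [par_y η hη, par_poly, eventually_ge_atTop 20, eventually_ge_atTop (62/ε)] with L hy hp hL hLε
  intro R hR
  set y := ⌊η * L⌋₊ with hydef
  obtain ⟨y8, yl, yu, -⟩ := hy
  have hε : 0 < ε := by linarith
  have hMp : (0:ℝ) < Mmod y := by exact_mod_cast Mmod_pos y
  have hM1 : (1:ℝ) ≤ Mmod y := by exact_mod_cast Mmod_pos y
  have hM : (Mmod y:ℝ) ≤ 4 * Real.exp (2 * η * L) := by
    have a : (Mmod y : ℝ) ≤ 4 * 4 ^ y := by exact_mod_cast Mmod_le y (by omega)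
    refine a.trans ?_
    gcongr
    calc (4:ℝ)^y ≤ (Real.exp 2)^y := by
          gcongr
          have := Real.add_one_le_exp (1:ℝ)
          have e : Real.exp 2 = Real.exp 1 * Real.exp 1 := by rw [← Real.exp_add]; norm_num
          rw [e]; calc (4:ℝ) = 2 * 2 := by norm_num
            _ ≤ _ := mul_le_mul (by linarith) (by linarith) (by norm_num) (Real.exp_pos 1).le
      _ = Real.exp (2 * y) := by rw [← Real.exp_nat_mul]; ring_nf
      _ ≤ _ := Real.exp_le_exp.mpr (by linarith)
  have hRu : (R:ℝ) ≤ Real.exp L / Mmod y := by rw [hR]; exact Nat.floor_le (by positivity)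
  have hRl : Real.exp L / Mmod y < R + 1 := by rw [hR]; exact Nat.lt_floor_add_one _
  have q1 : Real.exp ((1 - 2 * η) * L) / 4 ≤ Real.exp L / Mmod y := by
    rw [div_le_div_iff₀ (by norm_num) hMp]
    calc _ ≤ Real.exp ((1 - 2 * η) * L) * (4 * Real.exp (2 * η * L)) := by gcongr
      _ = Real.exp ((1 - 2 * η) * L + 2 * η * L) * 4 := by rw [Real.exp_add]; ring
      _ = _ := by ring_nf
  have q2 : Real.exp (7/8 * L) ≤ Real.exp ((1 - 2 * η) * L) := Real.exp_le_exp.mpr (mul_le_mul_of_nonneg_right (by linarith) (by linarith))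
  have q3 : 7/8 * L + 1 ≤ Real.exp (7/8 * L) := Real.add_one_le_exp _
  have hR8 : Real.exp ((1 - 2 * η) * L) / 8 ≤ R := by linarith
  have hR0 : (0:ℝ) < R := by have := Real.exp_pos ((1 - 2 * η) * L); linarith
  refine ⟨hRu.trans (div_le_self (Real.exp_pos _).le hM1), by rwa [le_div_iff₀ hMp] at hRu, ?_⟩
  have y8' : (8:ℝ) ≤ y := by exact_mod_cast y8
  have t1 : (R:ℝ) / y ≤ R / 8 := by gcongr
  have t2 : ((⌊Real.exp (L/2)⌋₊ + 1 : ℕ) : ℝ) ≤ Real.exp (L/2) + 1 := by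
    push_cast; linarith [Nat.floor_le (Real.exp_pos (L/2)).le]
  have t3 : (⌊Real.exp (L/4)⌋₊:ℝ)^2 ≤ Real.exp (L/2) := by
    have e : Real.exp (L/2) = (Real.exp (L/4))^2 := by rw [sq, ← Real.exp_add]; ring_nf
    rw [e]
    exact pow_le_pow_left₀ (by positivity) (Nat.floor_le (Real.exp_pos _).le) 2
  have t4 : 2 * Real.exp (L/2) + 1 ≤ R / 4 := by
    have e8 := exp_aux L hL
    have e1 : L/2 + 1 ≤ Real.exp (L/2) := Real.add_one_le_exp _
    linarith
  have t5 : Real.exp (7/16*L) / 3 ≤ √R := by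
    apply Real.le_sqrt_of_sq_le
    have e : Real.exp (7/8 * L) = (Real.exp (7/16*L))^2 := by rw [sq, ← Real.exp_add]; ring_nf
    rw [div_pow, ← e]; linarith [Real.exp_pos (7/8*L)]
  have t6 : 4 * L^2 * (1 + L^2) * √R + 8 * L^2 * √R ≤ R / 4 := by
    have : √(R:ℝ) * √R = R := Real.mul_self_sqrt hR0.le
    have h0 := Real.sqrt_nonneg (R:ℝ)
    calc _ = (4 * L^2 * (1 + L^2) + 8 * L^2) * √R := by ring
      _ ≤ (√R / 4) * √R := by gcongr; linarith
      _ = _ := by rw [div_mul_eq_mul_div, this]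
  have t7 : Real.exp ((1-ε) * L) ≤ R / 4 := by
    have e : Real.exp ((1 - 2 * η) * L) = Real.exp ((1-ε) * L) * Real.exp ((ε - 2 * η) * L) := by
      rw [← Real.exp_add]; ring_nf
    have e1 : 31 ≤ (ε - 2 * η) * L := by
      rw [div_le_iff₀ hε] at hLε
      have : (ε/2) * L ≤ (ε - 2 * η) * L := mul_le_mul_of_nonneg_right (by linarith) (by linarith)
      linarith
    have e2 := Real.add_one_le_exp ((ε - 2 * η) * L)
    have e3 := Real.exp_pos ((1-ε) * L)
    have e4 : Real.exp ((1-ε) * L) * 32 ≤ Real.exp ((1-ε) * L) * Real.exp ((ε - 2 * η) * L) := mul_le_mul_of_nonneg_left (by linarith) e3.le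
    linarith
  linarith

end

lemma pairCount_eq (x : ℝ) (hx : 0 ≤ x) (P : ℕ → ℕ → Prop) [DecidablePred (fun pq : ℕ × ℕ => P pq.1 pq.2)] :
    pairCount x P = ((PP ⌊x⌋₊).filter (fun pq => P pq.1 pq.2)).card := by
  unfold pairCount
  apply Nat.subtype_card
  intro pq
  rw [Finset.mem_filter, mem_PP, Nat.le_floor_iff hx]
  tauto

lemma jchar_one_iff (d k : ℕ) [NeZero d] : jchar d (k : ZMod d) = 1 ↔ JR k d = 1 := by
  rw [jchar_apply]
  unfold JR
  constructor
  · intro h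
    have : jacobiSym (k:ℤ) d = 1 := by exact_mod_cast h
    rw [this]; norm_num
  · intro h
    have : jacobiSym (k:ℤ) d = 1 := by exact_mod_cast h
    rw [this]; norm_num

lemma race_eq (x : ℝ) (hx : 0 ≤ x) (d : ℕ) [NeZero d] : raceRatio (jchar d) 1 x =
    (((PP ⌊x⌋₊).filter (fun pq => JR pq.1 d = 1 ∧ JR pq.2 d = 1)).card : ℝ) /
      ((1/4) * (((PP ⌊x⌋₊).filter (fun pq => Nat.gcd (pq.1*pq.2) d = 1)).card : ℝ)) := by
  classical
  unfold raceRatio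
  rw [pairCount_eq x hx, pairCount_eq x hx]
  simp only [jchar_one_iff]

set_option maxHeartbeats 1000000

/-- fix `ε > 0`; with `D(x) = exp (C (log x)^{1/2})` for a suitable `C > 0`,
there is `A > 0` such that for all large `x` there are at least `D(x)^{1-ε}` fundamental
discriminants `d ≤ D(x)` whose real primitive character `χ_d` satisfies
`raceRatio ≤ 1 - (log log log x - A)/log log x`. -/
theorem statement_3 (ε : ℝ) (hε : 0 < ε) :
    ∃ C > (0:ℝ), ∃ A > (0:ℝ), ∀ᶠ x : ℝ in atTop,
      Real.exp (C * Real.sqrt (Real.log x)) ^ (1 - ε) ≤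
        (Nat.card {d : ℕ // (d : ℝ) ≤ Real.exp (C * Real.sqrt (Real.log x)) ∧
          IsFundamentalDiscriminant d ∧
          ∃ χ : DirichletCharacter ℂ d, χ.IsPrimitive ∧ MulChar.IsQuadratic χ ∧
            raceRatio χ 1 x ≤
              1 - (Real.log (Real.log (Real.log x)) - A) / Real.log (Real.log x)} : ℝ) := by
  classical
  set η : ℝ := min ε (1/4) / 4 with hηdef
  have hη : 0 < η := by have : 0 < min ε (1/4) := lt_min hε (by norm_num); positivity
  have hη1 : η ≤ 1/16 := by have := min_le_right ε (1/4); linarith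
  have hη2 : η ≤ ε/4 := by have := min_le_left ε (1/4); linarith
  obtain ⟨K, hK, hcrude⟩ := pi_crude
  obtain ⟨A2, hA2, hNup⟩ := N_upper
  obtain ⟨AT, hAT, hTlow⟩ := T_lower
  obtain ⟨AR, hAR, hRec⟩ := Rec_upper
  set A3 : ℝ := 2 + AT + K + K * (32 + AR) + 1 + 1/2 + 4 * K / η with hA3
  have hA3p : 0 < A3 := by positivity
  refine ⟨1, one_pos, A3 + 1, by linarith, ?_⟩
  have hsqrt : Tendsto (fun x : ℝ => √(Real.log x)) atTop atTop := Real.tendsto_sqrt_atTop.comp Real.tendsto_log_atTop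
  have hlo : ∀ᶠ x : ℝ in atTop, A2 * Real.log (Real.log (Real.log x)) ≤ Real.log (Real.log x) := by
    have h := (Real.isLittleO_log_id_atTop.comp_tendsto tendsto_ll).def (by positivity : 0 < 1 / A2)
    filter_upwards [h, tendsto_ll.eventually_ge_atTop 1] with x h h1
    simp only [Function.comp, id] at h
    rw [Real.norm_of_nonneg (Real.log_nonneg h1), Real.norm_of_nonneg (by linarith), one_div_mul_eq_div, le_div_iff₀ hA2] at h
    linarith
  filter_upwards [hcrude, hNup, hTlow, hlo, hsqrt.eventually (par_y η hη), hsqrt.eventually par_zw,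
    hsqrt.eventually (par_count ε η hη hη1 hη2), hsqrt.eventually_ge_atTop 1, tendsto_ll.eventually_ge_atTop 1,
    tendsto_lll.eventually_gt_atTop A3, eventually_ge_atTop 1] with x hcr hN hT hlo hy hzw hcount hL1 hll1 hlll hx1
  set L := √(Real.log x) with hL
  have hlx : 0 ≤ Real.log x := Real.log_nonneg hx1
  have hL2 : L^2 = Real.log x := Real.sq_sqrt hlx
  have hxL : Real.exp (L^2) = x := by rw [hL2, Real.exp_log (by linarith)]
  have hL0 : 0 < L := by linarith
  have hl0 : 0 < Real.log x := by rw [← hL2]; positivity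
  have hx0 : 0 < x := by linarith
  have hsx : √x = Real.exp (L^2/2) := by
    rw [Real.exp_half, hxL]
  rw [hxL] at hy
  set y := ⌊η * L⌋₊ with hydef
  set z := ⌊Real.exp (L/4)⌋₊ with hzdef
  set w := ⌊Real.exp (4 * L)⌋₊ with hwdef
  set n := ⌊x⌋₊ with hndef
  set Z := ⌊Real.exp (L/2)⌋₊ + 1 with hZdef
  set R := ⌊Real.exp L / Mmod y⌋₊ with hRdef
  set U := x / Real.log x with hUdef
  have hU : 0 < U := by positivity
  obtain ⟨y8, yl, yu, yll⟩ := hy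
  obtain ⟨w1, w2, z1, zw, z3, zwll⟩ := hzw
  obtain ⟨R1, R2, R3⟩ := hcount R rfl
  obtain ⟨r, hr⟩ := exists_goodR y
  have hdD : ∀ m < R, ((r + Mmod y * m : ℕ) : ℝ) ≤ Real.exp L := by
    intro m hm
    have a1 : r + Mmod y * m ≤ R * Mmod y := by
      have := hr.lt
      calc r + Mmod y * m ≤ Mmod y * (m + 1) := by rw [mul_add]; omega
        _ ≤ Mmod y * R := Nat.mul_le_mul_left _ hm
        _ = _ := mul_comm _ _
    have a2 : ((r + Mmod y * m : ℕ) : ℝ) ≤ (R:ℝ) * Mmod y := by exact_mod_cast a1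
    linarith
  have hZ : ∀ m < R, r + Mmod y * m ≤ Z^2 := by
    intro m hm
    have a1 := hdD m hm
    have a2 : Real.exp L ≤ (Z:ℝ)^2 := by
      have e : Real.exp L = (Real.exp (L/2))^2 := by rw [sq, ← Real.exp_add]; ring_nf
      rw [e]
      apply pow_le_pow_left₀ (Real.exp_pos _).le
      rw [hZdef]; push_cast; exact (Nat.lt_floor_add_one _).le
    exact_mod_cast a1.trans a2
  have hD3 : (Real.exp L)^3 ≤ (w:ℝ) := by
    rw [← Real.exp_nat_mul]; exact_mod_cast w1
  have hDw : Real.exp L ≤ (w:ℝ) := by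
    refine le_trans (Real.exp_le_exp.mpr (by linarith)) w1
  have hw0 : 0 < w := by
    have : (0:ℝ) < w := (Real.exp_pos _).trans_le hDw
    exact_mod_cast this
  have hwx : (w:ℝ) ≤ √x := by rw [hsx]; exact w2
  have hwn : w ≤ n := by
    apply Nat.le_floor
    refine hwx.trans ?_
    rw [Real.sqrt_le_left (by linarith), sq]
    exact le_mul_of_one_le_left hx0.le hx1
  have hyz : y ≤ z := by
    have : (y:ℝ) ≤ z := by
      have : η * L ≤ 1 * L := mul_le_mul_of_nonneg_right (by linarith) hL0.le
      linarith
    exact_mod_cast this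
  have hcr' : ∀ p : ℕ, 1 ≤ p → p ≤ w → PIr (n/p) ≤ K * U / p := by
    intro p hp hpw
    have : (p:ℝ) ≤ w := by exact_mod_cast hpw
    exact hcr p hp (this.trans hwx)
  obtain ⟨G, hG1, hG2⟩ := core_count hr (by omega) R z w n Z (Real.exp L) U K hU hK hdD R1 hZ zw hwn hD3 hw0 hcr'
  have hn1 : 1 ≤ n := by omega
  have hnx : (n:ℝ) ≤ x := Nat.floor_le hx0.le
  have hn1' : (1:ℝ) ≤ n := by exact_mod_cast hn1
  have hlnn : Real.log n ≤ L^2 := by rw [hL2]; exact Real.log_le_log (by linarith) hnx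
  have hlnn0 : 0 ≤ Real.log n := Real.log_nonneg hn1'
  have hnU : (n:ℝ) / U ≤ L^2 := by
    rw [div_le_iff₀ hU, hUdef, hL2]
    rw [mul_div_cancel₀ _ hl0.ne']; exact hnx
  have hGc : Real.exp ((1-ε) * L) ≤ (G.card:ℝ) := by
    have b1 : (4 * n * (1 + Real.log n) * √R) / U ≤ 4 * L^2 * (1 + L^2) * √R := by
      calc _ = 4 * (n/U) * (1 + Real.log n) * √R := by ring
        _ ≤ _ := by gcongr
    have b2 : (8 * n * √R) / U ≤ 8 * L^2 * √R := by
      calc _ = 8 * (n/U) * √R := by ring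
        _ ≤ _ := by gcongr
    linarith
  have hW : Rec w - Rec z ≤ 32 + AR := by
    have c1 := hRec w (by omega)
    have c2 := Rec_lower z (by omega)
    linarith
  have hTy := hT y (by omega) (le_trans (by exact_mod_cast hyz.trans zw) hwx)
  -- the good moduli
  have hgood : ∀ m ∈ G, ((r + Mmod y * m : ℕ) : ℝ) ≤ Real.exp (1 * L) ∧
          IsFundamentalDiscriminant (r + Mmod y * m) ∧
          ∃ χ : DirichletCharacter ℂ (r + Mmod y * m), χ.IsPrimitive ∧ MulChar.IsQuadratic χ ∧
            raceRatio χ 1 x ≤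
              1 - (Real.log (Real.log (Real.log x)) - (A3 + 1)) / Real.log (Real.log x) := by
    intro m hm
    obtain ⟨g1, g2, g3, g4, g5⟩ := hG1 m hm
    have hmod := hr.mod8 m
    have hd0 : r + Mmod y * m ≠ 0 := by omega
    haveI : NeZero (r + Mmod y * m) := ⟨hd0⟩
    have hodd := hr.odd m
    have hfac := hr.factor_gt m
    have hdm := hdD m g1
    have hs1 := S1_bound hr m n z w K U _ (32 + AR) hU hK hyz zw hwn hcr' hTy hW g3 g4
    set d := r + Mmod y * m with hd
    refine ⟨by rw [one_mul]; exact hdm, ⟨by omega, Or.inl ⟨by omega, g2⟩⟩, jchar d, jchar_prim d g2 hodd, jchar_quad d, ?_⟩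
    rw [race_eq x hx0.le d]
    have hE := E1_bound n d y w K U hU hK hd0 (by omega) hfac (by exact_mod_cast hdm.trans hDw) hcr'
    have hE' : E1 n d ≤ U * (4 * K / η) := by
      refine hE.trans ?_
      have hld : Real.log d ≤ L := by
        have := Real.log_le_log (by exact_mod_cast Nat.pos_of_ne_zero hd0) hdm
        rwa [Real.log_exp] at this
      have hyη : (0:ℝ) < η * L / 2 := by positivity
      calc 2 * Real.log d * (K * U / y) ≤ 2 * L * (K * U / (η * L / 2)) := by gcongr
        _ = _ := by field_simp; ring
    have hs2 := (abs_le.mp g5).2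
    refine final_ratio (PP n).card _ _ (S1 n d) (S2 n d) (E1 n d) U _ _ A2 A3 hU (by positivity) (by linarith) hA2
      (race_upper n d) (race_lower n d) (by exact_mod_cast Finset.card_filter_le _ _) ?_ hlll ?_ ?_
    · have hyll' : U * (Real.log (Real.log (Real.log x)) - 2 - AT) ≤ U * (Real.log (Real.log y) - AT) :=
        mul_le_mul_of_nonneg_left (by linarith) hU.le
      have : 2 * U * (Real.log (Real.log (Real.log x)) - A3) =
        2 * (U * (Real.log (Real.log (Real.log x)) - 2 - AT)) - 2 * (K * U) - 2 * (K * U * (32 + AR)) - 2 * U - U - 2 * (U * (4 * K / η)) := by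
        rw [hA3]; ring
      rw [this]
      linarith
    · exact hN
    · have : A2 * (Real.log (Real.log (Real.log x)) - A3 - 1) ≤ A2 * Real.log (Real.log (Real.log x)) :=
        mul_le_mul_of_nonneg_left (by linarith) hA2.le
      linarith
  have hinj : Set.InjOn (fun m => r + Mmod y * m) (G : Set ℕ) := by
    intro a _ b _ hab
    simp only at hab
    exact Nat.eq_of_mul_eq_mul_left (Mmod_pos y) (by omega)
  set Sset := {d : ℕ | (d : ℝ) ≤ Real.exp (1 * L) ∧
          IsFundamentalDiscriminant d ∧
          ∃ χ : DirichletCharacter ℂ d, χ.IsPrimitive ∧ MulChar.IsQuadratic χ ∧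
            raceRatio χ 1 x ≤
              1 - (Real.log (Real.log (Real.log x)) - (A3 + 1)) / Real.log (Real.log x)} with hSset
  have hfin : Sset.Finite := by
    apply (Set.finite_Iic ⌊Real.exp (1 * L)⌋₊).subset
    intro d hd
    exact Nat.le_floor hd.1
  have hcard : G.card ≤ Nat.card Sset := by
    rw [← Finset.card_image_of_injOn hinj, Nat.card_coe_set_eq, ← Set.ncard_coe_finset]
    apply Set.ncard_le_ncard _ hfin
    intro d hd
    rw [Finset.mem_coe, Finset.mem_image] at hd
    obtain ⟨m, hm, rfl⟩ := hd
    exact hgood m hm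
  have hcard' : (G.card:ℝ) ≤ (Nat.card Sset : ℝ) := by exact_mod_cast hcard
  refine le_trans ?_ (hGc.trans hcard')
  rw [one_mul, ← Real.exp_mul, mul_comm]
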